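/- Fix d ∈ ℕ, d ≥ 1, and θ ∈ (0,1). There exist constants Λ = Λ(d) > 0 and Δ = Δ(d,θ) > 0 with the following property. Let m, n, l ∈ ℕ with m = 2^l and m ≤ n, let a, b be reals with θ < a < b < 1/θ, let c > 1, and let S ⊆ ℤ^d ∩ [0, c·n]^d be a finite set with |S| = n^d such that a·n^d/m^d ≤ |S ∩ (c·n·T)| ≤ b·n^d/m^d for every T ∈ 𝒯_m. Then there exists a bijection g : S → {1,…,n}^d with Lipschitz constant (Euclidean metric) Lip(g) ≤ Λ · 2^(log₂ n − l·(1 − Δ·(b − a))). -/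

import Mathlib

/-- Euclidean distance between two points of the integer lattice `ℤ^d`. -/
noncomputable def zdist {d : ℕ} (x y : Fin d → ℤ) : ℝ :=
  Real.sqrt (∑ i, ((x i : ℝ) - (y i : ℝ)) ^ 2)

section
open MeasureTheory Set

noncomputable def tGp (γ : ℝ → ℝ) (s v : ℝ) : ℝ :=
  (∫ u in (0:ℝ)..v, γ u) + (1/4) * ((∫ u in v..(v+s), γ u) - ∫ u in (v-s)..v, γ u)

noncomputable def tAv (γ : ℝ → ℝ) (s v : ℝ) : ℝ :=
  (1/4) * γ (v - s) + (1/2) * γ v + (1/4) * γ (v + s)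

noncomputable def tTt (γ : ℝ → ℝ) (s x : ℝ) : ℝ :=
  Function.invFun (tGp γ s) (∫ u in (0:ℝ)..x, γ u)

lemma tGp_eq {γ : ℝ → ℝ} (hc : Continuous γ) (s v : ℝ) :
    tGp γ s v = (1/2) * (∫ u in (0:ℝ)..v, γ u) + (1/4) * (∫ u in (0:ℝ)..(v+s), γ u)
      + (1/4) * (∫ u in (0:ℝ)..(v-s), γ u) := by
  have i : ∀ a b, IntervalIntegrable γ volume a b := fun a b => hc.intervalIntegrable a b
  have h1 := intervalIntegral.integral_add_adjacent_intervals (i 0 v) (i v (v+s))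
  have h2 := intervalIntegral.integral_add_adjacent_intervals (i 0 (v-s)) (i (v-s) v)
  unfold tGp
  linarith

lemma tInt_deriv {γ : ℝ → ℝ} (hc : Continuous γ) (v : ℝ) :
    HasDerivAt (fun v => ∫ u in (0:ℝ)..v, γ u) (γ v) v :=
  intervalIntegral.integral_hasDerivAt_right (hc.intervalIntegrable 0 v)
    (hc.stronglyMeasurableAtFilter _ _) hc.continuousAt

lemma tGp_deriv {γ : ℝ → ℝ} (hc : Continuous γ) (s v : ℝ) :
    HasDerivAt (tGp γ s) (tAv γ s v) v := by
  have e : tGp γ s = fun v => (1/2) * (∫ u in (0:ℝ)..v, γ u) + (1/4) * (∫ u in (0:ℝ)..(v+s), γ u)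
      + (1/4) * (∫ u in (0:ℝ)..(v-s), γ u) := funext fun v => tGp_eq hc s v
  rw [e]
  have h1 := tInt_deriv hc v
  have h2 := (tInt_deriv hc (v+s)).comp_add_const v s
  have h3 := (tInt_deriv hc (v-s)).comp_sub_const v s
  have := ((h1.const_mul (1/2)).add (h2.const_mul (1/4))).add (h3.const_mul (1/4))
  refine this.congr_deriv ?_
  unfold tAv; ring

lemma tGp_mono {γ : ℝ → ℝ} (hc : Continuous γ) {α : ℝ} (ha : ∀ x, α ≤ γ x) (s : ℝ) {x y : ℝ}
    (hxy : x ≤ y) : α * (y - x) ≤ tGp γ s y - tGp γ s x := by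
  refine mul_sub_le_image_sub_of_le_deriv (fun v => (tGp_deriv hc s v).differentiableAt) ?_ hxy
  intro v
  rw [(tGp_deriv hc s v).deriv]
  unfold tAv
  linarith [ha (v-s), ha v, ha (v+s)]

lemma tGp_abs {γ : ℝ → ℝ} (hc : Continuous γ) {α : ℝ} (ha : ∀ x, α ≤ γ x) (s : ℝ) (x y : ℝ) :
    α * |y - x| ≤ |tGp γ s y - tGp γ s x| := by
  rcases le_total x y with h | h
  · rw [abs_of_nonneg (sub_nonneg.2 h)]
    exact (tGp_mono hc ha s h).trans (le_abs_self _)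
  · rw [abs_sub_comm, abs_of_nonneg (sub_nonneg.2 h), abs_sub_comm (tGp γ s y)]
    exact (tGp_mono hc ha s h).trans (le_abs_self _)

lemma tGp_inj {γ : ℝ → ℝ} (hc : Continuous γ) {α : ℝ} (hα : 0 < α) (ha : ∀ x, α ≤ γ x) (s : ℝ) :
    Function.Injective (tGp γ s) := by
  intro x y h
  have := tGp_abs hc ha s x y
  rw [h, sub_self, abs_zero] at this
  have h2 : |y - x| ≤ 0 := by
    by_contra hh
    push Not at hh
    nlinarith
  have := abs_nonpos_iff.1 h2
  linarith

lemma tGp_surj {γ : ℝ → ℝ} (hc : Continuous γ) {α : ℝ} (hα : 0 < α) (ha : ∀ x, α ≤ γ x) (s : ℝ) :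
    Function.Surjective (tGp γ s) := by
  have hcont : Continuous (tGp γ s) :=
    continuous_iff_continuousAt.2 fun v => (tGp_deriv hc s v).continuousAt
  refine hcont.surjective ?_ ?_
  · refine Filter.tendsto_atTop_mono' Filter.atTop (f₁ := fun y => α * y + tGp γ s 0) ?_ ?_
    · filter_upwards [Filter.eventually_ge_atTop 0] with y hy
      have := tGp_mono hc ha s hy
      linarith
    · exact Filter.tendsto_atTop_add_const_right _ _ (Filter.tendsto_id.const_mul_atTop hα)
  · refine Filter.tendsto_atBot_mono' Filter.atBot (f₁ := fun y => α * y + tGp γ s 0) ?_ ?_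
    · filter_upwards [Filter.eventually_le_atBot 0] with y hy
      have := tGp_mono hc ha s hy
      linarith
    · exact Filter.tendsto_atBot_add_const_right _ _ (Filter.tendsto_id.const_mul_atBot hα)

lemma tTt_spec {γ : ℝ → ℝ} (hc : Continuous γ) {α : ℝ} (hα : 0 < α) (ha : ∀ x, α ≤ γ x) (s x : ℝ) :
    tGp γ s (tTt γ s x) = ∫ u in (0:ℝ)..x, γ u :=
  Function.rightInverse_invFun (tGp_surj hc hα ha s) _

lemma tTt_unique {γ : ℝ → ℝ} (hc : Continuous γ) {α : ℝ} (hα : 0 < α) (ha : ∀ x, α ≤ γ x) (s x t : ℝ)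
    (h : tGp γ s t = ∫ u in (0:ℝ)..x, γ u) : tTt γ s x = t :=
  tGp_inj hc hα ha s ((tTt_spec hc hα ha s x).trans h.symm)

lemma tInt_le {γ : ℝ → ℝ} (hc : Continuous γ) {α β : ℝ} (ha : ∀ x, α ≤ γ x) (hb : ∀ x, γ x ≤ β)
    {x y : ℝ} (h : x ≤ y) : α * (y - x) ≤ (∫ u in x..y, γ u) ∧ (∫ u in x..y, γ u) ≤ β * (y - x) := by
  have h1 := intervalIntegral.integral_mono_on h (f := fun _ => α) (g := γ) (μ := volume)
    (by simp) (hc.intervalIntegrable _ _) (fun u _ => ha u)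
  have h2 := intervalIntegral.integral_mono_on h (g := fun _ => β) (f := γ) (μ := volume)
    (hc.intervalIntegrable _ _) (by simp) (fun u _ => hb u)
  simp at h1 h2
  constructor <;> linarith

lemma tInt_abs {γ : ℝ → ℝ} {ε : ℝ} (hb : ∀ x, |γ x| ≤ ε)
    (x y : ℝ) : |∫ u in x..y, γ u| ≤ ε * |y - x| :=
  intervalIntegral.norm_integral_le_of_norm_le_const (f := γ) (fun u _ => hb u)

lemma tTt_near {γ : ℝ → ℝ} (hc : Continuous γ) {α β : ℝ} (hα : 0 < α) (ha : ∀ x, α ≤ γ x)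
    (hb : ∀ x, γ x ≤ β) {s : ℝ} (hs : 0 < s) (x : ℝ) :
    |tTt γ s x - x| ≤ s * (β - α) / (4 * α) := by
  have h1 := tGp_abs hc ha s x (tTt γ s x)
  rw [tTt_spec hc hα ha] at h1
  have h2 := tInt_le hc ha hb (x := x) (y := x + s) (by linarith)
  have h3 := tInt_le hc ha hb (x := x - s) (y := x) (by linarith)
  have h4 : |(∫ u in (0:ℝ)..x, γ u) - tGp γ s x| ≤ s * (β - α) / 4 := by
    unfold tGp
    rw [abs_le]
    constructor <;> nlinarith
  rw [le_div_iff₀ (by positivity)]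
  linarith

lemma tTt_lip {γ : ℝ → ℝ} (hc : Continuous γ) {α β : ℝ} (hα : 0 < α) (ha : ∀ x, α ≤ γ x)
    (hb : ∀ x, γ x ≤ β) (s x x' : ℝ) :
    |tTt γ s x - tTt γ s x'| ≤ β / α * |x - x'| := by
  have h1 := tGp_abs hc ha s (tTt γ s x') (tTt γ s x)
  rw [tTt_spec hc hα ha, tTt_spec hc hα ha,
    intervalIntegral.integral_interval_sub_left (hc.intervalIntegrable _ _) (hc.intervalIntegrable _ _)] at h1
  have h2 := tInt_abs (γ := γ) (ε := β) (fun u => abs_le.2 ⟨by linarith [ha u, hb u], hb u⟩) x' x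
  rw [div_mul_eq_mul_div, le_div_iff₀ hα]
  linarith

lemma tTt_diff {γ δ : ℝ → ℝ} (hc : Continuous γ) (hcδ : Continuous δ) {α β : ℝ} (hα : 0 < α)
    (ha : ∀ x, α ≤ γ x) (hb : ∀ x, γ x ≤ β) (haδ : ∀ x, α ≤ δ x)
    {s : ℝ} (hs : 0 < s) {ε : ℝ} (hε : ∀ x, |γ x - δ x| ≤ ε) (x : ℝ) :
    |tTt γ s x - tTt δ s x| ≤ ε / α * (s * (β - α) / (4 * α) + s / 2) := by
  have h1 := tGp_abs hcδ haδ s (tTt δ s x) (tTt γ s x)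
  rw [tTt_spec hcδ hα haδ] at h1
  have hε0 : 0 ≤ ε := (abs_nonneg _).trans (hε 0)
  set t := tTt γ s x with ht
  have hcd : Continuous fun u => γ u - δ u := hc.sub hcδ
  have key : tGp δ s t - (∫ u in (0:ℝ)..x, δ u) =
      -((∫ u in x..t, (γ u - δ u)) + (1/4) * ((∫ u in t..(t+s), (γ u - δ u)) - ∫ u in (t-s)..t, (γ u - δ u))) := by
    have hs := tTt_spec hc hα ha s x
    rw [← ht] at hs
    unfold tGp at hs ⊢
    have i : ∀ a b, IntervalIntegrable γ volume a b := fun a b => hc.intervalIntegrable a b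
    have i' : ∀ a b, IntervalIntegrable δ volume a b := fun a b => hcδ.intervalIntegrable a b
    rw [intervalIntegral.integral_sub (i _ _) (i' _ _), intervalIntegral.integral_sub (i _ _) (i' _ _),
      intervalIntegral.integral_sub (i _ _) (i' _ _)]
    have h1 := intervalIntegral.integral_add_adjacent_intervals (i 0 x) (i x t)
    have h2 := intervalIntegral.integral_add_adjacent_intervals (i' 0 x) (i' x t)
    linarith
  rw [key, abs_neg] at h1
  have e1 := tInt_abs hε x t
  have e2 := tInt_abs hε t (t+s)
  have e3 := tInt_abs hε (t-s) t
  have hn := tTt_near hc hα ha hb hs x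
  rw [← ht] at hn
  rw [show t + s - t = s by ring, abs_of_pos hs] at e2
  rw [show t - (t - s) = s by ring, abs_of_pos hs] at e3
  have e4 : ε * |t - x| ≤ ε * (s * (β - α) / (4 * α)) := mul_le_mul_of_nonneg_left hn hε0
  have tot : |(∫ u in x..t, (γ u - δ u)) + (1/4) * ((∫ u in t..(t+s), (γ u - δ u)) - ∫ u in (t-s)..t, (γ u - δ u))|
      ≤ ε * (s * (β - α) / (4 * α) + s / 2) := by
    rw [abs_le] at *
    constructor <;> nlinarith
  rw [div_mul_eq_mul_div, le_div_iff₀ hα]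
  linarith

lemma tTt_period {γ : ℝ → ℝ} (hc : Continuous γ) {α : ℝ} (hα : 0 < α) (ha : ∀ x, α ≤ γ x)
    {T : ℝ} (hp : Function.Periodic γ T) (s x : ℝ) : tTt γ s (x + T) = tTt γ s x + T := by
  refine tTt_unique hc hα ha s _ _ ?_
  have hs := tTt_spec hc hα ha s x
  set t := tTt γ s x
  have per : ∀ y, (∫ u in (0:ℝ)..(y+T), γ u) = (∫ u in (0:ℝ)..y, γ u) + ∫ u in (0:ℝ)..T, γ u := by
    intro y
    have i : ∀ a b, IntervalIntegrable γ volume a b := fun a b => hc.intervalIntegrable a b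
    have h1 := intervalIntegral.integral_add_adjacent_intervals (i 0 y) (i y (y+T))
    have h2 := hp.intervalIntegral_add_eq y 0
    rw [zero_add] at h2
    linarith
  rw [tGp_eq hc] at hs ⊢
  rw [show t + T + s = t + s + T by ring, show t + T - s = t - s + T by ring, per, per, per, per]
  linarith

lemma tTt_cont {γ : ℝ → ℝ} (hc : Continuous γ) {α β : ℝ} (hα : 0 < α) (ha : ∀ x, α ≤ γ x)
    (hb : ∀ x, γ x ≤ β) (s : ℝ) : Continuous (tTt γ s) := by
  have hβ : 0 ≤ β / α := div_nonneg (by linarith [ha 0, hb 0]) hα.le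
  refine (LipschitzWith.of_dist_le_mul (K := ⟨β/α, hβ⟩) fun x y => ?_).continuous
  rw [Real.dist_eq, Real.dist_eq]
  exact tTt_lip hc hα ha hb s x y

lemma tTt_deriv {γ : ℝ → ℝ} (hc : Continuous γ) {α : ℝ} (hα : 0 < α) (ha : ∀ x, α ≤ γ x)
    (s x : ℝ) :
    HasDerivAt (tTt γ s) ((tAv γ s (tTt γ s x))⁻¹ * γ x) x := by
  have hpos : 0 < tAv γ s (tTt γ s x) := by
    unfold tAv
    linarith [ha (tTt γ s x - s), ha (tTt γ s x), ha (tTt γ s x + s)]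
  set w := Function.invFun (tGp γ s) with hw
  have hwr : ∀ y, tGp γ s (w y) = y := Function.rightInverse_invFun (tGp_surj hc hα ha s)
  have hwc : Continuous w := by
    refine (LipschitzWith.of_dist_le_mul (K := ⟨α⁻¹, by positivity⟩) fun x y => ?_).continuous
    rw [Real.dist_eq, Real.dist_eq]
    have := tGp_abs hc ha s (w y) (w x)
    rw [hwr, hwr] at this
    change |w x - w y| ≤ α⁻¹ * |x - y|
    rw [inv_mul_eq_div, le_div_iff₀ hα]
    linarith
  have h1 : HasDerivAt w (tAv γ s (tTt γ s x))⁻¹ (∫ u in (0:ℝ)..x, γ u) :=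
    HasDerivAt.of_local_left_inverse hwc.continuousAt (tGp_deriv hc s _) hpos.ne'
      (Filter.Eventually.of_forall hwr)
  exact h1.comp x (tInt_deriv hc x)

lemma tTt_lintegral {γ : ℝ → ℝ} (hc : Continuous γ) {α β : ℝ} (hα : 0 < α) (ha : ∀ x, α ≤ γ x)
    (hb : ∀ x, γ x ≤ β) {T : ℝ} (hT : 0 < T) (hp : Function.Periodic γ T) (s : ℝ)
    (f : ℝ → ENNReal) (hfp : Function.Periodic f T) :
    ∫⁻ x in Ioc 0 T, f (tTt γ s x) * ENNReal.ofReal (γ x) =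
      ∫⁻ x in Ioc 0 T, f x * ENNReal.ofReal (tAv γ s x) := by
  have hpos : ∀ t, 0 < tAv γ s t := by
    intro t
    unfold tAv
    linarith [ha (t - s), ha t, ha (t + s)]
  have hmono : StrictMono (tTt γ s) := by
    intro x y hxy
    by_contra h
    push Not at h
    have h1 := tGp_mono hc ha s h
    rw [tTt_spec hc hα ha, tTt_spec hc hα ha,
      intervalIntegral.integral_interval_sub_left (hc.intervalIntegrable _ _) (hc.intervalIntegrable _ _)] at h1
    have h2 := (tInt_le hc ha hb hxy.le).1
    rw [intervalIntegral.integral_symm] at h1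
    nlinarith
  have himg : tTt γ s '' Ioc 0 T = Ioc (tTt γ s 0) (tTt γ s 0 + T) := by
    have e : tTt γ s 0 + T = tTt γ s T := by
      rw [← tTt_period hc hα ha hp, zero_add]
    rw [e]
    apply Subset.antisymm
    · rintro _ ⟨x, hx, rfl⟩
      exact ⟨hmono hx.1, hmono.monotone hx.2⟩
    · intro y hy
      have := intermediate_value_Ioc hT.le (tTt_cont hc hα ha hb s).continuousOn hy
      exact this
  have key := lintegral_image_eq_lintegral_abs_deriv_mul (s := Ioc 0 T) (f := tTt γ s)
    (f' := fun x => (tAv γ s (tTt γ s x))⁻¹ * γ x) measurableSet_Ioc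
    (fun x _ => (tTt_deriv hc hα ha s x).hasDerivWithinAt) hmono.injective.injOn
    (fun x => f x * ENNReal.ofReal (tAv γ s x))
  rw [himg] at key
  have per2 : Function.Periodic (fun x => f x * ENNReal.ofReal (tAv γ s x)) T := by
    intro x
    have : tAv γ s (x + T) = tAv γ s x := by
      unfold tAv
      rw [show x + T - s = x - s + T by ring, show x + T + s = x + s + T by ring, hp, hp, hp]
    simp only [this, hfp x]
  have fd : ∫⁻ x in Ioc (tTt γ s 0) (tTt γ s 0 + T), f x * ENNReal.ofReal (tAv γ s x) =
      ∫⁻ x in Ioc 0 (0 + T), f x * ENNReal.ofReal (tAv γ s x) := by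
    refine (isAddFundamentalDomain_Ioc hT (tTt γ s 0)).setLIntegral_eq (isAddFundamentalDomain_Ioc hT 0) _ ?_
    rintro ⟨g, hg⟩ x
    obtain ⟨k, rfl⟩ := AddSubgroup.mem_zmultiples_iff.1 hg
    change (fun x => f x * ENNReal.ofReal (tAv γ s x)) (k • T + x) = _
    rw [add_comm]
    exact per2.zsmul k x
  rw [zero_add] at fd
  rw [← fd, key]
  refine setLIntegral_congr_fun measurableSet_Ioc fun x _ => ?_
  have hγ : 0 ≤ γ x := hα.le.trans (ha x)
  rw [abs_of_nonneg (mul_nonneg (inv_nonneg.2 (hpos _).le) hγ), ENNReal.ofReal_mul (inv_nonneg.2 (hpos _).le),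
    ENNReal.ofReal_inv_of_pos (hpos _)]
  have h0 : ENNReal.ofReal (tAv γ s (tTt γ s x)) ≠ 0 := by simpa using hpos _
  have ht : ENNReal.ofReal (tAv γ s (tTt γ s x)) ≠ ⊤ := ENNReal.ofReal_ne_top
  generalize ENNReal.ofReal (tAv γ s (tTt γ s x)) = A at *
  rw [show A⁻¹ * ENNReal.ofReal (γ x) * (f (tTt γ s x) * A) = (A⁻¹ * A) * (f (tTt γ s x) * ENNReal.ofReal (γ x)) by ring,
    ENNReal.inv_mul_cancel h0 ht, one_mul]
end

section
open MeasureTheory Set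

def l1 {d : ℕ} (x y : Fin d → ℝ) : ℝ := ∑ j, |x j - y j|

lemma l1_self {d : ℕ} (x : Fin d → ℝ) : l1 x x = 0 := by simp [l1]

lemma l1_nonneg {d : ℕ} (x y : Fin d → ℝ) : 0 ≤ l1 x y := Finset.sum_nonneg fun _ _ => abs_nonneg _

lemma l1_tri {d : ℕ} (x y z : Fin d → ℝ) : l1 x z ≤ l1 x y + l1 y z := by
  unfold l1
  rw [← Finset.sum_add_distrib]
  exact Finset.sum_le_sum fun j _ => abs_sub_le _ _ _

lemma l1_coord {d : ℕ} (x y : Fin d → ℝ) (j : Fin d) : |x j - y j| ≤ l1 x y :=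
  Finset.single_le_sum (f := fun j => |x j - y j|) (fun _ _ => abs_nonneg _) (Finset.mem_univ j)

lemma telescoping {d : ℕ} {E : Type*} (D : E → E → ℝ) (h0 : ∀ x, D x x = 0)
    (htri : ∀ x y z, D x z ≤ D x y + D y z) (F : (Fin d → ℝ) → E) (K : ℝ)
    (h : ∀ z j t t', D (F (Function.update z j t)) (F (Function.update z j t')) ≤ K * |t - t'|)
    (x y : Fin d → ℝ) : D (F x) (F y) ≤ K * l1 x y := by
  have key : ∀ s : Finset (Fin d), D (F x) (F (s.piecewise y x)) ≤ K * ∑ j ∈ s, |x j - y j| := by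
    intro s
    induction s using Finset.induction_on with
    | empty => simp [h0]
    | insert j s hj ih =>
      rw [Finset.sum_insert hj, mul_add]
      have h1 := htri (F x) (F (s.piecewise y x)) (F ((insert j s).piecewise y x))
      have h2 := h (s.piecewise y x) j (x j) (y j)
      rw [← Finset.piecewise_insert] at h2
      have h3 : Function.update (s.piecewise y x) j (x j) = s.piecewise y x := by
        rw [Function.update_eq_self_iff]
        simp [hj]
      rw [h3] at h2
      linarith
  have := key Finset.univ
  simpa [l1] using this

lemma cont_of_l1 {d : ℕ} (φ : (Fin d → ℝ) → ℝ) (K : ℝ)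
    (h : ∀ x y, |φ x - φ y| ≤ K * l1 x y) : Continuous φ := by
  have hK : ∀ x y, |φ x - φ y| ≤ |K| * l1 x y := fun x y =>
    (h x y).trans (mul_le_mul_of_nonneg_right (le_abs_self K) (l1_nonneg _ _))
  refine (LipschitzWith.of_dist_le_mul (K := ⟨|K| * d, by positivity⟩) fun x y => ?_).continuous
  rw [Real.dist_eq]
  refine (hK x y).trans ?_
  change _ ≤ (|K| * d) * dist x y
  rw [mul_assoc]
  refine mul_le_mul_of_nonneg_left ?_ (abs_nonneg K)
  unfold l1
  calc ∑ j, |x j - y j| ≤ ∑ _j : Fin d, dist x y := Finset.sum_le_sum fun j _ => by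
        rw [← Real.dist_eq]; exact dist_le_pi_dist x y j
    _ = d * dist x y := by simp

def CPer {d : ℕ} {E : Type*} (T : ℝ) (g : (Fin d → ℝ) → E) : Prop :=
  ∀ z j, g (Function.update z j (z j + T)) = g z

def CEqv {d : ℕ} (T : ℝ) (F : (Fin d → ℝ) → (Fin d → ℝ)) : Prop :=
  ∀ z j, F (Function.update z j (z j + T)) = Function.update (F z) j (F z j + T)

def CLip {d : ℕ} (κ : ℝ) (g : (Fin d → ℝ) → ℝ) : Prop :=
  ∀ z j t t', |g (Function.update z j t) - g (Function.update z j t')| ≤ κ * |t - t'|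

noncomputable def cAv {d : ℕ} (s : ℝ) (j : Fin d) (g : (Fin d → ℝ) → ℝ) (z : Fin d → ℝ) : ℝ :=
  tAv (fun t => g (Function.update z j t)) s (z j)

noncomputable def torM (d : ℕ) (T : ℝ) : Measure (Fin d → ℝ) :=
  Measure.pi fun _ => volume.restrict (Ioc 0 T)

lemma CLip.cont {d : ℕ} {κ : ℝ} {g : (Fin d → ℝ) → ℝ} (h : CLip κ g) : Continuous g :=
  cont_of_l1 g κ fun x y => telescoping (fun a b : ℝ => |a - b|) (by simp)
    (fun x y z => abs_sub_le x y z) g κ h x y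

lemma transport {d : ℕ} (j : Fin d) (g : (Fin d → ℝ) → ℝ) {α β s T : ℝ} (hα : 0 < α)
    (ha : ∀ x, α ≤ g x) (hb : ∀ x, g x ≤ β) (hs : 0 < s) (hT : 0 < T) (hp : CPer T g)
    (hL : CLip ((β - α) / s) g) :
    ∃ F : (Fin d → ℝ) → (Fin d → ℝ),
      (∀ x y, l1 (F x) (F y) ≤ (1 + (β - α) * (1 / α + (β - α) / (4 * α ^ 2))) * l1 x y) ∧ CEqv T F ∧
      Measurable F ∧
      ∀ f : (Fin d → ℝ) → ENNReal, Measurable f → CPer T f →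
        ∫⁻ z, f (F z) * ENNReal.ofReal (g z) ∂(torM d T) =
          ∫⁻ z, f z * ENNReal.ofReal (cAv s j g z) ∂(torM d T) := by
  have hβα : 0 ≤ β - α := by linarith [ha 0, hb 0]
  set γ : (Fin d → ℝ) → ℝ → ℝ := fun z t => g (Function.update z j t) with hγ
  have hgc : Continuous g := hL.cont
  have hγc : ∀ z, Continuous (γ z) := fun z =>
    hgc.comp (continuous_const.update j continuous_id)
  have hγa : ∀ z t, α ≤ γ z t := fun z t => ha _
  have hγb : ∀ z t, γ z t ≤ β := fun z t => hb _
  have hγp : ∀ z, Function.Periodic (γ z) T := by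
    intro z t
    have := hp (Function.update z j t) j
    simpa [hγ] using this
  have hγu : ∀ z t, γ (Function.update z j t) = γ z := by
    intro z t; funext u; simp [hγ]
  set F : (Fin d → ℝ) → (Fin d → ℝ) := fun z => Function.update z j (tTt (γ z) s (z j)) with hF
  have hFl : ∀ x y, l1 (F x) (F y) ≤ (1 + (β - α) * (1 / α + (β - α) / (4 * α ^ 2))) * l1 x y := by
    refine telescoping l1 l1_self l1_tri F _ ?_
    intro z i t t'
    by_cases hij : i = j
    · subst hij
      have e : l1 (F (Function.update z i t)) (F (Function.update z i t')) = |tTt (γ z) s t - tTt (γ z) s t'| := by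
        unfold l1
        rw [Finset.sum_eq_single i]
        · simp [hF, hγu]
        · intro k _ hk; simp [hF, hk]
        · simp
      rw [e]
      refine (tTt_lip (hγc z) hα (hγa z) (hγb z) s t t').trans ?_
      refine mul_le_mul_of_nonneg_right ?_ (abs_nonneg _)
      have : β / α = 1 + (β - α) * (1/α) := by field_simp; ring
      rw [this]
      have : 0 ≤ (β - α) * ((β - α) / (4 * α ^ 2)) := by positivity
      linarith
    · have hε : ∀ u, |γ (Function.update z i t) u - γ (Function.update z i t') u| ≤ (β - α) / s * |t - t'| := by
        intro u
        have := hL (Function.update z j u) i t t'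
        rw [Function.update_comm (Ne.symm hij), Function.update_comm (Ne.symm hij)] at this
        exact this
      have h1 := tTt_diff (hγc (Function.update z i t)) (hγc (Function.update z i t')) hα (hγa _) (hγb _) (hγa _)
        hs hε (z j)
      have e : l1 (F (Function.update z i t)) (F (Function.update z i t')) = |t - t'| +
          |tTt (γ (Function.update z i t)) s (z j) - tTt (γ (Function.update z i t')) s (z j)| := by
        unfold l1
        rw [← Finset.sum_subset (Finset.subset_univ {i, j}), Finset.sum_pair hij]
        · simp [hF, hij, Ne.symm hij]
        · intro k _ hk
          simp only [Finset.mem_insert, Finset.mem_singleton, not_or] at hk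
          simp [hF, hk.1, hk.2]
      rw [e]
      have e2 : (β - α) / s * |t - t'| / α * (s * (β - α) / (4 * α) + s / 2) =
         (β - α) * (1 / (2 * α) + (β - α) / (4 * α ^ 2)) * |t - t'| := by
        field_simp; ring
      rw [e2] at h1
      have : (β - α) * (1 / (2 * α) + (β - α) / (4 * α ^ 2)) ≤ (β - α) * (1 / α + (β - α) / (4 * α ^ 2)) := by
        refine mul_le_mul_of_nonneg_left ?_ hβα
        have : 1 / (2 * α) ≤ 1 / α := one_div_le_one_div_of_le hα (by linarith)
        linarith
      nlinarith [abs_nonneg (t - t')]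
  have hFc : Continuous F := by
    refine continuous_pi fun i => cont_of_l1 _ _ fun x y => (l1_coord _ _ i).trans (hFl x y)
  refine ⟨F, hFl, ?_, hFc.measurable, ?_⟩
  · intro z i
    by_cases hij : i = j
    · subst hij
      have h1 := tTt_period (hγc z) hα (hγa z) (hγp z) s (z i)
      simp [hF, hγu, h1]
    · have h1 : γ (Function.update z i (z i + T)) = γ z := by
        funext u
        have := hp (Function.update z j u) i
        rw [Function.update_of_ne hij, Function.update_comm (Ne.symm hij)] at this
        exact this
      simp only [hF, h1]
      rw [Function.update_of_ne (Ne.symm hij), Function.update_of_ne hij, Function.update_comm hij]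
  · intro f hf hfp
    have hcc : Continuous (cAv s j g) := by
      unfold cAv tAv
      have : ∀ w : (Fin d → ℝ) → ℝ, Continuous w → Continuous fun z => g (Function.update z j (w z)) := by
        intro w hw
        exact hgc.comp (continuous_id.update j hw)
      have c1 := this (fun z => z j - s) (by fun_prop)
      have c2 := this (fun z => z j) (by fun_prop)
      have c3 := this (fun z => z j + s) (by fun_prop)
      fun_prop
    refine lintegral_eq_of_lmarginal_eq {j} ?_ ?_ ?_
    · exact (hf.comp hFc.measurable).mul hgc.measurable.ennreal_ofReal
    · exact hf.mul hcc.measurable.ennreal_ofReal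
    · rw [lmarginal_singleton, lmarginal_singleton]
      funext z
      have h1 := tTt_lintegral (hγc z) hα (hγa z) (hγb z) hT (hγp z) s (fun t => f (Function.update z j t)) (by
        intro t
        have := hfp (Function.update z j t) j
        simpa using this)
      simpa [hF, hγu, cAv] using h1
end

section
open MeasureTheory Set

noncomputable def kb (T s t : ℝ) : ℝ := if Int.fract (t / T) < s / T then 1 / s else 0

noncomputable def kH (T s t : ℝ) : ℝ := (1 / s) * ∫ u in t..(t + s), kb T s u

lemma kb_meas (T s : ℝ) : Measurable (kb T s) := by
  unfold kb
  refine Measurable.ite ?_ measurable_const measurable_const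
  exact measurableSet_lt (measurable_fract.comp (measurable_id.div_const T)) measurable_const

lemma kb_nonneg {T s : ℝ} (hs : 0 < s) (t : ℝ) : 0 ≤ kb T s t := by
  unfold kb; split_ifs <;> positivity

lemma kb_le {T s : ℝ} (hs : 0 < s) (t : ℝ) : kb T s t ≤ 1 / s := by
  unfold kb; split_ifs <;> [exact le_rfl; positivity]

lemma kb_per {T : ℝ} (hT : 0 < T) (s : ℝ) : Function.Periodic (kb T s) T := by
  intro t
  unfold kb
  rw [add_div, div_self hT.ne', Int.fract_add_one]

lemma ii_of_bdd {φ : ℝ → ℝ} (hm : Measurable φ) (C : ℝ) (hb : ∀ t, |φ t| ≤ C) (a b : ℝ) :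
    IntervalIntegrable φ volume a b := by
  refine IntervalIntegrable.mono_fun' (g := fun _ => C) (by simp) hm.aestronglyMeasurable ?_
  exact Filter.Eventually.of_forall fun t => hb t

lemma kb_ii {T s : ℝ} (hs : 0 < s) (a b : ℝ) : IntervalIntegrable (kb T s) volume a b :=
  ii_of_bdd (kb_meas T s) (1/s) (fun t => by
    rw [abs_of_nonneg (kb_nonneg hs t)]; exact kb_le hs t) a b

lemma kb_refine {T s : ℝ} (hT : 0 < T) (hs : 0 < s) (h2 : 2 * s ≤ T) (t : ℝ) :
    kb T (2 * s) t = (1/2) * (kb T s t + kb T s (t - s)) := by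
  unfold kb
  rw [sub_div]
  have hσ : 0 < s / T := by positivity
  have hσ2 : 2 * (s / T) ≤ 1 := by
    rw [← mul_div_assoc, div_le_one hT]; exact h2
  rw [mul_div_assoc]
  generalize s / T = σ at *
  generalize t / T = r
  have h0 := Int.fract_nonneg r
  have h1 := Int.fract_lt_one r
  have hr : r = ⌊r⌋ + Int.fract r := (Int.floor_add_fract r).symm
  by_cases hc : Int.fract r < σ
  · have : Int.fract (r - σ) = Int.fract r - σ + 1 := by
      rw [Int.fract_eq_iff]
      refine ⟨by linarith, by linarith, ⌊r⌋ - 1, ?_⟩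
      push_cast; linarith
    rw [this, if_pos hc, if_pos (by linarith), if_neg (by linarith)]
    field_simp; ring
  · have : Int.fract (r - σ) = Int.fract r - σ := by
      rw [Int.fract_eq_iff]
      refine ⟨by linarith, by linarith, ⌊r⌋, ?_⟩
      linarith
    rw [this, if_neg hc]
    by_cases hc2 : Int.fract r < 2 * σ
    · rw [if_pos hc2, if_pos (by linarith)]
      field_simp; ring
    · rw [if_neg hc2, if_neg (by linarith)]
      ring

lemma kb_full {T : ℝ} (hT : 0 < T) (t : ℝ) : kb T T t = 1 / T := by
  unfold kb
  rw [div_self hT.ne', if_pos (Int.fract_lt_one _)]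

lemma kH_full {T : ℝ} (hT : 0 < T) (t : ℝ) : kH T T t = 1 / T := by
  unfold kH
  simp [kb_full hT]
  field_simp

lemma kH_refine {T s : ℝ} (hT : 0 < T) (hs : 0 < s) (h2 : 2 * s ≤ T) (t : ℝ) :
    kH T (2 * s) t = tAv (kH T s) s t := by
  unfold kH tAv
  simp only [kb_refine hT hs h2]
  have i : ∀ a b, IntervalIntegrable (kb T s) volume a b := kb_ii hs
  have i2 : ∀ a b, IntervalIntegrable (fun u => kb T s (u - s)) volume a b := fun a b => by
    have := (i (a - s) (b - s)).comp_sub_right s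
    simpa using this
  rw [intervalIntegral.integral_const_mul, intervalIntegral.integral_add (i _ _) (i2 _ _),
    intervalIntegral.integral_comp_sub_right (fun u => kb T s u) s,
    ← intervalIntegral.integral_add_adjacent_intervals (i t (t+s)) (i (t+s) (t+2*s)),
    ← intervalIntegral.integral_add_adjacent_intervals (i (t-s) t) (i t (t+2*s-s))]
  rw [show t + 2 * s - s = t + s by ring, show t + s + s = t + 2 * s by ring, show t - s + s = t by ring]
  field_simp
  ring

lemma kH_per {T : ℝ} (hT : 0 < T) (s : ℝ) : Function.Periodic (kH T s) T := by
  intro t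
  unfold kH
  have := intervalIntegral.integral_comp_add_right (a := t) (b := t + s) (fun u => kb T s u) T
  rw [show t + T + s = t + s + T by ring, ← this]
  simp only [kb_per hT s _]

lemma kH_nonneg {T s : ℝ} (hs : 0 < s) (t : ℝ) : 0 ≤ kH T s t := by
  unfold kH
  refine mul_nonneg (by positivity) (intervalIntegral.integral_nonneg (by linarith) fun u _ => kb_nonneg hs u)

lemma kH_supp {T s : ℝ} (hT : 0 < T) {t : ℝ} (hs : 0 < s) (h : kH T s t ≠ 0) : ∃ k : ℤ, |t - T * k| ≤ s := by
  by_contra hc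
  push Not at hc
  apply h
  unfold kH
  rw [intervalIntegral.integral_zero_ae, mul_zero]
  refine Filter.Eventually.of_forall fun u hu => ?_
  rw [uIoc_of_le (by linarith)] at hu
  unfold kb
  rw [if_neg]
  intro hf
  have := hc ⌊u / T⌋
  have h1 : u = T * ⌊u/T⌋ + T * Int.fract (u/T) := by
    rw [← mul_add, Int.floor_add_fract]; field_simp
  have h2 : T * Int.fract (u/T) < s := by
    rw [lt_div_iff₀ hT] at hf; linarith
  have h3 : 0 ≤ T * Int.fract (u/T) := mul_nonneg hT.le (Int.fract_nonneg _)
  have h4 : |t - T * ⌊u/T⌋| ≤ s := by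
    rw [abs_le]; constructor <;> linarith [hu.1, hu.2]
  linarith

section sums
variable {X : Type*} (S : Finset X) (c : X → ℝ) (p : X → ℝ)

lemma ksum_H {T s : ℝ} (hs : 0 < s) (t : ℝ) :
    ∑ x ∈ S, c x * kH T s (t - p x) = (1 / s) * ∫ u in t..(t+s), ∑ x ∈ S, c x * kb T s (u - p x) := by
  have i2 : ∀ q a b, IntervalIntegrable (fun u => kb T s (u - q)) volume a b := fun q a b => by
    have := (kb_ii (T := T) hs (a - q) (b - q)).comp_sub_right q
    simpa using this
  rw [intervalIntegral.integral_finsetSum (fun x _ => (i2 _ _ _).const_mul _), Finset.mul_sum]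
  refine Finset.sum_congr rfl fun x _ => ?_
  rw [intervalIntegral.integral_const_mul, intervalIntegral.integral_comp_sub_right (fun u => kb T s u)]
  unfold kH
  rw [show t - p x + s = t + s - p x by ring]
  ring

lemma ksum_meas (T s : ℝ) : Measurable fun u => ∑ x ∈ S, c x * kb T s (u - p x) := by
  refine Finset.measurable_fun_sum _ fun x _ => ?_
  exact ((kb_meas T s).comp (measurable_id.sub_const _)).const_mul _

lemma mint_le {φ : ℝ → ℝ} (hm : Measurable φ) {α β : ℝ} (ha : ∀ t, α ≤ φ t) (hb : ∀ t, φ t ≤ β)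
    {x y : ℝ} (h : x ≤ y) : α * (y - x) ≤ (∫ u in x..y, φ u) ∧ (∫ u in x..y, φ u) ≤ β * (y - x) := by
  have ii := ii_of_bdd hm (max |α| |β|) (fun t => abs_le_max_abs_abs (ha t) (hb t)) x y
  have h1 := intervalIntegral.integral_mono_on h (f := fun _ => α) (g := φ) (μ := volume)
    (by simp) ii (fun u _ => ha u)
  have h2 := intervalIntegral.integral_mono_on h (g := fun _ => β) (f := φ) (μ := volume)
    ii (by simp) (fun u _ => hb u)
  simp at h1 h2
  constructor <;> linarith

lemma ksum_bd {T s α β : ℝ} (hs : 0 < s)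
    (h : ∀ t, α ≤ ∑ x ∈ S, c x * kb T s (t - p x) ∧ ∑ x ∈ S, c x * kb T s (t - p x) ≤ β) (t : ℝ) :
    α ≤ ∑ x ∈ S, c x * kH T s (t - p x) ∧ ∑ x ∈ S, c x * kH T s (t - p x) ≤ β := by
  rw [ksum_H S c p hs]
  have := mint_le (ksum_meas S c p T s) (fun t => (h t).1) (fun t => (h t).2) (x := t) (y := t + s) (by linarith)
  rw [add_sub_cancel_left] at this
  rw [one_div_mul_eq_div, le_div_iff₀ hs, div_le_iff₀ hs]
  exact this

lemma ksum_av (φ : ℝ → ℝ) (s t : ℝ) : ∑ x ∈ S, c x * tAv φ s (t - p x) =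
    tAv (fun t => ∑ x ∈ S, c x * φ (t - p x)) s t := by
  unfold tAv
  rw [Finset.mul_sum, Finset.mul_sum, Finset.mul_sum, ← Finset.sum_add_distrib, ← Finset.sum_add_distrib]
  refine Finset.sum_congr rfl fun x _ => ?_
  rw [show t - p x - s = t - s - p x by ring, show t - p x + s = t + s - p x by ring]
  ring

lemma ksum_bd2 {φ : ℝ → ℝ} {s α β : ℝ} 
    (h : ∀ t, α ≤ ∑ x ∈ S, c x * φ (t - p x) ∧ ∑ x ∈ S, c x * φ (t - p x) ≤ β) (t : ℝ) :
    α ≤ ∑ x ∈ S, c x * tAv φ s (t - p x) ∧ ∑ x ∈ S, c x * tAv φ s (t - p x) ≤ β := by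
  rw [ksum_av]
  unfold tAv
  have h1 := h (t - s)
  have h2 := h t
  have h3 := h (t + s)
  constructor <;> linarith

lemma ksum_lip {T s α β : ℝ} (hs : 0 < s)
    (h : ∀ t, α ≤ ∑ x ∈ S, c x * kb T s (t - p x) ∧ ∑ x ∈ S, c x * kb T s (t - p x) ≤ β) (t t' : ℝ) :
    |∑ x ∈ S, c x * kH T s (t - p x) - ∑ x ∈ S, c x * kH T s (t' - p x)| ≤ (β - α) / s * |t - t'| := by
  wlog hle : t' ≤ t generalizing t t'
  · rw [abs_sub_comm, abs_sub_comm t]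
    exact this t' t (by linarith)
  rw [ksum_H S c p hs, ksum_H S c p hs, abs_of_nonneg (sub_nonneg.2 hle)]
  have hm := ksum_meas S c p T s
  set φ := fun u => ∑ x ∈ S, c x * kb T s (u - p x) with hφ
  have i : ∀ a b, IntervalIntegrable φ volume a b :=
    ii_of_bdd hm (max |α| |β|) (fun t => abs_le_max_abs_abs (h t).1 (h t).2)
  have h1 := mint_le hm (fun t => (h t).1) (fun t => (h t).2) hle
  have h2 := mint_le hm (fun t => (h t).1) (fun t => (h t).2) (x := t' + s) (y := t + s) (by linarith)
  have e1 := intervalIntegral.integral_add_adjacent_intervals (i t' t) (i t (t+s))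
  have e2 := intervalIntegral.integral_add_adjacent_intervals (i t' (t'+s)) (i (t'+s) (t+s))
  have e : 1 / s * (∫ u in t..(t+s), φ u) - 1 / s * (∫ u in t'..(t'+s), φ u) =
     ((∫ u in (t'+s)..(t+s), φ u) - ∫ u in t'..t, φ u) / s := by
    rw [← mul_sub, one_div_mul_eq_div]; congr 1; linarith
  rw [e, abs_div, abs_of_pos hs, div_mul_eq_mul_div]
  refine div_le_div_of_nonneg_right ?_ hs.le
  rw [abs_le]
  constructor <;> linarith [h1.1, h1.2, h2.1, h2.2]

lemma ksum_lip2 {φ : ℝ → ℝ} {s K : ℝ} 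
    (h : ∀ t t', |∑ x ∈ S, c x * φ (t - p x) - ∑ x ∈ S, c x * φ (t' - p x)| ≤ K * |t - t'|) (t t' : ℝ) :
    |∑ x ∈ S, c x * tAv φ s (t - p x) - ∑ x ∈ S, c x * tAv φ s (t' - p x)| ≤ K * |t - t'| := by
  rw [ksum_av, ksum_av]
  unfold tAv
  have h1 := h (t - s) (t' - s)
  have h2 := h t t'
  have h3 := h (t + s) (t' + s)
  rw [show t - s - (t' - s) = t - t' by ring] at h1
  rw [show t + s - (t' + s) = t - t' by ring] at h3
  rw [abs_le] at *
  constructor <;> linarith [h1.1, h1.2, h2.1, h2.2, h3.1, h3.2]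
end sums

lemma kH_cont {T s : ℝ} (hs : 0 < s) : Continuous (kH T s) := by
  have := ksum_lip (X := Unit) {()} (fun _ => 1) (fun _ => 0) (T := T) (s := s) (α := 0) (β := 1/s) hs
    (fun t => by simpa using ⟨kb_nonneg hs t, by simpa using kb_le hs t⟩)
  refine (LipschitzWith.of_dist_le_mul (K := ⟨(1/s - 0)/s, by rw [sub_zero]; positivity⟩) fun x y => ?_).continuous
  rw [Real.dist_eq, Real.dist_eq]
  have h3 := this x y
  simp only [Finset.sum_singleton, one_mul, sub_zero] at h3
  change _ ≤ ((1/s-0)/s) * _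
  rw [sub_zero]
  exact h3

lemma kH_int (i l : ℕ) (hil : i ≤ l) : ∫ t in (0:ℝ)..(2^l), kH (2^l) (2^i) t = 1 := by
  induction hil using Nat.decreasingInduction with
  | self => simp [kH_full (T := (2:ℝ)^l) (by positivity)]
  | of_succ i hi ih =>
    have hT : (0:ℝ) < 2^l := by positivity
    have hs : (0:ℝ) < 2^i := by positivity
    have h2 : 2 * (2:ℝ)^i ≤ 2^l := by
      rw [← pow_succ']; exact pow_le_pow_right₀ (by norm_num) hi
    rw [← ih, pow_succ' (2:ℝ) i]
    simp only [kH_refine hT hs h2]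
    unfold tAv
    have c : Continuous (kH (2^l) (2^i)) := kH_cont hs
    have hp := kH_per hT (2^i)
    rw [intervalIntegral.integral_add (Continuous.intervalIntegrable (by fun_prop) _ _) (Continuous.intervalIntegrable (by fun_prop) _ _),
      intervalIntegral.integral_add (Continuous.intervalIntegrable (by fun_prop) _ _) (Continuous.intervalIntegrable (by fun_prop) _ _),
      intervalIntegral.integral_const_mul, intervalIntegral.integral_const_mul, intervalIntegral.integral_const_mul,
      intervalIntegral.integral_comp_sub_right (kH (2^l) (2^i)), intervalIntegral.integral_comp_add_right (kH (2^l) (2^i))]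
    have h1 := hp.intervalIntegral_add_eq (0 - 2^i) 0
    have h3 := hp.intervalIntegral_add_eq (0 + 2^i) 0
    rw [show (2:ℝ)^l - 2^i = 0 - 2^i + 2^l by ring, show (2:ℝ)^l + 2^i = 0 + 2^i + 2^l by ring, h1, h3, zero_add]
    ring

lemma kH_int_shift (i l : ℕ) (hil : i ≤ l) (q : ℝ) : ∫ t in (0:ℝ)..(2^l), kH (2^l) (2^i) (t - q) = 1 := by
  have hT : (0:ℝ) < 2^l := by positivity
  rw [intervalIntegral.integral_comp_sub_right (kH (2^l) (2^i)), show (2:ℝ)^l - q = 0 - q + 2^l by ring,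
    (kH_per hT (2^i)).intervalIntegral_add_eq (0 - q) 0, zero_add]
  exact kH_int i l hil
end

section
open MeasureTheory Set

def TorTr {d : ℕ} (T K : ℝ) (g g' : (Fin d → ℝ) → ℝ) : Prop :=
  ∃ F : (Fin d → ℝ) → (Fin d → ℝ), (∀ x y, l1 (F x) (F y) ≤ K * l1 x y) ∧ CEqv T F ∧
      Measurable F ∧
      ∀ f : (Fin d → ℝ) → ENNReal, Measurable f → CPer T f →
        ∫⁻ z, f (F z) * ENNReal.ofReal (g z) ∂(torM d T) =
          ∫⁻ z, f z * ENNReal.ofReal (g' z) ∂(torM d T)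

lemma TorTr.refl {d : ℕ} (T : ℝ) (g : (Fin d → ℝ) → ℝ) : TorTr T 1 g g :=
  ⟨id, fun x y => by simp, fun z j => rfl, measurable_id, fun f _ _ => rfl⟩

lemma TorTr.comp {d : ℕ} {T K K' : ℝ} {g g' g'' : (Fin d → ℝ) → ℝ} (hK' : 0 ≤ K')
    (h : TorTr T K g g') (h' : TorTr T K' g' g'') : TorTr T (K * K') g g'' := by
  obtain ⟨F, h1, h2, h3, h4⟩ := h
  obtain ⟨G, k1, k2, k3, k4⟩ := h'
  refine ⟨fun z => G (F z), fun x y => ?_, fun z j => ?_, k3.comp h3, fun f hf hp => ?_⟩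
  · refine (k1 _ _).trans ?_
    rw [mul_comm K, mul_assoc]
    exact mul_le_mul_of_nonneg_left (h1 _ _) hK'
  · change G (F _) = _
    rw [h2, k2]
  · rw [← k4 f hf hp]
    refine h4 (fun z => f (G z)) (hf.comp k3) fun z j => ?_
    simp only
    rw [k2, hp]

section dens
variable {d : ℕ} {X : Type*} (S : Finset X) (w : ℝ) (P : X → Fin d → ℝ)

noncomputable def gD (κ : Fin d → ℝ → ℝ) (z : Fin d → ℝ) : ℝ :=
  w * ∑ x ∈ S, ∏ j, κ j (z j - P x j)

lemma gD_upd (κ : Fin d → ℝ → ℝ) (j : Fin d) (φ : ℝ → ℝ) (z : Fin d → ℝ) (t : ℝ) :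
    gD S w P (Function.update κ j φ) (Function.update z j t) =
      ∑ x ∈ S, (w * ∏ i ∈ Finset.univ.erase j, κ i (z i - P x i)) * φ (t - P x j) := by
  unfold gD
  rw [Finset.mul_sum]
  refine Finset.sum_congr rfl fun x _ => ?_
  rw [← Finset.mul_prod_erase _ _ (Finset.mem_univ j)]
  simp only [Function.update_self]
  rw [Finset.prod_congr rfl (g := fun i => κ i (z i - P x i))]
  · ring
  · intro i hi
    have := Finset.ne_of_mem_erase hi
    simp [this]

lemma gD_upd' (κ : Fin d → ℝ → ℝ) (j : Fin d) (φ : ℝ → ℝ) (z : Fin d → ℝ) :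
    gD S w P (Function.update κ j φ) z =
      ∑ x ∈ S, (w * ∏ i ∈ Finset.univ.erase j, κ i (z i - P x i)) * φ (z j - P x j) := by
  rw [← gD_upd, Function.update_eq_self]

lemma gD_cAv (κ : Fin d → ℝ → ℝ) (j : Fin d) (φ : ℝ → ℝ) (s : ℝ) :
    cAv s j (gD S w P (Function.update κ j φ)) = gD S w P (Function.update κ j (tAv φ s)) := by
  funext z
  unfold cAv
  simp only [gD_upd]
  rw [gD_upd']
  rw [ksum_av]

lemma gD_bd {T s α β : ℝ} (hT : 0 < T) (hs : 0 < s) (h2 : 2 * s ≤ T)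
    (h : ∀ z, α ≤ gD S w P (fun _ => kb T s) z ∧ gD S w P (fun _ => kb T s) z ≤ β)
    (κ : Fin d → ℝ → ℝ) (hκ : ∀ j, κ j = kb T s ∨ κ j = kH T s ∨ κ j = kH T (2 * s)) (z : Fin d → ℝ) :
    α ≤ gD S w P κ z ∧ gD S w P κ z ≤ β := by
  have key : ∀ U : Finset (Fin d), ∀ κ : Fin d → ℝ → ℝ, (∀ j, κ j = kb T s ∨ κ j = kH T s ∨ κ j = kH T (2 * s)) →
      (∀ j, j ∉ U → κ j = kb T s) → ∀ z, α ≤ gD S w P κ z ∧ gD S w P κ z ≤ β := by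
    intro U
    induction U using Finset.induction_on with
    | empty =>
      intro κ _ h2
      have : κ = fun _ => kb T s := funext fun j => h2 j (by simp)
      rw [this]; exact h
    | insert j U hj ih =>
      intro κ h1 hU z
      have h0 : ∀ z, α ≤ gD S w P (Function.update κ j (kb T s)) z ∧ gD S w P (Function.update κ j (kb T s)) z ≤ β := by
        refine ih _ (fun i => ?_) (fun i hi => ?_)
        · by_cases hij : i = j
          · subst hij; simp
          · simpa [hij] using h1 i
        · by_cases hij : i = j
          · subst hij; simp
          · simpa [hij] using hU i (by simp [hij, hi])
      have hb : ∀ t, _ := fun t => h0 (Function.update z j t)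
      simp only [gD_upd] at hb
      have hH := ksum_bd S _ _ hs hb
      have hH2 := ksum_bd2 S _ _ (s := s) hH
      have e2 : kH T (2 * s) = tAv (kH T s) s := funext fun t => kH_refine hT hs h2 t
      rw [← e2] at hH2
      rw [← Function.update_eq_self j κ, gD_upd']
      rcases h1 j with e | e | e <;> rw [e]
      · exact hb _
      · exact hH _
      · exact hH2 _
  exact key Finset.univ κ hκ (by simp) z

lemma gD_lip {T s α β : ℝ} (hT : 0 < T) (hs : 0 < s) (h2 : 2 * s ≤ T)
    (h : ∀ z, α ≤ gD S w P (fun _ => kb T s) z ∧ gD S w P (fun _ => kb T s) z ≤ β)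
    (κ : Fin d → ℝ → ℝ) (hκ : ∀ j, κ j = kH T s ∨ κ j = kH T (2 * s)) :
    CLip ((β - α) / s) (gD S w P κ) := by
  intro z j t t'
  have h0 := gD_bd S w P hT hs h2 h (Function.update κ j (kb T s)) (fun i => by
    by_cases hij : i = j
    · subst hij; simp
    · rw [Function.update_of_ne hij]; exact Or.inr (hκ i))
  have hb : ∀ t, _ := fun t => h0 (Function.update z j t)
  simp only [gD_upd] at hb
  have hH := ksum_lip S _ _ hs hb
  have hH2 := ksum_lip2 S _ _ (s := s) hH
  have e2 : kH T (2 * s) = tAv (kH T s) s := funext fun t => kH_refine hT hs h2 t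
  rw [← e2] at hH2
  rw [← Function.update_eq_self j κ, gD_upd, gD_upd]
  rcases hκ j with e | e <;> rw [e]
  · exact hH _ _
  · exact hH2 _ _

lemma gD_per {T : ℝ} (κ : Fin d → ℝ → ℝ) (hκ : ∀ j, Function.Periodic (κ j) T) : CPer T (gD S w P κ) := by
  intro z j
  unfold gD
  congr 1
  refine Finset.sum_congr rfl fun x _ => Finset.prod_congr rfl fun i _ => ?_
  by_cases hij : i = j
  · subst hij
    rw [Function.update_self, show z i + T - P x i = z i - P x i + T by ring, hκ]
  · rw [Function.update_of_ne hij]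

lemma gD_step {T s α β : ℝ} (hT : 0 < T) (hs : 0 < s) (h2 : 2 * s ≤ T) (hα : 0 < α)
    (h : ∀ z, α ≤ gD S w P (fun _ => kb T s) z ∧ gD S w P (fun _ => kb T s) z ≤ β) :
    TorTr T ((1 + (β - α) * (1 / α + (β - α) / (4 * α ^ 2))) ^ d)
      (gD S w P (fun _ => kH T s)) (gD S w P (fun _ => kH T (2 * s))) := by
  have hβα : 0 ≤ β - α := by linarith [(h 0).1, (h 0).2]
  set C := 1 + (β - α) * (1 / α + (β - α) / (4 * α ^ 2)) with hC
  have hC0 : 0 ≤ C := by positivity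
  have key : ∀ U : Finset (Fin d), TorTr T (C ^ U.card) (gD S w P (fun _ => kH T s))
      (gD S w P (U.piecewise (fun _ => kH T (2 * s)) (fun _ => kH T s))) := by
    intro U
    induction U using Finset.induction_on with
    | empty => simpa using TorTr.refl T _
    | insert j U hj ih =>
      rw [Finset.card_insert_of_notMem hj, pow_succ]
      refine ih.comp hC0 ?_
      set κ := U.piecewise (fun _ => kH T (2 * s)) (fun _ => kH T s) with hκ
      have hκc : ∀ i, κ i = kH T s ∨ κ i = kH T (2 * s) := by
        intro i
        by_cases hi : i ∈ U <;> simp [hκ, hi]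
      have hκj : κ j = kH T s := by simp [hκ, hj]
      have hbd := gD_bd S w P hT hs h2 h κ (fun i => Or.inr (hκc i))
      obtain ⟨F, f1, f2, f3, f4⟩ := transport j (gD S w P κ) hα (fun z => (hbd z).1) (fun z => (hbd z).2) hs hT
        (gD_per S w P κ fun i => by
          rcases hκc i with e | e <;> rw [e] <;> exact kH_per hT _)
        (gD_lip S w P hT hs h2 h κ hκc)
      have e : cAv s j (gD S w P κ) = gD S w P ((insert j U).piecewise (fun _ => kH T (2 * s)) (fun _ => kH T s)) := by
        rw [Finset.piecewise_insert, ← hκ]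
        conv_lhs => rw [← Function.update_eq_self j κ, hκj]
        rw [gD_cAv]
        congr 2
        exact (funext fun t => kH_refine hT hs h2 t).symm
      rw [e] at f4
      exact ⟨F, f1, f2, f3, f4⟩
  have := key Finset.univ
  simpa using this

lemma gD_full {T : ℝ} (hT : 0 < T) (z : Fin d → ℝ) : gD S w P (fun _ => kH T T) z = w * (S.card * (1 / T) ^ d) := by
  unfold gD
  simp [kH_full hT]

lemma gD_chain (l i1 : ℕ) (hi : i1 ≤ l) (α β : ℕ → ℝ) (hα : ∀ i, i1 ≤ i → i < l → 0 < α i)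
    (h : ∀ i, i1 ≤ i → i < l → ∀ z, α i ≤ gD S w P (fun _ => kb (2^l) (2^i)) z ∧
      gD S w P (fun _ => kb (2^l) (2^i)) z ≤ β i) :
    TorTr (2^l) (∏ i ∈ Finset.Ico i1 l, (1 + (β i - α i) * (1 / α i + (β i - α i) / (4 * α i ^ 2))) ^ d)
      (gD S w P (fun _ => kH (2^l) (2^i1))) (gD S w P (fun _ => kH (2^l) (2^l))) := by
  induction hi using Nat.decreasingInduction with
  | self => simpa using TorTr.refl _ _
  | of_succ i hi ih =>
    rw [Finset.prod_eq_prod_Ico_succ_bot hi]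
    have h2 : 2 * (2:ℝ)^i ≤ 2^l := by
      rw [← pow_succ']; exact pow_le_pow_right₀ (by norm_num) hi
    have st := gD_step S w P (T := 2^l) (s := 2^i) (by positivity) (by positivity) h2 (hα i le_rfl hi) (h i le_rfl hi)
    rw [← pow_succ'] at st
    refine st.comp ?_ (ih (fun k hk => hα k (by omega)) (fun k hk => h k (by omega)))
    refine Finset.prod_nonneg fun k hk => ?_
    rw [Finset.mem_Ico] at hk
    have a := hα k (by omega) hk.2
    have b := h k (by omega) hk.2 0
    have : 0 ≤ β k - α k := by linarith [b.1, b.2]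
    positivity
end dens
end

section
open MeasureTheory Set

noncomputable def tdl (T t : ℝ) : ℝ := |t - T * round (t / T)|

lemma tdl_le {T : ℝ} (hT : 0 < T) (t : ℝ) (k : ℤ) : tdl T t ≤ |t - T * k| := by
  unfold tdl
  have := round_le (t / T) k
  have h1 : ∀ r : ℝ, |t - T * r| = T * |t / T - r| := by
    intro r
    rw [← abs_of_pos hT, ← abs_mul, abs_of_pos hT]
    congr 1; field_simp
  rw [h1, h1]
  exact mul_le_mul_of_nonneg_left this hT.le

lemma tdl_half {T : ℝ} (hT : 0 < T) (t : ℝ) : tdl T t ≤ T / 2 := by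
  unfold tdl
  have := abs_sub_round (t / T)
  have h1 : ∀ r : ℝ, |t - T * r| = T * |t / T - r| := by
    intro r
    rw [← abs_of_pos hT, ← abs_mul, abs_of_pos hT]
    congr 1; field_simp
  rw [h1]
  nlinarith

lemma tdl_lip {T : ℝ} (hT : 0 < T) (t t' : ℝ) (k : ℤ) : |tdl T t - tdl T t'| ≤ |t - t' - T * k| := by
  rw [abs_le]
  constructor
  · have h1 := tdl_le hT t' (round (t / T) - k)
    have h2 : |t' - T * ((round (t/T) - k : ℤ) : ℝ)| ≤ |t - T * round (t/T)| + |t - t' - T * k| := by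
      push_cast
      rw [show t' - T * (round (t/T) - k) = (t - T * round (t/T)) - (t - t' - T * k) by ring]
      exact abs_sub _ _
    unfold tdl at *
    linarith
  · have h1 := tdl_le hT t (round (t' / T) + k)
    have h2 : |t - T * ((round (t'/T) + k : ℤ) : ℝ)| ≤ |t' - T * round (t'/T)| + |t - t' - T * k| := by
      push_cast
      rw [show t - T * (round (t'/T) + k) = (t' - T * round (t'/T)) + (t - t' - T * k) by ring]
      exact abs_add_le _ _
    unfold tdl at *
    linarith

lemma tdl_dom {T : ℝ} (hT : 0 < T) {t : ℝ} (h0 : 0 < t) (h1 : t ≤ T) : tdl T t = t ∨ tdl T t = T - t := by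
  unfold tdl
  have a : 0 < t / T := by positivity
  have b : t / T ≤ 1 := by rw [div_le_one hT]; exact h1
  have : round (t/T) = 0 ∨ round (t/T) = 1 := by
    rw [round_eq]
    have c1 : 0 ≤ ⌊t/T + 1/2⌋ := Int.floor_nonneg.2 (by linarith)
    have c2 : ⌊t/T + 1/2⌋ < 2 := Int.floor_lt.2 (by push_cast; linarith)
    omega
  rcases this with e | e <;> rw [e]
  · left; simp [abs_of_pos h0]
  · right; rw [abs_sub_comm, abs_of_nonneg] <;> push_cast <;> linarith

lemma tdl_cell {T h y : ℝ} (hT : 0 < T) (hh : 0 < h) :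
    volume.restrict (Ioc 0 T) {t | y - 1 ≤ 2 * h * tdl T t ∧ 2 * h * tdl T t ≤ y} ≤ ENNReal.ofReal (1 / h) := by
  rw [Measure.restrict_apply' measurableSet_Ioc]
  have sub : {t | y - 1 ≤ 2 * h * tdl T t ∧ 2 * h * tdl T t ≤ y} ∩ Ioc 0 T ⊆
      Icc ((y-1)/(2*h)) (y/(2*h)) ∪ Icc (T - y/(2*h)) (T - (y-1)/(2*h)) := by
    rintro t ⟨⟨h1, h2⟩, h3, h4⟩
    have a1 : (y-1)/(2*h) ≤ tdl T t := by rw [div_le_iff₀ (by positivity)]; linarith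
    have a2 : tdl T t ≤ y/(2*h) := by rw [le_div_iff₀ (by positivity)]; linarith
    rcases tdl_dom hT h3 h4 with e | e
    · left; rw [e] at a1 a2; exact ⟨a1, a2⟩
    · right; rw [e] at a1 a2; constructor <;> linarith
  refine (measure_mono sub).trans ((measure_union_le _ _).trans ?_)
  rw [Real.volume_Icc, Real.volume_Icc, ← ENNReal.ofReal_add]
  · refine ENNReal.ofReal_le_ofReal (le_of_eq ?_)
    field_simp; ring
  · rw [← sub_div]; apply div_nonneg <;> linarith
  · rw [show T - (y-1)/(2*h) - (T - y/(2*h)) = y/(2*h) - (y-1)/(2*h) by ring, ← sub_div]; apply div_nonneg <;> linarith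

lemma CEqv.int {d : ℕ} {T : ℝ} {F : (Fin d → ℝ) → (Fin d → ℝ)} (h : CEqv T F) (z : Fin d → ℝ) (k : Fin d → ℤ) :
    F (fun j => z j + T * k j) = fun j => F z j + T * k j := by
  have h1 : ∀ (j : Fin d) (q : ℤ) z, F (Function.update z j (z j + T * q)) = Function.update (F z) j (F z j + T * q) := by
    intro j q
    induction q using Int.induction_on with
    | zero => intro z; simp
    | succ q ih =>
      intro z
      have a := h (Function.update z j (z j + T * (q:ℤ))) j
      rw [ih z] at a
      simp only [Function.update_self, Function.update_idem] at a
      push_cast at a ⊢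
      rw [show z j + T * ((q:ℝ) + 1) = z j + T * q + T by ring, a]
      congr 1; ring
    | pred q ih =>
      intro z
      have a := h (Function.update z j (z j + T * ((-(q:ℤ) - 1 : ℤ) : ℝ))) j
      simp only [Function.update_self, Function.update_idem] at a
      have e : z j + T * ((-(q:ℤ) - 1 : ℤ) : ℝ) + T = z j + T * ((-(q:ℤ) : ℤ) : ℝ) := by push_cast; ring
      rw [e, ih z] at a
      funext i
      by_cases hij : i = j
      · subst hij
        have := congrFun a i
        simp only [Function.update_self] at this ⊢
        push_cast at this ⊢
        linarith
      · have := congrFun a i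
        simp only [Function.update_of_ne hij] at this ⊢
        exact this.symm
  have h2 : ∀ U : Finset (Fin d), F (fun j => if j ∈ U then z j + T * k j else z j) =
      fun j => if j ∈ U then F z j + T * k j else F z j := by
    intro U
    induction U using Finset.induction_on with
    | empty => simp
    | insert j U hj ih =>
      have a := h1 j (k j) (fun j => if j ∈ U then z j + T * k j else z j)
      rw [ih] at a
      simp only [hj, if_false] at a
      convert a using 1
      · congr 1
        funext i
        by_cases hij : i = j
        · subst hij; simp
        · simp [hij]
      · funext i
        by_cases hij : i = j
        · subst hij; simp
        · simp [hij]
  simpa using h2 Finset.univ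

lemma prod_kH_lint {d : ℕ} (i l : ℕ) (hil : i ≤ l) (q : Fin d → ℝ) :
    ∫⁻ z, ENNReal.ofReal (∏ j, kH (2^l) (2^i) (z j - q j)) ∂(torM d (2^l)) = 1 := by
  have hs : (0:ℝ) < 2^i := by positivity
  have c : Continuous (kH (2^l) (2^i)) := kH_cont hs
  have : IsFiniteMeasure (volume.restrict (Ioc (0:ℝ) (2^l))) := ⟨by simp⟩
  have h1 : ∀ j : Fin d, ∫ t, kH (2^l) (2^i) (t - q j) ∂(volume.restrict (Ioc (0:ℝ) (2^l))) = 1 := by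
    intro j
    rw [← kH_int_shift i l hil (q j), intervalIntegral.integral_of_le (by positivity)]
  have h2 : ∀ j : Fin d, Integrable (fun t => kH (2^l) (2^i) (t - q j)) (volume.restrict (Ioc (0:ℝ) (2^l))) := by
    intro j
    by_contra hn
    have := h1 j
    rw [integral_undef hn] at this
    norm_num at this
  rw [← ofReal_integral_eq_lintegral_ofReal]
  · unfold torM
    rw [integral_fintype_prod_eq_prod (𝕜 := ℝ) (f := fun j t => kH (2^l) (2^i) (t - q j))]
    simp [h1]
  · unfold torM
    exact Integrable.fintype_prod (𝕜 := ℝ) (f := fun j t => kH (2^l) (2^i) (t - q j)) h2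
  · exact Filter.Eventually.of_forall fun z => Finset.prod_nonneg fun j _ => kH_nonneg hs _

lemma hallB {d : ℕ} {X : Type*} (S : Finset X) (P : X → Fin d → ℝ) (l n i1 : ℕ) (hi : i1 ≤ l) (hn : 0 < n)
    (hS : S.card = n ^ d) (K : ℝ) (hK : 0 ≤ K)
    (hT : TorTr (2^l) K (gD S ((2^l/n)^d) P (fun _ => kH (2^l) (2^i1))) (gD S ((2^l/n)^d) P (fun _ => kH (2^l) (2^l)))) :
    ∃ g : X → Fin d → ℤ, InjOn g S ∧ (∀ x ∈ S, ∀ j, 1 ≤ g x j ∧ g x j ≤ n) ∧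
      ∀ x ∈ S, ∀ y ∈ S, ∀ j, |(g x j : ℝ) - g y j| ≤ 2 + 2 * (n / 2^l) * (2 * (K * (d * 2^i1)) + K * l1 (P x) (P y)) := by
  classical
  obtain ⟨F, hF1, hF2, hF3, hF4⟩ := hT
  set T : ℝ := 2^l with hTd
  have hT0 : 0 < T := by positivity
  have hn0 : (0:ℝ) < n := by exact_mod_cast hn
  set h : ℝ := n / T with hh
  have hh0 : 0 < h := by positivity
  set w : ℝ := (T/n)^d with hw
  have hw0 : 0 < w := by positivity
  have hs : (0:ℝ) < 2^i1 := by positivity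
  set ρ := K * (d * 2^i1) with hρ
  set near : X → (Fin d → ℝ) → Prop := fun x v => ∃ k : Fin d → ℤ, l1 v (fun j => F (P x) j + T * k j) ≤ ρ with hnear
  set cell : (Fin d → ℤ) → Set (Fin d → ℝ) := fun y => univ.pi fun j => {t | (y j : ℝ) - 1 ≤ 2 * h * tdl T t ∧ 2 * h * tdl T t ≤ y j} with hcell
  set t : {x // x ∈ S} → Finset (Fin d → ℤ) := fun x =>
    (Fintype.piFinset fun _ => Finset.Icc (1:ℤ) n).filter fun y => ∃ v, near x v ∧ v ∈ cell y with ht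
  have hall : ∀ A : Finset {x // x ∈ S}, A.card ≤ (A.biUnion t).card := by
    intro A
    set V : Set (Fin d → ℝ) := {v | ∃ x ∈ A, near x v} with hV
    have hl1c : ∀ q : Fin d → ℝ, Continuous fun v => l1 v q := by
      intro q; unfold l1; fun_prop
    have hVm : MeasurableSet V := by
      have : V = ⋃ x ∈ A, ⋃ k : Fin d → ℤ, {v | l1 v (fun j => F (P x) j + T * k j) ≤ ρ} := by
        ext v; simp [hV, hnear]
      rw [this]
      refine Finset.measurableSet_biUnion _ fun x _ => MeasurableSet.iUnion fun k => ?_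
      exact measurableSet_le (hl1c _).measurable measurable_const
    have hVp : ∀ v j, v ∈ V → Function.update v j (v j + T) ∈ V ∧ Function.update v j (v j - T) ∈ V := by
      rintro v j ⟨x, hx, k, hk⟩
      refine ⟨⟨x, hx, Function.update k j (k j + 1), ?_⟩, ⟨x, hx, Function.update k j (k j - 1), ?_⟩⟩
      · refine le_trans (le_of_eq ?_) hk
        unfold l1
        refine Finset.sum_congr rfl fun i _ => ?_
        by_cases hij : i = j
        · subst hij; simp; congr 1; ring
        · simp [hij]
      · refine le_trans (le_of_eq ?_) hk
        unfold l1
        refine Finset.sum_congr rfl fun i _ => ?_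
        by_cases hij : i = j
        · subst hij; simp; congr 1; ring
        · simp [hij]
    have hVp' : CPer T (V.indicator (1 : (Fin d → ℝ) → ENNReal)) := by
      intro v j
      by_cases hv : v ∈ V
      · rw [indicator_of_mem hv, indicator_of_mem (hVp v j hv).1]; rfl
      · rw [indicator_of_notMem hv, indicator_of_notMem]
        intro hc
        have := (hVp _ j hc).2
        simp at this
        exact hv this
    have mass := hF4 (V.indicator 1) (measurable_one.indicator hVm) hVp'
    have hfull : ∀ z, gD S w P (fun _ => kH T T) z = 1 := by
      intro z
      rw [gD_full S w P hT0, hS, hw]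
      push_cast
      rw [← mul_pow, ← mul_pow]
      have : T / n * (n * (1/T)) = 1 := by field_simp
      rw [this, one_pow]
    simp only [hfull, ENNReal.ofReal_one, mul_one] at mass
    rw [lintegral_indicator_one hVm] at mass
    have low : (A.card : ENNReal) * ENNReal.ofReal w ≤ torM d T V := by
      rw [← mass]
      calc (A.card : ENNReal) * ENNReal.ofReal w = ∑ x ∈ A, ENNReal.ofReal w * ∫⁻ z, ENNReal.ofReal (∏ j, kH T (2^i1) (z j - P x j)) ∂(torM d T) := by
            rw [Finset.sum_congr rfl (fun x _ => by rw [prod_kH_lint i1 l hi (P x)])]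
            simp
        _ = ∫⁻ z, ∑ x ∈ A, ENNReal.ofReal w * ENNReal.ofReal (∏ j, kH T (2^i1) (z j - P x j)) ∂(torM d T) := by
            have mm : ∀ x : {x // x ∈ S}, Measurable fun z : Fin d → ℝ => ENNReal.ofReal (∏ j, kH T (2^i1) (z j - P x j)) := by
              intro x
              have c : Continuous (kH T (2^i1)) := kH_cont hs
              apply Measurable.ennreal_ofReal
              apply Continuous.measurable
              fun_prop
            rw [lintegral_finsetSum _ (fun x _ => (mm x).const_mul _)]
            refine Finset.sum_congr rfl fun x _ => ?_
            rw [lintegral_const_mul _ (mm x)]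
        _ ≤ _ := by
            refine lintegral_mono fun z => ?_
            have hp0 : ∀ x : X, 0 ≤ ∏ j, kH T (2^i1) (z j - P x j) := fun x => Finset.prod_nonneg fun j _ => kH_nonneg hs _
            by_cases hz : F z ∈ V
            · simp only [indicator_of_mem hz, Pi.one_apply, one_mul]
              unfold gD
              rw [ENNReal.ofReal_mul hw0.le, ← Finset.mul_sum,
                ← ENNReal.ofReal_sum_of_nonneg (f := fun x : {x // x ∈ S} => ∏ j, kH T (2^i1) (z j - P x j)) (fun x _ => hp0 x)]
              refine mul_le_mul_right ?_ _
              refine ENNReal.ofReal_le_ofReal ?_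
              rw [← Finset.sum_coe_sort S]
              exact Finset.sum_le_sum_of_subset_of_nonneg (Finset.subset_univ A) (fun x _ _ => hp0 x)
            · simp only [indicator_of_notMem hz, zero_mul]
              refine le_of_eq (Finset.sum_eq_zero fun x hx => ?_)
              have : ∏ j, kH T (2^i1) (z j - P x j) = 0 := by
                by_contra hne
                apply hz
                rw [← ne_eq, Finset.prod_ne_zero_iff] at hne
                have hk : ∀ j, ∃ k : ℤ, |z j - P x j - T * k| ≤ 2^i1 := fun j => kH_supp hT0 hs (hne j (Finset.mem_univ j))
                choose k hk using hk
                refine ⟨x, hx, k, ?_⟩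
                rw [← hF2.int]
                refine (hF1 _ _).trans (mul_le_mul_of_nonneg_left ?_ hK)
                unfold l1
                calc ∑ j, |z j - (P x j + T * k j)| ≤ ∑ _j : Fin d, (2:ℝ)^i1 := Finset.sum_le_sum fun j _ => by
                      rw [← sub_sub]; exact hk j
                  _ = d * 2^i1 := by simp
              rw [this]; simp
    have up : torM d T V ≤ ((A.biUnion t).card : ENNReal) * ENNReal.ofReal w := by
      have hcov : V ⊆ ⋃ y ∈ A.biUnion t, cell y := by
        rintro v ⟨x, hx, hxv⟩
        rw [mem_iUnion₂]
        set y : Fin d → ℤ := fun j => max 1 ⌈2 * h * tdl T (v j)⌉ with hy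
        have hc : v ∈ cell y := by
          intro j _
          have hnn : 0 ≤ 2 * h * tdl T (v j) := by unfold tdl; positivity
          simp only [hy, mem_ofPred_eq, Int.cast_max, Int.cast_one]
          constructor
          · rw [sub_le_iff_le_add, max_le_iff]
            exact ⟨by linarith, (Int.ceil_lt_add_one _).le⟩
          · exact (Int.le_ceil _).trans (le_max_right _ _)
        refine ⟨y, ?_, hc⟩
        rw [Finset.mem_biUnion]
        refine ⟨x, hx, ?_⟩
        rw [ht, Finset.mem_filter, Fintype.mem_piFinset]
        refine ⟨fun j => ?_, v, hxv, hc⟩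
        rw [Finset.mem_Icc]
        refine ⟨le_max_left _ _, max_le (by exact_mod_cast hn) ?_⟩
        rw [Int.ceil_le]
        push_cast
        have := tdl_half hT0 (v j)
        calc 2 * h * tdl T (v j) ≤ 2 * h * (T/2) := mul_le_mul_of_nonneg_left this (by positivity)
          _ = n := by rw [hh]; field_simp
      refine (measure_mono hcov).trans ((measure_biUnion_finset_le _ _).trans ?_)
      calc ∑ y ∈ A.biUnion t, torM d T (cell y) ≤ ∑ _y ∈ A.biUnion t, ENNReal.ofReal w := by
            refine Finset.sum_le_sum fun y _ => ?_
            unfold torM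
            rw [hcell, Measure.pi_pi]
            calc _ ≤ ∏ _j : Fin d, ENNReal.ofReal (1/h) := Finset.prod_le_prod' fun j _ => tdl_cell hT0 hh0
              _ = ENNReal.ofReal w := by
                rw [Finset.prod_const, Finset.card_univ, Fintype.card_fin, ← ENNReal.ofReal_pow (by positivity), hw, hh, one_div_div]
        _ = _ := by simp
    have := low.trans up
    rw [ENNReal.mul_le_mul_iff_left (by simpa using hw0) ENNReal.ofReal_ne_top] at this
    exact_mod_cast this
  obtain ⟨f, hfi, hft⟩ := (Finset.all_card_le_biUnion_card_iff_exists_injective t).1 hall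
  refine ⟨fun x => if hx : x ∈ S then f ⟨x, hx⟩ else 0, ?_, ?_, ?_⟩
  · intro x hx y hy hxy
    simp only [Finset.mem_coe] at hx hy
    simp only [hx, hy, dite_true] at hxy
    have := hfi hxy
    simpa using this
  · intro x hx j
    have := hft ⟨x, hx⟩
    rw [ht, Finset.mem_filter, Fintype.mem_piFinset] at this
    have := this.1 j
    rw [Finset.mem_Icc] at this
    simpa [hx] using this
  · intro x hx y hy j
    simp only [hx, hy, dite_true]
    have key : ∀ x (hx : x ∈ S), |(f ⟨x, hx⟩ j : ℝ) - 2 * h * tdl T (F (P x) j)| ≤ 1 + 2 * h * ρ := by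
      intro x hx
      have := hft ⟨x, hx⟩
      rw [ht, Finset.mem_filter] at this
      obtain ⟨_, v, ⟨k, hk⟩, hv⟩ := this
      have h1 := hv j (mem_univ j)
      simp only [mem_ofPred_eq] at h1
      have h2 := (l1_coord _ _ j).trans hk
      simp only at h2
      have h3 := tdl_lip hT0 (v j) (F (P x) j) (k j)
      rw [← sub_sub] at h2
      have h4 := h3.trans h2
      have h5 : |2 * h * tdl T (v j) - 2 * h * tdl T (F (P x) j)| ≤ 2 * h * ρ := by
        rw [← mul_sub, abs_mul, abs_of_pos (by positivity : 0 < 2 * h)]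
        exact mul_le_mul_of_nonneg_left h4 (by positivity)
      rw [abs_le] at h5 ⊢
      constructor <;> linarith [h1.1, h1.2, h5.1, h5.2]
    have kx := key x hx
    have ky := key y hy
    have h3 := tdl_lip hT0 (F (P x) j) (F (P y) j) 0
    have h4 := (l1_coord _ _ j).trans (hF1 (P x) (P y))
    simp only [Int.cast_zero, mul_zero, sub_zero] at h3
    have h5 : |2 * h * tdl T (F (P x) j) - 2 * h * tdl T (F (P y) j)| ≤ 2 * h * (K * l1 (P x) (P y)) := by
      rw [← mul_sub, abs_mul, abs_of_pos (by positivity : 0 < 2 * h)]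
      exact mul_le_mul_of_nonneg_left (h3.trans h4) (by positivity)
    rw [abs_le] at *
    constructor <;> nlinarith
end

section
open MeasureTheory Set

/-- hypotheses of the main theorem -/
def Hyp (d : ℕ) (θ : ℝ) (m n l : ℕ) (a b c : ℝ) (S : Finset (Fin d → ℤ)) : Prop :=
  m = 2 ^ l ∧ m ≤ n ∧ θ < a ∧ a < b ∧ b < 1 / θ ∧ 1 < c ∧
        (∀ x ∈ S, ∀ i, (0 : ℝ) ≤ (x i : ℝ) ∧ (x i : ℝ) ≤ c * n) ∧
        S.card = n ^ d ∧
        (∀ p : Fin d → Fin m,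
          a * n ^ d / m ^ d ≤
            (Set.ncard {x | x ∈ S ∧ ∀ i,
              c * n * (p i : ℕ) / m < (x i : ℝ) ∧
              (x i : ℝ) ≤ c * n * ((p i : ℕ) + 1) / m} : ℝ) ∧
          (Set.ncard {x | x ∈ S ∧ ∀ i,
              c * n * (p i : ℕ) / m < (x i : ℝ) ∧
              (x i : ℝ) ≤ c * n * ((p i : ℕ) + 1) / m} : ℝ) ≤ b * n ^ d / m ^ d)

open Classical in
/-- number of points of `S` whose index lies in the window `z + [0,s)^d` modulo `m` -/
noncomputable def wc {d : ℕ} {X : Type*} (S : Finset X) (m : ℕ) (P : X → Fin d → ℤ) (z : Fin d → ℤ) (s : ℕ) : ℕ :=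
  (S.filter fun x => ∀ j, (P x j - z j) % (m:ℤ) < s).card

def ThmA (d : ℕ) (θ : ℝ) : Prop :=
  ∃ (CA : ℝ) (i0 : ℕ), 0 < CA ∧ ∀ m n l a b c S, Hyp d θ m n l a b c S →
    ∃ P : (Fin d → ℤ) → (Fin d → ℤ), (∀ x y j, |((P x j : ℤ):ℝ) - P y j| ≤ CA * dist x y) ∧
      ∀ i, i0 ≤ i → i < l → ∃ α β : ℝ, θ / 2 ≤ α ∧ β ≤ α + (b - a) + CA * (1/2)^(i / (16 * d)) ∧
        ∀ z : Fin d → ℤ, α * (n / m)^d * (2^i)^d ≤ wc S m P z (2^i) ∧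
          wc S m P z (2^i) ≤ β * (n / m)^d * (2^i)^d

lemma geo_sum (q : ℕ) (l : ℕ) : ∑ i ∈ Finset.range l, (1/2:ℝ)^(i / q) ≤ 2 * q + (if q = 0 then (l:ℝ) else 0) := by
  rcases Nat.eq_zero_or_pos q with rfl | hq
  · simp
  rw [if_neg hq.ne', add_zero]
  induction l using Nat.strong_induction_on with
  | _ l ih =>
    rcases lt_or_ge l q with h | h
    · calc ∑ i ∈ Finset.range l, (1/2:ℝ)^(i / q) ≤ ∑ i ∈ Finset.range l, (1:ℝ) :=
            Finset.sum_le_sum fun i _ => pow_le_one₀ (by norm_num) (by norm_num)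
        _ = l := by simp
        _ ≤ 2 * q := by exact_mod_cast (by omega : l ≤ 2 * q)
    · obtain ⟨r, rfl⟩ := Nat.exists_eq_add_of_le h
      rw [Finset.sum_range_add]
      have h1 : ∑ i ∈ Finset.range q, (1/2:ℝ)^(i / q) = q := by
        rw [Finset.sum_congr rfl (g := fun _ => (1:ℝ))]
        · simp
        · intro i hi
          rw [Nat.div_eq_of_lt (Finset.mem_range.1 hi), pow_zero]
      have h2 : ∑ i ∈ Finset.range r, (1/2:ℝ)^((q + i) / q) = (1/2) * ∑ i ∈ Finset.range r, (1/2:ℝ)^(i / q) := by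
        rw [Finset.mul_sum]
        refine Finset.sum_congr rfl fun i _ => ?_
        rw [Nat.add_div_left _ hq, pow_succ']
      have := ih r (by omega)
      rw [h1, h2]
      linarith

lemma emod_window (p z : ℤ) (m s : ℕ) (hm : 0 < m) (hs : s ≤ m) :
    (z - p) % (m:ℤ) < s ↔ (p - (z - s + 1)) % (m:ℤ) < s := by
  have hm' : (0:ℤ) < m := by exact_mod_cast hm
  have h1 := Int.emod_nonneg (z - p) hm'.ne'
  have h2 := Int.emod_lt_of_pos (z - p) hm'
  have e := Int.emod_add_mul_ediv (z - p) m
  set r := (z - p) % (m:ℤ) with hr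
  have hs' : (s:ℤ) ≤ m := by exact_mod_cast hs
  by_cases h : r < s
  · have : (p - (z - s + 1)) % (m:ℤ) = s - 1 - r := by
      rw [Int.emod_eq_iff hm'.ne']
      refine ⟨by omega, by omega, ⟨((z-p) / m), by linarith⟩⟩
    rw [this]; constructor <;> intro <;> omega
  · have : (p - (z - s + 1)) % (m:ℤ) = s - 1 - r + m := by
      rw [Int.emod_eq_iff hm'.ne']
      refine ⟨by omega, by omega, ⟨((z-p) / m) + 1, by linarith⟩⟩
    rw [this]; constructor <;> intro <;> omega

lemma fract_window (p : ℤ) (t : ℝ) (m s : ℕ) (hm : 0 < m) (hs : s ≤ m) :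
    Int.fract ((t - p) / m) < s / m ↔ (p - (⌊t⌋ - s + 1)) % (m:ℤ) < s := by
  rw [← emod_window p ⌊t⌋ m s hm hs]
  have hm' : (0:ℤ) < m := by exact_mod_cast hm
  have hmr : (0:ℝ) < m := by exact_mod_cast hm
  have h1 := Int.emod_nonneg (⌊t⌋ - p) hm'.ne'
  have h2 := Int.emod_lt_of_pos (⌊t⌋ - p) hm'
  have e := Int.emod_add_mul_ediv (⌊t⌋ - p) m
  set r := (⌊t⌋ - p) % (m:ℤ) with hr
  have f0 := Int.fract_nonneg t
  have f1 := Int.fract_lt_one t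
  have ef := Int.floor_add_fract t
  have h2' : (r:ℝ) + 1 ≤ m := by exact_mod_cast h2
  have h1' : (0:ℝ) ≤ r := by exact_mod_cast h1
  have e' : (r:ℝ) + m * ((⌊t⌋ - p) / (m:ℤ) : ℤ) = ⌊t⌋ - p := by exact_mod_cast e
  have : Int.fract ((t - p) / m) = (r + Int.fract t) / m := by
    rw [Int.fract_eq_iff]
    refine ⟨by positivity, by rw [div_lt_one hmr]; linarith, (⌊t⌋ - p) / (m:ℤ), ?_⟩
    rw [← sub_div, div_eq_iff hmr.ne']
    linarith
  rw [this, div_lt_div_iff_of_pos_right hmr]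
  constructor
  · intro h
    have : (r:ℝ) < s := by linarith
    exact_mod_cast this
  · intro h
    have : (r:ℝ) + 1 ≤ s := by exact_mod_cast h
    linarith

lemma gD_kb {d : ℕ} {X : Type*} (S : Finset X) (w : ℝ) (P : X → Fin d → ℤ) (m s : ℕ) (hm : 0 < m) (hs : s ≤ m)
    (z : Fin d → ℝ) :
    gD S w (fun x j => (P x j : ℝ)) (fun _ => kb m s) z = w * ((1 / s)^d * wc S m P (fun j => ⌊z j⌋ - s + 1) s) := by
  classical
  unfold gD wc
  congr 1
  rw [Finset.card_filter]
  push_cast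
  rw [Finset.mul_sum]
  refine Finset.sum_congr rfl fun x _ => ?_
  unfold kb
  simp only [fract_window _ _ m s hm hs]
  rw [Finset.prod_ite_zero]
  simp

lemma zdist_coord {d : ℕ} (x y : Fin d → ℤ) (j : Fin d) : |(x j : ℝ) - y j| ≤ zdist x y := by
  unfold zdist
  rw [← Real.sqrt_sq_eq_abs]
  exact Real.sqrt_le_sqrt (Finset.single_le_sum (f := fun i => ((x i : ℝ) - y i)^2) (fun _ _ => sq_nonneg _) (Finset.mem_univ j))

lemma dist_le_zdist {d : ℕ} (x y : Fin d → ℤ) : dist x y ≤ zdist x y := by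
  rw [dist_pi_le_iff (show 0 ≤ zdist x y from Real.sqrt_nonneg _)]
  intro j
  rw [Int.dist_eq]
  exact zdist_coord x y j

lemma zdist_le {d : ℕ} (x y : Fin d → ℤ) {B : ℝ} (hB : 0 ≤ B) (h : ∀ j, |(x j : ℝ) - y j| ≤ B) : zdist x y ≤ d * B := by
  unfold zdist
  rw [Real.sqrt_le_left (by positivity)]
  calc ∑ i, ((x i : ℝ) - y i)^2 ≤ ∑ _i : Fin d, B^2 := Finset.sum_le_sum fun i _ => by
        rw [← sq_abs]; exact pow_le_pow_left₀ (abs_nonneg _) (h i) 2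
    _ = d * B^2 := by simp
    _ ≤ (d * B)^2 := by
      rw [mul_pow]
      refine mul_le_mul_of_nonneg_right ?_ (sq_nonneg B)
      exact_mod_cast Nat.le_self_pow (by norm_num) d

lemma one_le_dist {d : ℕ} {x y : Fin d → ℤ} (h : x ≠ y) : 1 ≤ dist x y := by
  obtain ⟨j, hj⟩ := Function.ne_iff.1 h
  refine le_trans ?_ (dist_le_pi_dist x y j)
  rw [Int.dist_eq]
  have : (1:ℤ) ≤ |x j - y j| := Int.one_le_abs (sub_ne_zero.2 hj)
  exact_mod_cast this

lemma main_of_A (d : ℕ) (hd : 1 ≤ d) (θ : ℝ) (hθ0 : 0 < θ) (hA : ThmA d θ) :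
    ∃ Λ : ℝ, 0 < Λ ∧ ∃ Δ : ℝ, 0 < Δ ∧
      ∀ (m n l : ℕ) (a b c : ℝ) (S : Finset (Fin d → ℤ)), Hyp d θ m n l a b c S →
        ∃ g : (Fin d → ℤ) → (Fin d → ℤ),
          Set.BijOn g ↑S {y : Fin d → ℤ | ∀ i, 1 ≤ y i ∧ y i ≤ (n : ℤ)} ∧
          ∀ x ∈ S, ∀ y ∈ S,
            zdist (g x) (g y) ≤
              Λ * (2 : ℝ) ^ (Real.logb 2 n - l * (1 - Δ * (b - a))) * zdist x y := by
  obtain ⟨CA, i0, hCA, hA⟩ := hA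
  have hd0 : (0:ℝ) < d := by exact_mod_cast hd
  set D := 1 / θ + CA with hD
  set C3 := 2 / θ + D / θ^2 with hC3
  have hD0 : 0 < D := by positivity
  have hC30 : 0 < C3 := by positivity
  set K1 := Real.exp (d * C3 * CA * (32 * d)) with hK1
  have hK10 : 0 < K1 := Real.exp_pos _
  refine ⟨d * (2 + 4 * K1 * d * 2^i0 + 2 * K1 * d * CA), by positivity, d * C3 / Real.log 2,
    div_pos (by positivity) (Real.log_pos (by norm_num)), ?_⟩
  intro m n l a b c S hyp
  obtain ⟨P, hP, hdens⟩ := hA m n l a b c S hyp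
  obtain ⟨hm, hmn, hθa, hab, hbθ, hc, hbox, hcard, -⟩ := hyp
  have hm0 : 0 < m := by rw [hm]; positivity
  have hn0 : 0 < n := by omega
  have hnr : (0:ℝ) < n := by exact_mod_cast hn0
  have hmr : (0:ℝ) < m := by exact_mod_cast hm0
  have hmT : (m:ℝ) = 2^l := by rw [hm]; push_cast; rfl
  set i1 := min i0 l with hi1
  have ex : ∀ i, ∃ α β : ℝ, i1 ≤ i → i < l → θ / 2 ≤ α ∧ β ≤ α + (b - a) + CA * (1/2)^(i / (16 * d)) ∧
        ∀ z : Fin d → ℤ, α * (n / m)^d * (2^i)^d ≤ wc S m P z (2^i) ∧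
          wc S m P z (2^i) ≤ β * (n / m)^d * (2^i)^d := by
    intro i
    by_cases hi : i1 ≤ i ∧ i < l
    · obtain ⟨α, β, h⟩ := hdens i (by omega) hi.2
      exact ⟨α, β, fun _ _ => h⟩
    · exact ⟨0, 0, fun h1 h2 => absurd ⟨h1, h2⟩ hi⟩
  choose α β hαβ using ex
  have hgd : ∀ i, i1 ≤ i → i < l → ∀ z, α i ≤ gD S ((2^l/n)^d) (fun x j => (P x j : ℝ)) (fun _ => kb (2^l) (2^i)) z ∧
      gD S ((2^l/n)^d) (fun x j => (P x j : ℝ)) (fun _ => kb (2^l) (2^i)) z ≤ β i := by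
    intro i h1 h2 z
    have hs : 2^i ≤ m := by rw [hm]; exact Nat.pow_le_pow_right (by norm_num) h2.le
    have e := gD_kb S ((2^l/n)^d) P m (2^i) hm0 hs z
    push_cast at e
    rw [hmT] at e
    rw [e]
    have := (hαβ i h1 h2).2.2 (fun j => ⌊z j⌋ - 2^i + 1)
    rw [hmT] at this
    push_cast at this
    generalize ((wc S m P (fun j => ⌊z j⌋ - 2^i + 1) (2^i) : ℕ) : ℝ) = N at this ⊢
    have e2 : ((2:ℝ)^l/n)^d * ((1/2^i)^d * N) = N / ((n / 2^l)^d * (2^i)^d) := by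
      rw [div_pow, div_pow, div_pow]; field_simp; simp
    rw [e2, le_div_iff₀ (by positivity), div_le_iff₀ (by positivity)]
    constructor <;> nlinarith [this.1, this.2]
  have hβα : ∀ i, i1 ≤ i → i < l → 0 ≤ β i - α i := fun i h1 h2 => by
    linarith [(hgd i h1 h2 0).1, (hgd i h1 h2 0).2]
  have tr := gD_chain S ((2^l/n)^d) (fun x j => (P x j : ℝ)) l i1 (min_le_right _ _) α β
    (fun i h1 h2 => by linarith [(hαβ i h1 h2).1]) hgd
  set K := ∏ i ∈ Finset.Ico i1 l, (1 + (β i - α i) * (1 / α i + (β i - α i) / (4 * α i ^ 2))) ^ d with hKdef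
  set Q : ℝ := Real.exp (d * C3 * (b - a) * l) with hQ
  have hK0 : 0 ≤ K := by
    refine Finset.prod_nonneg fun i hi => ?_
    rw [Finset.mem_Ico] at hi
    have h1 := (hαβ i hi.1 hi.2).1
    have h2 := hβα i hi.1 hi.2
    have : 0 < α i := by linarith
    positivity
  have hKle : K ≤ K1 * Q := by
    have step : ∀ i ∈ Finset.Ico i1 l, (1 + (β i - α i) * (1 / α i + (β i - α i) / (4 * α i ^ 2))) ^ d ≤
        Real.exp (d * C3 * (b - a) + d * C3 * CA * (1/2)^(i / (16 * d))) := by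
      intro i hi
      rw [Finset.mem_Ico] at hi
      obtain ⟨h1, h2, -⟩ := hαβ i hi.1 hi.2
      have h3 := hβα i hi.1 hi.2
      have hα0 : 0 < α i := by linarith
      have hp1 : (1/2:ℝ)^(i / (16 * d)) ≤ 1 := pow_le_one₀ (by norm_num) (by norm_num)
      have hosc : β i - α i ≤ D := by
        have : CA * (1/2:ℝ)^(i / (16 * d)) ≤ CA := mul_le_of_le_one_right hCA.le hp1
        rw [hD]; linarith
      have hb1 : 1 / α i ≤ 2 / θ := by
        rw [div_le_div_iff₀ hα0 hθ0]; linarith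
      have hb2 : (β i - α i) / (4 * α i ^ 2) ≤ D / θ^2 := by
        refine div_le_div₀ hD0.le hosc (by positivity) ?_
        nlinarith
      have h4 : 1 + (β i - α i) * (1 / α i + (β i - α i) / (4 * α i ^ 2)) ≤
          Real.exp (C3 * (b - a) + C3 * CA * (1/2)^(i / (16 * d))) := by
        refine le_trans ?_ (Real.add_one_le_exp _)
        have : (β i - α i) * (1 / α i + (β i - α i) / (4 * α i ^ 2)) ≤ (b - a + CA * (1/2)^(i / (16 * d))) * C3 := by
          refine mul_le_mul (by linarith) (by rw [hC3]; linarith) (by positivity) ?_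
          have : 0 ≤ CA * (1/2:ℝ)^(i / (16 * d)) := by positivity
          linarith
        nlinarith
      calc _ ≤ (Real.exp (C3 * (b - a) + C3 * CA * (1/2)^(i / (16 * d))))^d :=
            pow_le_pow_left₀ (by positivity) h4 d
        _ = _ := by rw [← Real.exp_nat_mul]; congr 1; ring
    calc K ≤ ∏ i ∈ Finset.Ico i1 l, Real.exp (d * C3 * (b - a) + d * C3 * CA * (1/2)^(i / (16 * d))) := by
          refine Finset.prod_le_prod (fun i hi => ?_) step
          rw [Finset.mem_Ico] at hi
          have h1 := (hαβ i hi.1 hi.2).1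
          have h2 := hβα i hi.1 hi.2
          have : 0 < α i := by linarith
          positivity
      _ = Real.exp (∑ i ∈ Finset.Ico i1 l, (d * C3 * (b - a) + d * C3 * CA * (1/2)^(i / (16 * d)))) := by
          rw [Real.exp_sum]
      _ ≤ Real.exp (∑ i ∈ Finset.range l, (d * C3 * (b - a) + d * C3 * CA * (1/2)^(i / (16 * d)))) := by
          rw [Real.exp_le_exp]
          refine Finset.sum_le_sum_of_subset_of_nonneg (fun i hi => ?_) (fun i _ _ => ?_)
          · rw [Finset.mem_Ico] at hi; exact Finset.mem_range.2 hi.2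
          · have : 0 < b - a := by linarith
            positivity
      _ ≤ K1 * Q := by
          rw [hK1, hQ, ← Real.exp_add, Real.exp_le_exp, Finset.sum_add_distrib, Finset.sum_const, ← Finset.mul_sum]
          have g := geo_sum (16 * d) l
          rw [if_neg (by omega)] at g
          push_cast at g
          rw [Finset.card_range, nsmul_eq_mul]
          have : d * C3 * CA * ∑ i ∈ Finset.range l, (1/2:ℝ)^(i / (16*d)) ≤ d * C3 * CA * (32 * d) :=
            mul_le_mul_of_nonneg_left (by linarith) (by positivity)
          linarith
  have hQ1 : 1 ≤ Q := by
    rw [hQ, Real.one_le_exp_iff]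
    have : 0 < b - a := by linarith
    positivity
  obtain ⟨g, hg1, hg2, hg3⟩ := hallB S (fun x j => (P x j : ℝ)) l n i1 (min_le_right _ _) hn0 hcard K hK0 tr
  have hh1 : (1:ℝ) ≤ n / 2^l := by
    rw [← hmT, one_le_div hmr]; exact_mod_cast hmn
  have eQ : (2 : ℝ) ^ (Real.logb 2 n - l * (1 - d * C3 / Real.log 2 * (b - a))) = n / 2^l * Q := by
    have hl2 : Real.log 2 ≠ 0 := (Real.log_pos (by norm_num)).ne'
    rw [show Real.logb 2 n - l * (1 - d * C3 / Real.log 2 * (b - a)) = Real.logb 2 n - l + (d * C3 * (b - a) * l) / Real.log 2 by ring,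
      Real.rpow_add (by norm_num), Real.rpow_sub (by norm_num), Real.rpow_logb (by norm_num) (by norm_num) hnr, Real.rpow_natCast]
    congr 1
    rw [hQ, Real.rpow_def_of_pos (by norm_num)]
    congr 1; field_simp
  refine ⟨g, ⟨?_, hg1, ?_⟩, ?_⟩
  · intro x hx j
    exact hg2 x hx j
  · have : S.image g = Fintype.piFinset fun _ : Fin d => Finset.Icc (1:ℤ) n := by
      refine Finset.eq_of_subset_of_card_le ?_ ?_
      · intro y hy
        obtain ⟨x, hx, rfl⟩ := Finset.mem_image.1 hy
        rw [Fintype.mem_piFinset]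
        intro j
        exact Finset.mem_Icc.2 (hg2 x hx j)
      · rw [Finset.card_image_of_injOn hg1, hcard, Fintype.card_piFinset]
        simp
    intro y hy
    have hy' : y ∈ S.image g := by
      rw [this, Fintype.mem_piFinset]
      intro j
      exact Finset.mem_Icc.2 (hy j)
    obtain ⟨x, hx, e⟩ := Finset.mem_image.1 hy'
    exact ⟨x, hx, e⟩
  · intro x hx y hy
    by_cases hxy : x = y
    · subst hxy; simp [zdist]
    have hd1 := one_le_dist hxy
    have hzd := dist_le_zdist x y
    rw [eQ]
    set h : ℝ := n / 2^l with hh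
    have hl1 : l1 (fun j => (P x j : ℝ)) (fun j => (P y j : ℝ)) ≤ d * (CA * dist x y) := by
      unfold l1
      calc _ ≤ ∑ _j : Fin d, CA * dist x y := Finset.sum_le_sum fun j _ => hP x y j
        _ = _ := by simp
    have h2i : (2:ℝ)^i1 ≤ 2^i0 := pow_le_pow_right₀ (by norm_num) (min_le_left _ _)
    have hu : 1 ≤ h * Q * dist x y := by
      have : 1 ≤ h * Q := one_le_mul_of_one_le_of_one_le hh1 hQ1
      exact one_le_mul_of_one_le_of_one_le this hd1
    have hcoord : ∀ j, |(g x j : ℝ) - g y j| ≤ (2 + 4 * K1 * d * 2^i0 + 2 * K1 * d * CA) * (h * Q * dist x y) := by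
      intro j
      refine (hg3 x hx y hy j).trans ?_
      have hKQ : K * (d * 2^i1) ≤ K1 * Q * (d * 2^i0) :=
        mul_le_mul hKle (mul_le_mul_of_nonneg_left h2i hd0.le) (by positivity) (by positivity)
      have hKQ2 : K1 * Q * (d * 2^i0) ≤ K1 * Q * (d * 2^i0) * dist x y :=
        le_mul_of_one_le_right (by positivity) hd1
      have hKL : K * l1 (fun j => (P x j : ℝ)) (fun j => (P y j : ℝ)) ≤ K1 * Q * (d * (CA * dist x y)) :=
        mul_le_mul hKle hl1 (l1_nonneg _ _) (by positivity)
      have : 2 * h * (2 * (K * (d * 2^i1)) + K * l1 (fun j => (P x j : ℝ)) (fun j => (P y j : ℝ))) ≤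
          2 * h * (2 * (K1 * Q * (d * 2^i0) * dist x y) + K1 * Q * (d * (CA * dist x y))) :=
        mul_le_mul_of_nonneg_left (by linarith) (by positivity)
      calc _ ≤ 2 * (h * Q * dist x y) + 2 * h * (2 * (K1 * Q * (d * 2^i0) * dist x y) + K1 * Q * (d * (CA * dist x y))) := by linarith
        _ = _ := by ring
    refine (zdist_le _ _ (by positivity) hcoord).trans ?_
    calc d * ((2 + 4 * K1 * d * 2^i0 + 2 * K1 * d * CA) * (h * Q * dist x y)) =
        d * (2 + 4 * K1 * d * 2^i0 + 2 * K1 * d * CA) * (h * Q) * dist x y := by ring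
      _ ≤ _ := mul_le_mul_of_nonneg_left hzd (by positivity)
end

section
/-- iterated averages over the coordinates in a list -/
noncomputable def Av {Q T : Type*} [DecidableEq Q] [Fintype T] : List Q → ((Q → T) → ℝ) → (Q → T) → ℝ
  | [], f, o => f o
  | q :: l, f, o => (∑ t, Av l f (Function.update o q t)) / Fintype.card T

set_option linter.unusedSectionVars false
section Av
variable {Q T : Type*} [DecidableEq Q] [Fintype T] [Nonempty T]

lemma cardT_pos : (0:ℝ) < Fintype.card T := by exact_mod_cast Fintype.card_pos

lemma Av_mono (l : List Q) (f g : (Q → T) → ℝ) (h : ∀ o, f o ≤ g o) (o : Q → T) : Av l f o ≤ Av l g o := by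
  induction l generalizing o with
  | nil => exact h o
  | cons q l ih =>
    unfold Av
    exact div_le_div_of_nonneg_right (Finset.sum_le_sum fun t _ => ih _) (Nat.cast_nonneg _)

lemma Av_const (l : List Q) (c : ℝ) (o : Q → T) : Av l (fun _ => c) o = c := by
  induction l generalizing o with
  | nil => rfl
  | cons q l ih =>
    unfold Av
    simp only [ih, Finset.sum_const, Finset.card_univ, nsmul_eq_mul]
    rw [mul_div_cancel_left₀ _ cardT_pos.ne']

lemma Av_sum {ι : Type*} (s : Finset ι) (l : List Q) (f : ι → (Q → T) → ℝ) (o : Q → T) :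
    Av l (fun o => ∑ i ∈ s, f i o) o = ∑ i ∈ s, Av l (f i) o := by
  induction l generalizing o with
  | nil => rfl
  | cons q l ih =>
    unfold Av
    simp only [ih]
    rw [Finset.sum_comm, Finset.sum_div]

lemma Av_indep (l : List Q) (f : (Q → T) → ℝ) (q : Q) (hf : ∀ o t, f (Function.update o q t) = f o) (o : Q → T) (t : T) :
    Av l f (Function.update o q t) = Av l f o := by
  induction l generalizing o with
  | nil => exact hf o t
  | cons q' l ih =>
    unfold Av
    congr 1
    refine Finset.sum_congr rfl fun t' _ => ?_
    by_cases h : q' = q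
    · subst h; rw [Function.update_idem]
    · rw [Function.update_comm (fun e => h e.symm), ih]

lemma Av_swap (l : List Q) (f : (Q → T) → ℝ) (q : Q) (hq : q ∉ l) (o : Q → T) :
    ∑ t, Av l f (Function.update o q t) = Av l (fun o => ∑ t, f (Function.update o q t)) o := by
  induction l generalizing o with
  | nil => rfl
  | cons q' l ih =>
    rw [List.mem_cons, not_or] at hq
    unfold Av
    rw [← Finset.sum_div, Finset.sum_comm]
    congr 1
    refine Finset.sum_congr rfl fun t' _ => ?_
    rw [← ih hq.2]
    refine Finset.sum_congr rfl fun t _ => ?_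
    rw [Function.update_comm hq.1]

lemma Av_core_le (l : List Q) (hl : l.Nodup) (f : (Q → T) → ℝ) (q : Q) (hq : q ∈ l) (c : ℝ)
    (h : ∀ o, ∑ t, f (Function.update o q t) ≤ c * Fintype.card T) (o : Q → T) : Av l f o ≤ c := by
  induction l generalizing o with
  | nil => simp at hq
  | cons q' l ih =>
    rw [List.nodup_cons] at hl
    unfold Av
    rw [div_le_iff₀ cardT_pos]
    by_cases e : q = q'
    · subst e
      rw [Av_swap l f q hl.1]
      exact (Av_mono l _ _ h o).trans (Av_const l _ o).le
    · have hq' : q ∈ l := by simpa [e] using hq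
      calc _ ≤ ∑ t : T, c := Finset.sum_le_sum fun t _ => ih hl.2 hq' _
        _ = _ := by simp [mul_comm]

lemma Av_le_core (l : List Q) (hl : l.Nodup) (f : (Q → T) → ℝ) (q : Q) (hq : q ∈ l) (c : ℝ)
    (h : ∀ o, c * Fintype.card T ≤ ∑ t, f (Function.update o q t)) (o : Q → T) : c ≤ Av l f o := by
  induction l generalizing o with
  | nil => simp at hq
  | cons q' l ih =>
    rw [List.nodup_cons] at hl
    unfold Av
    rw [le_div_iff₀ cardT_pos]
    by_cases e : q = q'
    · subst e
      rw [Av_swap l f q hl.1]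
      exact (Av_const l _ o).ge.trans (Av_mono l _ _ h o)
    · have hq' : q ∈ l := by simpa [e] using hq
      calc _ = ∑ t : T, c := by simp [mul_comm]
        _ ≤ _ := Finset.sum_le_sum fun t _ => ih hl.2 hq' _

end Av

section round
open Classical
variable {X Q T K Γ : Type*} [Fintype T] [Nonempty T]

/-- number of points with a given value -/
noncomputable def Fc (S : Finset X) (val : X → (Q → T) → K) (k : K) (o : Q → T) : ℝ :=
  ∑ x ∈ S, if val x o = k then (1:ℝ) else 0

/-- number of points depending on the patch -/
noncomputable def muq (S : Finset X) (supp : X → Finset Q) (q : Q) : ℕ := (S.filter fun x => q ∈ supp x).card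

lemma round_step (S : Finset X) (supp : X → Finset Q) (val : X → (Q → T) → K)
    (hval : ∀ x q, q ∉ supp x → ∀ o t, val x (Function.update o q t) = val x o)
    (Kf : Finset K) (q : Q) (l : List Q) (o : Q → T) (e : K → ℝ) :
    ∃ t, ∑ k ∈ Kf, (e k + (Av l (Fc S val k) (Function.update o q t) - Av (q :: l) (Fc S val k) o))^2 ≤
        ∑ k ∈ Kf, (e k)^2 + 2 * (muq S supp q)^2 ∧
      ∀ k, (∀ x ∈ S, q ∈ supp x → ∀ o, val x o ≠ k) →
        Av l (Fc S val k) (Function.update o q t) - Av (q :: l) (Fc S val k) o = 0 := by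
  set D : T → K → ℝ := fun t k => Av l (Fc S val k) (Function.update o q t) - Av (q :: l) (Fc S val k) o with hD
  set V : X → K → (Q → T) → ℝ := fun x k o => if val x o = k then (1:ℝ) else 0 with hV
  have hV0 : ∀ x k o, 0 ≤ V x k o := fun x k o => by simp only [hV]; split_ifs <;> norm_num
  have hV1 : ∀ x k o, V x k o ≤ 1 := fun x k o => by simp only [hV]; split_ifs <;> norm_num
  have hDs : ∀ t k, D t k = ∑ x ∈ S.filter (fun x => q ∈ supp x), (Av l (V x k) (Function.update o q t) - Av (q :: l) (V x k) o) := by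
    intro t k
    have e1 : ∀ l' o', Av l' (Fc S val k) o' = ∑ x ∈ S, Av l' (V x k) o' := fun l' o' => Av_sum S l' (fun x => V x k) o'
    simp only [hD]
    rw [e1, e1, ← Finset.sum_sub_distrib, Finset.sum_filter]
    refine Finset.sum_congr rfl fun x _ => ?_
    split_ifs with h
    · rfl
    · have hi : ∀ o t, V x k (Function.update o q t) = V x k o := fun o t => by simp only [hV, hval x q h]
      have : Av (q :: l) (V x k) o = Av l (V x k) o := by
        conv_lhs => unfold Av
        simp only [Av_indep l (V x k) q hi]
        simp [mul_div_cancel_left₀ _ (cardT_pos (T := T)).ne']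
      rw [Av_indep l (V x k) q hi, this, sub_self]
  have hA0 : ∀ l' x k o, 0 ≤ Av l' (V x k) o := fun l' x k o => (Av_const l' 0 o).ge.trans (Av_mono l' _ _ (hV0 x k) o)
  have hA1 : ∀ l' x k o, Av l' (V x k) o ≤ 1 := fun l' x k o => (Av_mono l' _ _ (hV1 x k) o).trans (Av_const l' 1 o).le
  have hAs : ∀ l' x o, ∑ k ∈ Kf, Av l' (V x k) o ≤ 1 := by
    intro l' x o
    rw [← Av_sum]
    refine (Av_mono l' _ (fun _ => 1) (fun o' => ?_) o).trans (Av_const l' 1 o).le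
    simp only [hV, Finset.sum_ite_eq]
    split_ifs <;> norm_num
  set μ : ℝ := (muq S supp q : ℝ) with hμ
  have hμ' : μ = ∑ x ∈ S.filter (fun x => q ∈ supp x), (1:ℝ) := by simp [hμ, muq]
  have hDi : ∀ t k, |D t k| ≤ μ := by
    intro t k
    rw [hDs, hμ']
    refine (Finset.abs_sum_le_sum_abs _ _).trans (Finset.sum_le_sum fun x _ => ?_)
    rw [abs_le]
    constructor <;> linarith [hA0 l x k (Function.update o q t), hA1 l x k (Function.update o q t), hA0 (q::l) x k o, hA1 (q::l) x k o]
  have hD1 : ∀ t, ∑ k ∈ Kf, |D t k| ≤ 2 * μ := by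
    intro t
    calc ∑ k ∈ Kf, |D t k| ≤ ∑ k ∈ Kf, ∑ x ∈ S.filter (fun x => q ∈ supp x), (Av l (V x k) (Function.update o q t) + Av (q :: l) (V x k) o) := by
          refine Finset.sum_le_sum fun k _ => ?_
          rw [hDs]
          refine (Finset.abs_sum_le_sum_abs _ _).trans (Finset.sum_le_sum fun x _ => ?_)
          rw [abs_le]
          constructor <;> linarith [hA0 l x k (Function.update o q t), hA0 (q::l) x k o]
      _ = ∑ x ∈ S.filter (fun x => q ∈ supp x), (∑ k ∈ Kf, Av l (V x k) (Function.update o q t) + ∑ k ∈ Kf, Av (q :: l) (V x k) o) := by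
          rw [Finset.sum_comm]
          exact Finset.sum_congr rfl fun x _ => Finset.sum_add_distrib
      _ ≤ ∑ x ∈ S.filter (fun x => q ∈ supp x), (2:ℝ) := Finset.sum_le_sum fun x _ => by
          linarith [hAs l x (Function.update o q t), hAs (q :: l) x o]
      _ = 2 * μ := by rw [hμ', Finset.mul_sum]; simp
  have hD2 : ∀ t, ∑ k ∈ Kf, (D t k)^2 ≤ 2 * μ^2 := by
    intro t
    have hμ0 : 0 ≤ μ := by rw [hμ]; positivity
    calc ∑ k ∈ Kf, (D t k)^2 ≤ ∑ k ∈ Kf, μ * |D t k| := Finset.sum_le_sum fun k _ => by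
          rw [← sq_abs, sq]; exact mul_le_mul_of_nonneg_right (hDi t k) (abs_nonneg _)
      _ = μ * ∑ k ∈ Kf, |D t k| := by rw [Finset.mul_sum]
      _ ≤ μ * (2 * μ) := mul_le_mul_of_nonneg_left (hD1 t) hμ0
      _ = _ := by ring
  have hDz : ∀ k, ∑ t, D t k = 0 := by
    intro k
    simp only [hD]
    rw [Finset.sum_sub_distrib]
    conv_lhs => arg 2; unfold Av
    simp only [Finset.sum_const, Finset.card_univ, nsmul_eq_mul]
    rw [mul_div_cancel₀ _ (cardT_pos (T := T)).ne', sub_self]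
  have key : ∑ t : T, ∑ k ∈ Kf, (e k + D t k)^2 ≤ ∑ t : T, (∑ k ∈ Kf, (e k)^2 + 2 * μ^2) := by
    have : ∑ t : T, ∑ k ∈ Kf, (e k + D t k)^2 = ∑ t : T, (∑ k ∈ Kf, (e k)^2 + ∑ k ∈ Kf, (D t k)^2) := by
      have h0 : ∑ t : T, ∑ k ∈ Kf, 2 * e k * D t k = 0 := by
        rw [Finset.sum_comm]
        refine Finset.sum_eq_zero fun k _ => ?_
        rw [← Finset.mul_sum, hDz, mul_zero]
      rw [← sub_eq_zero, ← Finset.sum_sub_distrib, ← h0]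
      refine Finset.sum_congr rfl fun t _ => ?_
      rw [← Finset.sum_add_distrib, ← Finset.sum_sub_distrib]
      exact Finset.sum_congr rfl fun k _ => by ring
    rw [this]
    exact Finset.sum_le_sum fun t _ => by linarith [hD2 t]
  obtain ⟨t, -, ht⟩ := Finset.exists_le_of_sum_le Finset.univ_nonempty key
  refine ⟨t, ht, fun k hk => ?_⟩
  have := hDs t k
  simp only [hD] at this
  rw [this]
  refine Finset.sum_eq_zero fun x hx => ?_
  rw [Finset.mem_filter] at hx
  have : V x k = fun _ => 0 := by
    funext o'
    simp only [hV, if_neg (hk x hx.1 hx.2 o')]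
  rw [this, Av_const, Av_const, sub_self]

lemma round_list (S : Finset X) (supp : X → Finset Q) (val : X → (Q → T) → K)
    (hval : ∀ x q, q ∉ supp x → ∀ o t, val x (Function.update o q t) = val x o)
    (Kf : Finset K) (lab : Q → Γ) (G : Finset Γ) (l : List Q) (hG : ∀ q ∈ l, lab q ∈ G) (o : Q → T) (e0 : Γ → K → ℝ) :
    ∃ (o' : Q → T) (e : Γ → K → ℝ), (∀ k, Fc S val k o' - Av l (Fc S val k) o = ∑ g ∈ G, (e g k - e0 g k)) ∧
      (∀ g, ∑ k ∈ Kf, (e g k)^2 ≤ ∑ k ∈ Kf, (e0 g k)^2 + (l.map fun q => if lab q = g then 2 * (muq S supp q : ℝ)^2 else 0).sum) ∧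
      (∀ g k, (∀ q ∈ l, lab q = g → ∀ x ∈ S, q ∈ supp x → ∀ o, val x o ≠ k) → e g k = e0 g k) := by
  induction l generalizing o e0 with
  | nil => exact ⟨o, e0, fun k => by simp [Av], fun g => by simp, fun g k _ => rfl⟩
  | cons q l ih =>
    obtain ⟨t, ht1, ht2⟩ := round_step S supp val hval Kf q l o (e0 (lab q))
    set D : K → ℝ := fun k => Av l (Fc S val k) (Function.update o q t) - Av (q :: l) (Fc S val k) o with hD
    obtain ⟨o', e, h1, h2, h3⟩ := ih (fun q' hq' => hG q' (List.mem_cons_of_mem _ hq')) (Function.update o q t)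
      (fun g k => if g = lab q then e0 g k + D k else e0 g k)
    refine ⟨o', e, fun k => ?_, fun g => ?_, fun g k hgk => ?_⟩
    · have : ∑ g ∈ G, (e g k - e0 g k) = ∑ g ∈ G, (e g k - if g = lab q then e0 g k + D k else e0 g k) + D k := by
        have hs : D k = ∑ g ∈ G, if g = lab q then D k else 0 := by
          rw [Finset.sum_ite_eq', if_pos (hG q List.mem_cons_self)]
        rw [← sub_eq_iff_eq_add', ← Finset.sum_sub_distrib] 
        refine Eq.trans ?_ hs.symm
        refine Finset.sum_congr rfl fun g _ => ?_
        split_ifs <;> ring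
      rw [this, ← h1 k, hD]
      ring
    · refine (h2 g).trans ?_
      rw [List.map_cons, List.sum_cons]
      by_cases hg : g = lab q
      · subst hg
        simp only [if_true]
        linarith
      · rw [if_neg (fun h => hg h.symm)]
        simp only [if_neg hg]
        linarith
    · rw [h3 g k (fun q' hq' => hgk q' (List.mem_cons_of_mem _ hq'))]
      split_ifs with hg
      · rw [show D k = 0 from ht2 k (hgk q List.mem_cons_self hg.symm), add_zero]
      · rfl

theorem rounding (S : Finset X) (supp : X → Finset Q) (val : X → (Q → T) → K)
    (hval : ∀ x q, q ∉ supp x → ∀ o t, val x (Function.update o q t) = val x o)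
    (Kf : Finset K) (lab : Q → Γ) (core : X → Q) (hcore : ∀ x, core x ∈ supp x)
    (lo hi : X → K → ℝ)
    (hlo : ∀ x ∈ S, ∀ k ∈ Kf, ∀ o, lo x k * Fintype.card T ≤ ∑ t, if val x (Function.update o (core x) t) = k then (1:ℝ) else 0)
    (hhi : ∀ x ∈ S, ∀ k ∈ Kf, ∀ o, (∑ t, if val x (Function.update o (core x) t) = k then (1:ℝ) else 0) ≤ hi x k * Fintype.card T)
    (μ Bs NB : ℝ) (s3 : ℕ) (hs3 : ∀ x, (supp x).card ≤ s3)
    (hμ0 : 0 ≤ μ)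
    (hμ : ∀ q, (muq S supp q : ℝ) ≤ μ)
    (hB : ∀ g, ((S.filter fun x => ∃ q ∈ supp x, lab q = g).card : ℝ) ≤ Bs)
    (hN : ∀ k ∈ Kf, ∃ G : Finset Γ, (G.card : ℝ) ≤ NB ∧ ∀ q, ∀ x ∈ S, q ∈ supp x → ∀ o, val x o = k → lab q ∈ G) :
    ∃ o : Q → T, ∀ k ∈ Kf, ∑ x ∈ S, lo x k - NB * Real.sqrt (2 * μ * (s3 * Bs)) ≤ Fc S val k o ∧
      Fc S val k o ≤ ∑ x ∈ S, hi x k + NB * Real.sqrt (2 * μ * (s3 * Bs)) := by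
  set Qs := S.biUnion supp with hQs
  set l := Qs.toList with hl
  set o0 : Q → T := fun _ => Classical.arbitrary T with ho0
  obtain ⟨o, e, h1, h2, h3⟩ := round_list S supp val hval Kf lab (Qs.image lab) l
    (fun q hq => Finset.mem_image_of_mem _ (by simpa [hl] using hq)) o0 (fun _ _ => 0)
  have hsum : ∀ g, ∑ k ∈ Kf, (e g k)^2 ≤ 2 * μ * (s3 * Bs) := by
    intro g
    refine (h2 g).trans ?_
    have e1 : (l.map fun q => if lab q = g then 2 * (muq S supp q : ℝ)^2 else 0).sum = ∑ q ∈ Qs, if lab q = g then 2 * (muq S supp q : ℝ)^2 else 0 := by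
      rw [hl, Finset.sum_map_toList]
    rw [e1]
    simp only [ne_eq, OfNat.ofNat_ne_zero, not_false_eq_true, zero_pow, Finset.sum_const_zero, zero_add]
    calc (∑ q ∈ Qs, if lab q = g then 2 * (muq S supp q : ℝ)^2 else 0)
        ≤ ∑ q ∈ Qs, 2 * μ * (if lab q = g then (muq S supp q : ℝ) else 0) := by
          refine Finset.sum_le_sum fun q _ => ?_
          split_ifs
          · nlinarith [hμ q, (Nat.cast_nonneg (muq S supp q) : (0:ℝ) ≤ _)]
          · simp
      _ = 2 * μ * ∑ q ∈ Qs, (if lab q = g then (muq S supp q : ℝ) else 0) := by rw [Finset.mul_sum]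
      _ ≤ 2 * μ * (s3 * Bs) := by
          refine mul_le_mul_of_nonneg_left ?_ (by positivity)
          calc (∑ q ∈ Qs, (if lab q = g then (muq S supp q : ℝ) else 0))
              = ∑ q ∈ Qs, ∑ x ∈ S, if lab q = g ∧ q ∈ supp x then (1:ℝ) else 0 := by
                refine Finset.sum_congr rfl fun q _ => ?_
                split_ifs with h
                · simp [muq, h]
                · simp [h]
            _ = ∑ x ∈ S, ∑ q ∈ Qs, if lab q = g ∧ q ∈ supp x then (1:ℝ) else 0 := Finset.sum_comm
            _ ≤ ∑ x ∈ S, if (∃ q ∈ supp x, lab q = g) then (s3:ℝ) else 0 := by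
                refine Finset.sum_le_sum fun x _ => ?_
                split_ifs with h
                · rw [← Finset.sum_filter, Finset.sum_const, nsmul_eq_mul, mul_one]
                  refine le_trans ?_ (Nat.cast_le.2 (hs3 x))
                  refine Nat.cast_le.2 (Finset.card_le_card fun q hq => ?_)
                  rw [Finset.mem_filter] at hq
                  exact hq.2.2
                · refine le_of_eq (Finset.sum_eq_zero fun q _ => ?_)
                  rw [if_neg]
                  rintro ⟨a, b⟩
                  exact h ⟨q, b, a⟩
            _ = s3 * (S.filter fun x => ∃ q ∈ supp x, lab q = g).card := by
                rw [← Finset.sum_filter, Finset.sum_const, nsmul_eq_mul, mul_comm]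
            _ ≤ s3 * Bs := mul_le_mul_of_nonneg_left (hB g) (Nat.cast_nonneg _)
  have hent : ∀ g, ∀ k ∈ Kf, |e g k| ≤ Real.sqrt (2 * μ * (s3 * Bs)) := by
    intro g k hk
    rw [← Real.sqrt_sq_eq_abs]
    refine Real.sqrt_le_sqrt ((Finset.single_le_sum (f := fun k => (e g k)^2) (fun _ _ => sq_nonneg _) hk).trans (hsum g))
  have herr : ∀ k ∈ Kf, |Fc S val k o - Av l (Fc S val k) o0| ≤ NB * Real.sqrt (2 * μ * (s3 * Bs)) := by
    intro k hk
    obtain ⟨G, hG1, hG2⟩ := hN k hk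
    rw [h1 k]
    calc |∑ g ∈ Qs.image lab, (e g k - 0)| ≤ ∑ g ∈ Qs.image lab, |e g k| := by
          simp only [sub_zero]; exact Finset.abs_sum_le_sum_abs _ _
      _ ≤ ∑ g ∈ Qs.image lab, if g ∈ G then Real.sqrt (2 * μ * (s3 * Bs)) else 0 := by
          refine Finset.sum_le_sum fun g _ => ?_
          split_ifs with h
          · exact hent g k hk
          · rw [h3 g k, abs_zero]
            rintro q _ rfl x hx hqx o' he
            exact h (hG2 q x hx hqx o' he)
      _ ≤ ∑ g ∈ G, Real.sqrt (2 * μ * (s3 * Bs)) := by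
          rw [← Finset.sum_filter]
          refine Finset.sum_le_sum_of_subset_of_nonneg (fun g hg => (Finset.mem_filter.1 hg).2) (fun _ _ _ => Real.sqrt_nonneg _)
      _ = G.card * Real.sqrt (2 * μ * (s3 * Bs)) := by simp
      _ ≤ _ := mul_le_mul_of_nonneg_right hG1 (Real.sqrt_nonneg _)
  have hcl : ∀ x ∈ S, core x ∈ l := fun x hx => by
    rw [hl, Finset.mem_toList, hQs, Finset.mem_biUnion]
    exact ⟨x, hx, hcore x⟩
  refine ⟨o, fun k hk => ?_⟩
  have hk' := abs_le.1 (herr k hk)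
  have eA : Av l (Fc S val k) o0 = ∑ x ∈ S, Av l (fun o => if val x o = k then (1:ℝ) else 0) o0 :=
    Av_sum S l (fun x o => if val x o = k then (1:ℝ) else 0) o0
  have hA1 : ∑ x ∈ S, lo x k ≤ Av l (Fc S val k) o0 := by
    rw [eA]
    exact Finset.sum_le_sum fun x hx => Av_le_core l Qs.nodup_toList _ (core x) (hcl x hx) _ (hlo x hx k hk) o0
  have hA2 : Av l (Fc S val k) o0 ≤ ∑ x ∈ S, hi x k := by
    rw [eA]
    exact Finset.sum_le_sum fun x hx => Av_core_le l Qs.nodup_toList _ (core x) (hcl x hx) _ (hhi x hx k hk) o0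
  constructor <;> linarith
end round
end

section
lemma sum_range_periodic (N : ℕ) (G : ℤ → ℝ) (hG : ∀ i, G (i + N) = G i) (r : ℤ) :
    ∑ t ∈ Finset.range N, G (t + r) = ∑ t ∈ Finset.range N, G t := by
  have step : ∀ r : ℤ, ∑ t ∈ Finset.range N, G (t + (r + 1)) = ∑ t ∈ Finset.range N, G (t + r) := by
    intro r
    have h1 := Finset.sum_range_succ (fun t : ℕ => G (t + r)) N
    have h2 := Finset.sum_range_succ' (fun t : ℕ => G (t + r)) N
    have h3 : G (N + r) = G r := by rw [add_comm, hG]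
    have h4 : ∑ t ∈ Finset.range N, G (((t + 1 : ℕ) : ℤ) + r) = ∑ t ∈ Finset.range N, G (t + (r + 1)) :=
      Finset.sum_congr rfl fun t _ => by congr 1; push_cast; ring
    rw [h1, h4] at h2
    simp only [Nat.cast_zero, zero_add] at h2
    rw [h3] at h2
    linarith
  induction r using Int.induction_on with
  | zero => simp
  | succ i ih => rw [step, ih]
  | pred i ih => rw [← ih, ← step]; simp

/-- triangle wave with period `2L` and values in `[0,L]` -/
noncomputable def tri (L : ℕ) (w : ℝ) : ℝ := 2 * L * |w / (2 * L) - round (w / (2 * L))|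

lemma tri_nonneg (L : ℕ) (w : ℝ) : 0 ≤ tri L w := by unfold tri; positivity

lemma tri_le (L : ℕ) (w : ℝ) : tri L w ≤ L := by
  unfold tri
  have := abs_sub_round (w / (2 * L))
  have h0 : (0:ℝ) ≤ L := Nat.cast_nonneg _
  nlinarith

lemma tri_lip (L : ℕ) (v w : ℝ) : |tri L v - tri L w| ≤ |v - w| := by
  rcases Nat.eq_zero_or_pos L with rfl | hL
  · simp [tri]
  have hL' : (0:ℝ) < L := by exact_mod_cast hL
  have key : ∀ v w : ℝ, tri L v ≤ tri L w + |v - w| := by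
    intro v w
    unfold tri
    have h1 := round_le (v / (2 * L)) (round (w / (2 * L)))
    have h2 : |v / (2 * L) - round (w / (2 * L))| ≤ |v - w| / (2 * L) + |w / (2 * L) - round (w / (2 * L))| := by
      have : v / (2 * L) - round (w / (2 * L)) = (v - w) / (2 * L) + (w / (2 * L) - round (w / (2 * L))) := by ring
      rw [this]
      refine (abs_add_le _ _).trans ?_
      rw [abs_div, abs_of_pos (by positivity : (0:ℝ) < 2 * L)]
    have h3 : 2 * L * (|v - w| / (2 * L)) = |v - w| := by field_simp
    have := mul_le_mul_of_nonneg_left (h1.trans h2) (by positivity : (0:ℝ) ≤ 2 * L)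
    rw [mul_add, h3] at this
    linarith
  rw [abs_le]
  have h1 := key v w
  have h2 := key w v
  rw [abs_sub_comm] at h2
  constructor <;> linarith

lemma tri_add (L : ℕ) (w : ℝ) (z : ℤ) : tri L (w + z * (2 * L)) = tri L w := by
  rcases Nat.eq_zero_or_pos L with rfl | hL
  · simp [tri]
  have hL' : (0:ℝ) < L := by exact_mod_cast hL
  unfold tri
  have : (w + z * (2 * L)) / (2 * L) = w / (2 * L) + z := by field_simp
  rw [this, round_add_intCast]
  push_cast
  congr 2; ring

lemma tri_low (L : ℕ) (hL : 0 < L) (v : ℝ) (h0 : 0 ≤ v) (h1 : v ≤ L) : tri L v = v := by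
  have hL' : (0:ℝ) < L := by exact_mod_cast hL
  have hf : Int.fract (v / (2 * L)) = v / (2 * L) := by
    rw [Int.fract_eq_self]
    exact ⟨by positivity, by rw [div_lt_one (by positivity)]; linarith⟩
  unfold tri
  rw [abs_sub_round_eq_min, hf, min_eq_left]
  · field_simp
  · have : v / (2 * L) ≤ 1 / 2 := by rw [div_le_div_iff₀ (by positivity) (by norm_num)]; linarith
    linarith

lemma tri_high (L : ℕ) (hL : 0 < L) (v : ℝ) (h0 : L ≤ v) (h1 : v < 2 * L) : tri L v = 2 * L - v := by
  have hL' : (0:ℝ) < L := by exact_mod_cast hL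
  have hf : Int.fract (v / (2 * L)) = v / (2 * L) := by
    rw [Int.fract_eq_self]
    exact ⟨by apply div_nonneg <;> linarith, by rw [div_lt_one (by positivity)]; linarith⟩
  unfold tri
  rw [abs_sub_round_eq_min, hf, min_eq_right]
  · field_simp
  · have : 1 / 2 ≤ v / (2 * L) := by rw [div_le_div_iff₀ (by norm_num) (by positivity)]; linarith
    linarith

lemma tri_sum (L : ℕ) (hL : 0 < L) (r : ℝ) : ∃ f : ℝ, 0 ≤ f ∧ f < 1 ∧ ∀ φ : ℝ → ℝ,
    ∑ t : Fin (2 * L), φ (tri L ((t : ℕ) + r)) = ∑ i ∈ Finset.range L, φ (f + i) + ∑ i ∈ Finset.range L, φ (1 - f + i) := by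
  have hL' : (0:ℝ) < L := by exact_mod_cast hL
  refine ⟨Int.fract r, Int.fract_nonneg r, Int.fract_lt_one r, fun φ => ?_⟩
  have f0 := Int.fract_nonneg r
  have f1 := Int.fract_lt_one r
  set f := Int.fract r with hf
  have hr : r = ⌊r⌋ + f := (Int.floor_add_fract r).symm
  rw [Fin.sum_univ_eq_sum_range (fun t => φ (tri L (t + r))) (2 * L)]
  have e := sum_range_periodic (2 * L) (fun i : ℤ => φ (tri L (i + f))) (fun i => by
    have := tri_add L (i + f) 1
    congr 1
    rw [← this]; congr 1; push_cast; ring) ⌊r⌋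
  have e1 : ∑ t ∈ Finset.range (2 * L), φ (tri L (t + r)) = ∑ t ∈ Finset.range (2 * L), φ (tri L (((t:ℤ) + ⌊r⌋ : ℤ) + f)) := by
    refine Finset.sum_congr rfl fun t _ => ?_
    congr 2
    conv_lhs => rw [hr]
    push_cast; ring
  rw [e1, e, two_mul, Finset.sum_range_add]
  congr 1
  · refine Finset.sum_congr rfl fun i hi => ?_
    have : (i:ℝ) + 1 ≤ L := by exact_mod_cast Finset.mem_range.1 hi
    have hi0 : (0:ℝ) ≤ i := Nat.cast_nonneg _
    rw [Int.cast_natCast, tri_low L hL _ (by linarith) (by linarith), add_comm]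
  · rw [← Finset.sum_range_reflect]
    refine Finset.sum_congr rfl fun i hi => ?_
    have hi' : i + 1 ≤ L := Finset.mem_range.1 hi
    have : (i:ℝ) + 1 ≤ L := by exact_mod_cast Finset.mem_range.1 hi
    have hi0 : (0:ℝ) ≤ i := Nat.cast_nonneg _
    have ec : ((L + (L - 1 - i) : ℕ) : ℝ) = 2 * L - 1 - i := by
      have : L + (L - 1 - i) + 1 + i = 2 * L := by omega
      have := congrArg (Nat.cast : ℕ → ℝ) this
      push_cast at this ⊢
      linarith
    rw [Int.cast_natCast, ec, tri_high L hL _ (by linarith) (by linarith)]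
    congr 1; ring

/-- one dimensional count -/
noncomputable def c1 (L m τ : ℕ) (v : ℤ) : ℝ := ∑ i ∈ Finset.range L, if (v + i) % (m:ℤ) < τ then (1:ℝ) else 0

lemma c1_m (m τ : ℕ) (hτ : τ ≤ m) (v : ℤ) : c1 m m τ v = τ := by
  unfold c1
  have e := sum_range_periodic m (fun i : ℤ => if i % (m:ℤ) < τ then (1:ℝ) else 0) (fun i => by simp) v
  have e1 : (∑ i ∈ Finset.range m, if (v + i) % (m:ℤ) < τ then (1:ℝ) else 0) =
      ∑ i ∈ Finset.range m, if ((i:ℤ) + v) % (m:ℤ) < τ then (1:ℝ) else 0 :=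
    Finset.sum_congr rfl fun i _ => by rw [add_comm]
  rw [e1, e]
  rw [← Finset.sum_filter, Finset.sum_const, nsmul_eq_mul, mul_one]
  congr 1
  have : (Finset.range m).filter (fun i : ℕ => (i:ℤ) % (m:ℤ) < τ) = Finset.range τ := by
    ext i
    simp only [Finset.mem_filter, Finset.mem_range]
    constructor
    · rintro ⟨h1, h2⟩
      rw [Int.emod_eq_of_lt (by omega) (by omega)] at h2
      omega
    · intro h
      refine ⟨by omega, ?_⟩
      rw [Int.emod_eq_of_lt (by omega) (by omega)]
      omega
  rw [this, Finset.card_range]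

lemma c1_nonneg (L m τ : ℕ) (v : ℤ) : 0 ≤ c1 L m τ v :=
  Finset.sum_nonneg fun i _ => by split_ifs <;> norm_num

lemma c1_le (L m τ : ℕ) (hL : L ≤ m) (hτ : τ ≤ m) (v : ℤ) : c1 L m τ v ≤ τ := by
  rw [← c1_m m τ hτ v]
  unfold c1
  exact Finset.sum_le_sum_of_subset_of_nonneg (Finset.range_mono hL) (fun i _ _ => by split_ifs <;> norm_num)

lemma c1_ge (L m τ : ℕ) (hm : 0 < m) (w : ℤ) (v : ℤ) (h0 : 0 ≤ m * w - v) (h1 : m * w - v + τ ≤ L) :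
    (τ:ℝ) ≤ c1 L m τ v := by
  unfold c1
  rw [← Finset.sum_filter, Finset.sum_const, nsmul_eq_mul, mul_one]
  obtain ⟨s, hs⟩ := Int.eq_ofNat_of_zero_le h0
  have : Finset.Ico s (s + τ) ⊆ (Finset.range L).filter (fun i : ℕ => (v + i) % (m:ℤ) < τ) := by
    intro i hi
    rw [Finset.mem_Ico] at hi
    rw [Finset.mem_filter, Finset.mem_range]
    refine ⟨by omega, ?_⟩
    have : v + i = (i - s : ℤ) + m * w := by omega
    rw [this, Int.add_mul_emod_self_left]
    have h2 : (0:ℤ) ≤ i - s := by omega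
    have : ((i:ℤ) - s) % (m:ℤ) ≤ i - s := by
      rcases lt_or_ge ((i:ℤ) - s) m with h | h
      · rw [Int.emod_eq_of_lt h2 h]
      · exact (Int.emod_lt_of_pos _ (by exact_mod_cast hm)).le.trans h
    omega
  have := Finset.card_le_card this
  rw [Nat.card_Ico] at this
  exact_mod_cast (by omega : τ ≤ _)

lemma emod_le_of_nonneg (r : ℤ) (m : ℕ) (hm : 0 < m) (h : 0 ≤ r) : r % (m:ℤ) ≤ r := by
  rcases lt_or_ge r m with h' | h'
  · rw [Int.emod_eq_of_lt h h']
  · exact (Int.emod_lt_of_pos _ (by exact_mod_cast hm)).le.trans h'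

lemma c1_pos (L m τ : ℕ) (hm : 0 < m) (v δ : ℤ) (hδ0 : 0 ≤ δ) (hδ1 : δ ≤ 1) (h : c1 L m τ (v + δ) ≠ 0) :
    (v + L) % (m:ℤ) < (L + τ : ℕ) := by
  unfold c1 at h
  obtain ⟨i, hi, hi2⟩ := Finset.exists_ne_zero_of_sum_ne_zero h
  rw [Finset.mem_range] at hi
  have hi3 : (v + δ + i) % (m:ℤ) < τ := by
    by_contra hc
    exact hi2 (if_neg hc)
  have h0 := Int.emod_nonneg (v + δ + i) (by omega : (m:ℤ) ≠ 0)
  have e := Int.emod_add_mul_ediv (v + δ + i) m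
  set r := (v + δ + i) % (m:ℤ)
  have : v + L = (r - i - δ + L) + m * ((v + δ + i) / m) := by linarith
  rw [this, Int.add_mul_emod_self_left]
  have := emod_le_of_nonneg (r - i - δ + L) m hm (by omega)
  push_cast
  omega

lemma c1_full (L m τ : ℕ) (hm : 0 < m) (hL : L ≤ m) (hτ : τ ≤ m) (h2 : 2 * τ ≤ L) (v δ : ℤ) (hδ0 : 0 ≤ δ) (hδ1 : δ ≤ 1)
    (h : (v - 2 * τ + L) % (m:ℤ) < (L - 2 * τ : ℕ)) : c1 L m τ (v + δ) = τ := by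
  refine le_antisymm (c1_le L m τ hL hτ _) ?_
  have h0 := Int.emod_nonneg (v - 2 * τ + L) (by omega : (m:ℤ) ≠ 0)
  have e := Int.emod_add_mul_ediv (v - 2 * τ + L) m
  set r := (v - 2 * τ + L) % (m:ℤ)
  push_cast [h2] at h
  refine c1_ge L m τ hm ((v - 2 * τ + L) / m) _ ?_ ?_
  · generalize (m:ℤ) * ((v - 2 * τ + L) / m) = u at *
    omega
  · generalize (m:ℤ) * ((v - 2 * τ + L) / m) = u at *
    omega

/-- the one dimensional average -/
noncomputable def tc (L m τ : ℕ) (p r : ℝ) (z : ℤ) : ℝ :=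
  ∑ t : Fin (2 * L), if (⌊p + tri L ((t : ℕ) + r)⌋ - z) % (m:ℤ) < τ then (1:ℝ) else 0

lemma tc_eq (L m τ : ℕ) (hL : 0 < L) (p r : ℝ) (z : ℤ) : ∃ δ1 δ2 : ℤ, 0 ≤ δ1 ∧ δ1 ≤ 1 ∧ 0 ≤ δ2 ∧ δ2 ≤ 1 ∧
    tc L m τ p r z = c1 L m τ (⌊p⌋ - z + δ1) + c1 L m τ (⌊p⌋ - z + δ2) := by
  obtain ⟨f, f0, f1, h⟩ := tri_sum L hL r
  refine ⟨⌊p + f⌋ - ⌊p⌋, ⌊p + (1 - f)⌋ - ⌊p⌋, ?_, ?_, ?_, ?_, ?_⟩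
  · linarith [Int.floor_le_floor (by linarith : p ≤ p + f)]
  · have := Int.floor_le_floor (by linarith : p + f ≤ p + 1)
    rw [Int.floor_add_one] at this; linarith
  · linarith [Int.floor_le_floor (by linarith : p ≤ p + (1 - f))]
  · have := Int.floor_le_floor (by linarith : p + (1 - f) ≤ p + 1)
    rw [Int.floor_add_one] at this; linarith
  · unfold tc
    rw [h (fun s => if (⌊p + s⌋ - z) % (m:ℤ) < τ then (1:ℝ) else 0)]
    unfold c1
    congr 1
    · refine Finset.sum_congr rfl fun i _ => ?_
      rw [← add_assoc, Int.floor_add_natCast]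
      congr 3; ring
    · refine Finset.sum_congr rfl fun i _ => ?_
      rw [← add_assoc, Int.floor_add_natCast]
      congr 3; ring

lemma tc_nonneg (L m τ : ℕ) (p r : ℝ) (z : ℤ) : 0 ≤ tc L m τ p r z :=
  Finset.sum_nonneg fun i _ => by split_ifs <;> norm_num

lemma tc_le (L m τ : ℕ) (hL : 0 < L) (hLm : L ≤ m) (hτ : τ ≤ m) (p r : ℝ) (z : ℤ) : tc L m τ p r z ≤ 2 * τ := by
  obtain ⟨δ1, δ2, -, -, -, -, e⟩ := tc_eq L m τ hL p r z
  rw [e]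
  linarith [c1_le L m τ hLm hτ (⌊p⌋ - z + δ1), c1_le L m τ hLm hτ (⌊p⌋ - z + δ2)]

lemma tc_top (m τ : ℕ) (hm : 0 < m) (hτ : τ ≤ m) (p r : ℝ) (z : ℤ) : tc m m τ p r z = 2 * τ := by
  obtain ⟨δ1, δ2, -, -, -, -, e⟩ := tc_eq m m τ hm p r z
  rw [e, c1_m m τ hτ, c1_m m τ hτ]; ring

lemma tc_pos (L m τ : ℕ) (hL : 0 < L) (hm : 0 < m) (p r : ℝ) (z : ℤ) (h : tc L m τ p r z ≠ 0) :
    (⌊p⌋ - (z - L)) % (m:ℤ) < (L + τ : ℕ) := by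
  obtain ⟨δ1, δ2, a1, a2, a3, a4, e⟩ := tc_eq L m τ hL p r z
  rw [show ⌊p⌋ - (z - L) = ⌊p⌋ - z + L by ring]
  by_contra hc
  apply h
  rw [e]
  have h1 : c1 L m τ (⌊p⌋ - z + δ1) = 0 := by
    by_contra h1; exact hc (c1_pos L m τ hm _ δ1 a1 a2 h1)
  have h2 : c1 L m τ (⌊p⌋ - z + δ2) = 0 := by
    by_contra h1; exact hc (c1_pos L m τ hm _ δ2 a3 a4 h1)
  rw [h1, h2, add_zero]

lemma tc_full (L m τ : ℕ) (hL : 0 < L) (hm : 0 < m) (hLm : L ≤ m) (h2 : 2 * τ ≤ L) (p r : ℝ) (z : ℤ)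
    (h : (⌊p⌋ - (z + 2 * τ - L)) % (m:ℤ) < (L - 2 * τ : ℕ)) : tc L m τ p r z = 2 * τ := by
  obtain ⟨δ1, δ2, a1, a2, a3, a4, e⟩ := tc_eq L m τ hL p r z
  rw [show ⌊p⌋ - (z + 2 * τ - L) = ⌊p⌋ - z - 2 * τ + L by ring] at h
  rw [e, c1_full L m τ hm hLm (by omega) h2 _ δ1 a1 a2 h, c1_full L m τ hm hLm (by omega) h2 _ δ2 a3 a4 h]
  ring
end

section
/-- lattice cube -/
def lcube {d : ℕ} (R : ℕ) (q : Fin d → ℤ) : Set (Fin d → ℤ) := {y | ∀ j, y j / (R:ℤ) = q j}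

/-- bump function of a patch -/
noncomputable def phi {d : ℕ} (R : ℕ) (q x : Fin d → ℤ) : ℝ := max 0 (1 - Metric.infDist x (lcube R q) / R)

/-- relevant patches -/
noncomputable def psupp {d : ℕ} (R : ℕ) (x : Fin d → ℤ) : Finset (Fin d → ℤ) :=
  Fintype.piFinset fun j => Finset.Icc (x j / (R:ℤ) - 1) (x j / (R:ℤ) + 1)

/-- core patch -/
def pcore {d : ℕ} (R : ℕ) (x : Fin d → ℤ) : Fin d → ℤ := fun j => x j / (R:ℤ)

lemma pcore_mem {d : ℕ} (R : ℕ) (x : Fin d → ℤ) : pcore R x ∈ psupp R x := by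
  unfold psupp pcore
  rw [Fintype.mem_piFinset]
  intro j
  rw [Finset.mem_Icc]
  constructor <;> omega

lemma psupp_card {d : ℕ} (R : ℕ) (x : Fin d → ℤ) : (psupp R x).card = 3^d := by
  unfold psupp
  rw [Fintype.card_piFinset]
  have : ∀ j : Fin d, (Finset.Icc (x j / (R:ℤ) - 1) (x j / (R:ℤ) + 1)).card = 3 := by
    intro j; rw [Int.card_Icc]; omega
  simp [this]

lemma phi_core {d : ℕ} (R : ℕ) (x : Fin d → ℤ) : phi R (pcore R x) x = 1 := by
  unfold phi
  rw [Metric.infDist_zero_of_mem (show x ∈ lcube R (pcore R x) from fun j => rfl)]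
  simp

lemma lcube_nonempty {d : ℕ} (R : ℕ) (hR : 0 < R) (q : Fin d → ℤ) : (lcube R q).Nonempty :=
  ⟨fun j => R * q j, fun j => Int.mul_ediv_cancel_left _ (by omega)⟩

lemma phi_lip {d : ℕ} (R : ℕ) (hR : 0 < R) (q x y : Fin d → ℤ) : |phi R q x - phi R q y| ≤ dist x y / R := by
  have hR' : (0:ℝ) < R := by exact_mod_cast hR
  unfold phi
  refine (abs_max_sub_max_le_max _ _ _ _).trans ?_
  rw [sub_self, abs_zero]
  refine max_le (by positivity) ?_
  rw [show (1 - Metric.infDist x (lcube R q) / R - (1 - Metric.infDist y (lcube R q) / R)) = -((Metric.infDist x (lcube R q) - Metric.infDist y (lcube R q)) / R) by ring,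
    abs_neg, abs_div, abs_of_pos hR']
  refine div_le_div_of_nonneg_right ?_ hR'.le
  rw [abs_le]
  have h1 := Metric.infDist_le_infDist_add_dist (s := lcube R q) (x := x) (y := y)
  have h2 := Metric.infDist_le_infDist_add_dist (s := lcube R q) (x := y) (y := x)
  rw [dist_comm y x] at h2
  constructor <;> linarith

lemma ediv_near (R : ℕ) (hR : 0 < R) (x y : ℤ) (h : |x - y| < R) : x / (R:ℤ) - 1 ≤ y / (R:ℤ) ∧ y / (R:ℤ) ≤ x / (R:ℤ) + 1 := by
  have hR' : (0:ℤ) < R := by exact_mod_cast hR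
  rw [abs_lt] at h
  have e1 := Int.emod_add_mul_ediv x R
  have e2 := Int.emod_add_mul_ediv y R
  have a1 := Int.emod_nonneg x hR'.ne'
  have a2 := Int.emod_lt_of_pos x hR'
  have b1 := Int.emod_nonneg y hR'.ne'
  have b2 := Int.emod_lt_of_pos y hR'
  constructor
  · by_contra hc
    have : y / (R:ℤ) + 2 ≤ x / (R:ℤ) := by omega
    nlinarith
  · by_contra hc
    have : x / (R:ℤ) + 2 ≤ y / (R:ℤ) := by omega
    nlinarith

lemma phi_zero {d : ℕ} (R : ℕ) (hR : 0 < R) (q x : Fin d → ℤ) (h : q ∉ psupp R x) : phi R q x = 0 := by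
  have hR' : (0:ℝ) < R := by exact_mod_cast hR
  unfold phi
  rw [max_eq_left]
  rw [sub_nonpos, one_le_div hR']
  by_contra hc
  push Not at hc
  obtain ⟨y, hy, hd⟩ := (Metric.infDist_lt_iff (lcube_nonempty R hR q)).1 hc
  apply h
  unfold psupp
  rw [Fintype.mem_piFinset]
  intro j
  have := (dist_le_pi_dist x y j).trans_lt hd
  rw [Int.dist_eq] at this
  have h2 : |x j - y j| < R := by exact_mod_cast this
  have := ediv_near R hR _ _ h2
  rw [hy j] at this
  exact Finset.mem_Icc.2 this

/-- the random field -/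
noncomputable def Wf {d : ℕ} (L R : ℕ) (o : (Fin d → ℤ) → Fin d → Fin (2 * L)) (x : Fin d → ℤ) (j : Fin d) : ℝ :=
  ∑ q ∈ psupp R x, phi R q x * ((o q j : ℕ) : ℝ)

lemma Wf_lip {d : ℕ} (L R : ℕ) (hR : 0 < R) (o : (Fin d → ℤ) → Fin d → Fin (2 * L)) (x y : Fin d → ℤ) (j : Fin d) :
    |Wf L R o x j - Wf L R o y j| ≤ 4 * 3^d * (L / R) * dist x y := by
  classical
  have hR' : (0:ℝ) < R := by exact_mod_cast hR
  set U := psupp R x ∪ psupp R y with hU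
  have e : ∀ z, psupp R z ⊆ U → Wf L R o z j = ∑ q ∈ U, phi R q z * ((o q j : ℕ) : ℝ) := by
    intro z hz
    unfold Wf
    refine Finset.sum_subset hz fun q _ hq => ?_
    rw [phi_zero R hR q z hq, zero_mul]
  rw [e x Finset.subset_union_left, e y Finset.subset_union_right, ← Finset.sum_sub_distrib]
  have hc : (U.card : ℝ) ≤ 2 * 3^d := by
    have := Finset.card_union_le (psupp R x) (psupp R y)
    rw [psupp_card, psupp_card] at this
    exact_mod_cast (this.trans (by omega) : U.card ≤ 2 * 3^d)
  calc |∑ q ∈ U, (phi R q x * ((o q j : ℕ) : ℝ) - phi R q y * ((o q j : ℕ) : ℝ))|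
      ≤ ∑ q ∈ U, |phi R q x * ((o q j : ℕ) : ℝ) - phi R q y * ((o q j : ℕ) : ℝ)| := Finset.abs_sum_le_sum_abs _ _
    _ ≤ ∑ _q ∈ U, dist x y / R * (2 * L) := by
        refine Finset.sum_le_sum fun q _ => ?_
        rw [← sub_mul, abs_mul]
        refine mul_le_mul (phi_lip R hR q x y) ?_ (abs_nonneg _) (by positivity)
        rw [abs_of_nonneg (Nat.cast_nonneg _)]
        exact_mod_cast (o q j).2.le
    _ = U.card * (dist x y / R * (2 * L)) := by simp
    _ ≤ 2 * 3^d * (dist x y / R * (2 * L)) := mul_le_mul_of_nonneg_right hc (by positivity)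
    _ = _ := by ring

lemma Wf_update {d : ℕ} (L R : ℕ) [DecidableEq (Fin d → ℤ)] (o : (Fin d → ℤ) → Fin d → Fin (2 * L)) (x : Fin d → ℤ) :
    ∃ r : Fin d → ℝ, ∀ t j, Wf L R (Function.update o (pcore R x) t) x j = ((t j : ℕ) : ℝ) + r j := by
  refine ⟨fun j => ∑ q ∈ (psupp R x).erase (pcore R x), phi R q x * ((o q j : ℕ) : ℝ), fun t j => ?_⟩
  unfold Wf
  rw [← Finset.add_sum_erase _ _ (pcore_mem R x)]
  rw [phi_core, one_mul, Function.update_self]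
  congr 1
  refine Finset.sum_congr rfl fun q hq => ?_
  rw [Function.update_of_ne (Finset.ne_of_mem_erase hq)]

lemma Wf_indep {d : ℕ} (L R : ℕ) [DecidableEq (Fin d → ℤ)] (o : (Fin d → ℤ) → Fin d → Fin (2 * L)) (x q : Fin d → ℤ)
    (hq : q ∉ psupp R x) (t : Fin d → Fin (2 * L)) (j : Fin d) : Wf L R (Function.update o q t) x j = Wf L R o x j := by
  unfold Wf
  refine Finset.sum_congr rfl fun q' hq' => ?_
  rw [Function.update_of_ne]
  rintro rfl
  exact hq hq'

/-- the integer cell position -/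
lemma cell_iff (m τ mτ : ℕ) (hτ : 0 < τ) (hm : m = τ * mτ) (hm0 : 0 < m) (v k : ℤ) (hk0 : 0 ≤ k) (hk1 : k < mτ) :
    (v % (m:ℤ)) / (τ:ℤ) = k ↔ (v - τ * k) % (m:ℤ) < τ := by
  have hτ' : (0:ℤ) < τ := by exact_mod_cast hτ
  have hm' : (0:ℤ) < m := by exact_mod_cast hm0
  have hmm : (m:ℤ) = τ * mτ := by exact_mod_cast hm
  rw [← Int.emod_sub_emod]
  have h0 := Int.emod_nonneg v hm'.ne'
  have h1 := Int.emod_lt_of_pos v hm'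
  generalize v % (m:ℤ) = r at *
  have h2 : (τ:ℤ) * k + τ ≤ m := by rw [hmm]; nlinarith
  have h3 : 0 ≤ (τ:ℤ) * k := by positivity
  rw [Int.ediv_eq_iff_of_pos hτ']
  constructor
  · rintro ⟨a, b⟩
    rw [Int.emod_eq_of_lt (by linarith) (by linarith)]
    linarith
  · intro h
    by_cases hc : 0 ≤ r - τ * k
    · rw [Int.emod_eq_of_lt hc (by linarith)] at h
      constructor <;> linarith
    · exfalso
      have : (r - τ * k) % (m:ℤ) = r - τ * k + m := by
        rw [← Int.add_emod_right, Int.emod_eq_of_lt (by linarith) (by linarith)]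
      linarith
end

section
/-- floor of a position function -/
noncomputable def flp {d : ℕ} {X : Type*} (p : X → Fin d → ℝ) : X → Fin d → ℤ := fun x j => ⌊p x j⌋

lemma tc_prod {d : ℕ} (L R m τ : ℕ) [DecidableEq (Fin d → ℤ)] (p : (Fin d → ℤ) → Fin d → ℝ) (x : Fin d → ℤ)
    (o : (Fin d → ℤ) → Fin d → Fin (2 * L)) (k : Fin d → ℤ) : ∃ r : Fin d → ℝ,
    (∑ t, if (∀ j, (⌊p x j + tri L (Wf L R (Function.update o (pcore R x) t) x j)⌋ - τ * k j) % (m:ℤ) < τ) then (1:ℝ) else 0) =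
      ∏ j, tc L m τ (p x j) (r j) (τ * k j) := by
  obtain ⟨r, hr⟩ := Wf_update L R o x
  refine ⟨r, ?_⟩
  unfold tc
  rw [Finset.prod_univ_sum, Fintype.piFinset_univ]
  refine Finset.sum_congr rfl fun t _ => ?_
  rw [Finset.prod_ite_zero]
  simp only [hr, Finset.mem_univ, true_imp_iff, Finset.prod_const_one]

open Classical in
theorem level {d : ℕ} (S : Finset (Fin d → ℤ)) (p : (Fin d → ℤ) → Fin d → ℝ) (m L τ R mL mτ C1 : ℕ)
    (hL : 0 < L) (hτ : 0 < τ) (hR : 0 < R) (hm0 : 0 < m) (hmL : m = L * mL) (hmτ : m = τ * mτ) (hτL : τ ≤ L)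
    (hvar : ∀ x q, q ∈ psupp R x → ∀ j, |p x j - p (fun j => R * q j) j| ≤ C1 * L)
    (μ Bs : ℝ) (hμ : ∀ z : Fin d → ℤ, ((S.filter fun x => ∀ j, z j ≤ x j ∧ x j < z j + 3 * R).card : ℝ) ≤ μ)
    (hB : ∀ z, (wc S m (flp p) z ((2 * C1 + 1) * L) : ℝ) ≤ Bs)
    (lo hi : ℝ)
    (hcase : (L = m ∧ lo = (τ / m)^d * S.card ∧ hi = (τ / m)^d * S.card) ∨
      (2 * τ ≤ L ∧ ∀ z, lo ≤ (τ / L)^d * wc S m (flp p) z (L - 2 * τ) ∧ (τ / L)^d * wc S m (flp p) z (L + τ) ≤ hi)) :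
    ∃ u : (Fin d → ℤ) → Fin d → ℝ, (∀ x j, 0 ≤ u x j ∧ u x j ≤ L) ∧
      (∀ x y j, |u x j - u y j| ≤ 4 * 3^d * (L / R) * dist x y) ∧
      ∀ k : Fin d → ℤ, lo - (2 * C1 + 7 : ℕ)^d * Real.sqrt (2 * μ * (3^d * Bs)) ≤ wc S m (flp fun x j => p x j + u x j) (fun j => τ * k j) τ ∧
        wc S m (flp fun x j => p x j + u x j) (fun j => τ * k j) τ ≤ hi + (2 * C1 + 7 : ℕ)^d * Real.sqrt (2 * μ * (3^d * Bs)) := by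
  have hLr : (0:ℝ) < L := by exact_mod_cast hL
  have hLz : (0:ℤ) < L := by exact_mod_cast hL
  have hτz : (0:ℤ) < τ := by exact_mod_cast hτ
  have hLm : L ≤ m := by rw [hmL]; exact Nat.le_mul_of_pos_right _ (Nat.pos_of_ne_zero (by rintro rfl; simp at hmL; omega))
  have hτm : τ ≤ m := hτL.trans hLm
  have hmLz : (m:ℤ) = L * mL := by exact_mod_cast hmL
  have hmτz : (m:ℤ) = τ * mτ := by exact_mod_cast hmτ
  have hmτ0 : 0 < mτ := Nat.pos_of_ne_zero (by rintro rfl; simp at hmτ; omega)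
  have hmL0 : 0 < mL := Nat.pos_of_ne_zero (by rintro rfl; simp at hmL; omega)
  have : NeZero (2 * L) := ⟨by omega⟩
  set val : (Fin d → ℤ) → ((Fin d → ℤ) → Fin d → Fin (2 * L)) → (Fin d → ℤ) :=
    fun x o j => (⌊p x j + tri L (Wf L R o x j)⌋ % (m:ℤ)) / (τ:ℤ) with hval
  set Kf : Finset (Fin d → ℤ) := Fintype.piFinset fun _ => Finset.Ico (0:ℤ) mτ with hKf
  set lab : (Fin d → ℤ) → (Fin d → ℤ) := fun q j => ⌊p (fun j => R * q j) j / L⌋ % (mL:ℤ) with hlab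
  have hvk : ∀ x o k, k ∈ Kf → (val x o = k ↔ ∀ j, (⌊p x j + tri L (Wf L R o x j)⌋ - τ * k j) % (m:ℤ) < τ) := by
    intro x o k hk
    rw [hKf, Fintype.mem_piFinset] at hk
    rw [funext_iff]
    refine forall_congr' fun j => ?_
    have := Finset.mem_Ico.1 (hk j)
    exact cell_iff m τ mτ hτ hmτ hm0 _ _ this.1 this.2
  have hcT : (Fintype.card (Fin d → Fin (2 * L)) : ℝ) = (2 * L)^d := by simp
  -- bounds for the averages
  obtain ⟨flo, fhi, hflo, hfhi, hslo, hshi⟩ : ∃ flo fhi : (Fin d → ℤ) → (Fin d → ℤ) → ℝ,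
      (∀ x k (r : Fin d → ℝ), flo x k * (2 * L)^d ≤ ∏ j, tc L m τ (p x j) (r j) (τ * k j)) ∧
      (∀ x k (r : Fin d → ℝ), ∏ j, tc L m τ (p x j) (r j) (τ * k j) ≤ fhi x k * (2 * L)^d) ∧
      (∀ k, lo ≤ ∑ x ∈ S, flo x k) ∧ (∀ k, ∑ x ∈ S, fhi x k ≤ hi) := by
    rcases hcase with ⟨h1, h2, h3⟩ | ⟨h2τ, hz⟩
    · subst h1
      have hp : ∀ (x k : Fin d → ℤ) (r : Fin d → ℝ), ∏ j, tc L L τ (p x j) (r j) (τ * k j) = (τ/L)^d * (2 * L)^d := by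
        intro x k r
        simp only [tc_top L τ hm0 hτm]
        rw [Finset.prod_const, Finset.card_univ, Fintype.card_fin, ← mul_pow]
        congr 1; field_simp
      refine ⟨fun _ _ => (τ/L)^d, fun _ _ => (τ/L)^d, fun x k r => (hp x k r).ge, fun x k r => (hp x k r).le, fun k => ?_, fun k => ?_⟩
      · rw [h2]; simp [mul_comm]
      · rw [h3]; simp [mul_comm]
    · have e2 : ((τ:ℝ)/L)^d * (2 * L)^d = (2 * τ)^d := by rw [← mul_pow]; congr 1; field_simp
      refine ⟨fun x k => if (∀ j, (⌊p x j⌋ - (τ * k j + 2 * τ - L)) % (m:ℤ) < (L - 2 * τ : ℕ)) then (τ/L)^d else 0,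
        fun x k => if (∀ j, (⌊p x j⌋ - (τ * k j - L)) % (m:ℤ) < (L + τ : ℕ)) then (τ/L)^d else 0, fun x k r => ?_, fun x k r => ?_, fun k => ?_, fun k => ?_⟩
      · beta_reduce
        split_ifs with h
        · rw [e2, Finset.prod_congr rfl fun j _ => tc_full L m τ hL hm0 hLm h2τ (p x j) (r j) (τ * k j) (h j)]
          simp
        · rw [zero_mul]; exact Finset.prod_nonneg fun j _ => tc_nonneg _ _ _ _ _ _
      · beta_reduce
        split_ifs with h
        · rw [e2]
          calc _ ≤ ∏ _j : Fin d, (2 * τ : ℝ) := Finset.prod_le_prod (fun j _ => tc_nonneg _ _ _ _ _ _) fun j _ => tc_le L m τ hL hLm hτm _ _ _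
            _ = _ := by simp
        · rw [zero_mul]
          push Not at h
          obtain ⟨j, hj⟩ := h
          refine le_of_eq (Finset.prod_eq_zero (Finset.mem_univ j) ?_)
          by_contra hc
          exact absurd (tc_pos L m τ hL hm0 _ _ _ hc) (not_lt.2 hj)
      · refine (hz (fun j => τ * k j + 2 * τ - L)).1.trans (le_of_eq ?_)
        unfold wc flp
        rw [← Finset.sum_filter, Finset.sum_const, nsmul_eq_mul, mul_comm]
      · refine le_trans (le_of_eq ?_) (hz (fun j => τ * k j - L)).2
        unfold wc flp
        rw [← Finset.sum_filter, Finset.sum_const, nsmul_eq_mul, mul_comm]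
  have hμ0 : 0 ≤ μ := (Nat.cast_nonneg _).trans (hμ 0)
  have hR' : (0:ℤ) < R := by exact_mod_cast hR
  obtain ⟨o, ho⟩ := rounding S (psupp R) val
    (fun x q hq o t => by
      simp only [hval]
      funext j
      rw [@Wf_indep d L R (fun a b => Classical.propDecidable (a = b)) o x q hq t j])
    Kf lab (pcore R) (pcore_mem R) flo fhi
    (fun x _ k hk o => by
      obtain ⟨r, hr⟩ := @tc_prod d L R m τ (fun a b => Classical.propDecidable (a = b)) p x o k
      rw [hcT]
      refine (hflo x k r).trans (le_of_eq ?_)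
      rw [← hr]
      refine Finset.sum_congr rfl fun t _ => ?_
      simp only [hvk x _ k hk])
    (fun x _ k hk o => by
      obtain ⟨r, hr⟩ := @tc_prod d L R m τ (fun a b => Classical.propDecidable (a = b)) p x o k
      rw [hcT]
      refine le_trans (le_of_eq ?_) (hfhi x k r)
      rw [← hr]
      refine Finset.sum_congr rfl fun t _ => ?_
      simp only [hvk x _ k hk])
    μ Bs ((2 * C1 + 7 : ℕ)^d) (3^d) (fun x => (psupp_card R x).le) hμ0
    (fun q => by
      refine le_trans ?_ (hμ fun j => R * (q j - 1))
      unfold muq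
      refine Nat.cast_le.2 (Finset.card_le_card fun x hx => ?_)
      simp only [Finset.mem_filter] at hx
      obtain ⟨hxS, h1⟩ := hx
      refine (@Finset.mem_filter _ _ _ _ _).2 ⟨hxS, fun j => ?_⟩
      unfold psupp at h1
      rw [Fintype.mem_piFinset] at h1
      have h2 := Finset.mem_Icc.1 (h1 j)
      have e1 := Int.emod_add_mul_ediv (x j) R
      have a1 := Int.emod_nonneg (x j) hR'.ne'
      have a2 := Int.emod_lt_of_pos (x j) hR'
      constructor <;> nlinarith)
    (fun g => by
      refine le_trans ?_ (hB fun j => L * g j - C1 * L)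
      unfold wc
      refine Nat.cast_le.2 (Finset.card_le_card fun x hx => ?_)
      simp only [Finset.mem_filter] at hx
      obtain ⟨hxS, q, hq, hg⟩ := hx
      refine (@Finset.mem_filter _ _ _ _ _).2 ⟨hxS, fun j => ?_⟩
      have h1 := abs_le.1 (hvar x q hq j)
      have hgj : ⌊p (fun j => R * q j) j / L⌋ % (mL:ℤ) = g j := by rw [← hg]
      have e := Int.emod_add_mul_ediv ⌊p (fun j => R * q j) j / L⌋ mL
      rw [hgj] at e
      set w := ⌊p (fun j => R * q j) j / L⌋ / (mL:ℤ)
      set V := p (fun j => R * q j) j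
      have f1 := Int.floor_le (V / L)
      have f2 := Int.lt_floor_add_one (V / L)
      rw [← e] at f1 f2
      rw [le_div_iff₀ hLr] at f1
      rw [div_lt_iff₀ hLr] at f2
      push_cast at f1 f2
      have hmr : (m:ℝ) = L * mL := by exact_mod_cast hmL
      have g1 : (L * g j - C1 * L + m * w : ℤ) ≤ ⌊p x j⌋ := by
        rw [Int.le_floor]; push_cast; rw [hmr]; nlinarith
      have g2 : ⌊p x j⌋ < (L * g j - C1 * L + m * w : ℤ) + (2 * C1 + 1) * L := by
        rw [Int.floor_lt]; push_cast; rw [hmr]; nlinarith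
      show (⌊p x j⌋ - (L * g j - C1 * L)) % (m:ℤ) < _
      rw [show ⌊p x j⌋ - (L * g j - C1 * L) = (⌊p x j⌋ - (L * g j - C1 * L + m * w)) + m * w by ring, Int.add_mul_emod_self_left]
      refine (emod_le_of_nonneg _ m hm0 (by linarith)).trans_lt ?_
      push_cast
      linarith)
    (fun k hk => by
      refine ⟨(Fintype.piFinset fun _ : Fin d => Finset.Icc (-(C1 + 3) : ℤ) (C1 + 3)).image
        (fun v j => ((τ * k j) / (L:ℤ) + v j) % (mL:ℤ)), ?_, ?_⟩
      · refine le_trans (Nat.cast_le.2 Finset.card_image_le) ?_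
        rw [Fintype.card_piFinset]
        simp only [Int.card_Icc, Finset.prod_const, Finset.card_univ, Fintype.card_fin]
        rw [← Nat.cast_pow]
        refine Nat.cast_le.2 (Nat.pow_le_pow_left (by omega) d)
      · intro q x hxS hq o hv
        rw [hvk x o k hk] at hv
        rw [Finset.mem_image]
        have hvj := hv
        set Y : Fin d → ℤ := fun j => ⌊p x j + tri L (Wf L R o x j)⌋ with hY
        refine ⟨fun j => ⌊p (fun j => R * q j) j / L⌋ - (τ * k j) / (L:ℤ) - mL * ((Y j - τ * k j) / (m:ℤ)), ?_, ?_⟩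
        · rw [Fintype.mem_piFinset]
          intro j
          have h1 := abs_le.1 (hvar x q hq j)
          have hYj : (Y j - τ * k j) % (m:ℤ) < τ := hv j
          have y0 := Int.emod_nonneg (Y j - τ * k j) (by omega : (m:ℤ) ≠ 0)
          have e := Int.emod_add_mul_ediv (Y j - τ * k j) m
          set w := (Y j - τ * k j) / (m:ℤ)
          set V := p (fun j => R * q j) j
          have f1 := Int.floor_le (V / L)
          have f2 := Int.lt_floor_add_one (V / L)
          set fl := ⌊V / L⌋
          rw [le_div_iff₀ hLr] at f1
          rw [div_lt_iff₀ hLr] at f2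
          have t0 := tri_nonneg L (Wf L R o x j)
          have t1 := tri_le L (Wf L R o x j)
          have y1 : (Y j : ℝ) ≤ p x j + tri L (Wf L R o x j) := Int.floor_le _
          have y2 : p x j + tri L (Wf L R o x j) < (Y j : ℝ) + 1 := Int.lt_floor_add_one _
          have k1 := Int.emod_add_mul_ediv (τ * k j) L
          have k2 := Int.emod_nonneg (τ * k j) hLz.ne'
          have k3 := Int.emod_lt_of_pos (τ * k j) hLz
          set kk := (τ * k j) / (L:ℤ)
          have hmr : (m:ℝ) = L * mL := by exact_mod_cast hmL
          have b1 : (L:ℝ) * kk + m * w ≤ Y j := by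
            exact_mod_cast (by linarith : (L:ℤ) * kk + m * w ≤ Y j)
          have b2 : (Y j : ℝ) + 1 ≤ L * kk + m * w + L + τ := by
            exact_mod_cast (by linarith : Y j + 1 ≤ L * kk + m * w + L + τ)
          have hτL' : (τ:ℝ) ≤ L := by exact_mod_cast hτL
          rw [hmr] at b1 b2
          rw [Finset.mem_Icc]
          constructor
          · have : ((kk + mL * w - (C1 + 3) : ℤ) : ℝ) * L ≤ (fl + 1 : ℤ) * L := by
              push_cast
              nlinarith
            have := le_of_mul_le_mul_right this hLr
            have : kk + mL * w - (C1 + 3) ≤ fl + 1 := by exact_mod_cast this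
            have hstrict : ((kk + mL * w - (C1 + 3) : ℤ) : ℝ) * L < (fl + 1 : ℤ) * L := by
              push_cast
              nlinarith
            have := lt_of_mul_lt_mul_right hstrict hLr.le
            have : kk + mL * w - (C1 + 3) < fl + 1 := by exact_mod_cast this
            linarith
          · have : (fl : ℝ) * L ≤ ((kk + mL * w + (C1 + 3) : ℤ) : ℝ) * L := by
              push_cast
              nlinarith
            have := le_of_mul_le_mul_right this hLr
            have : fl ≤ kk + mL * w + (C1 + 3) := by exact_mod_cast this
            linarith
        · funext j
          simp only [hlab]
          rw [show τ * k j / (L:ℤ) + (⌊p (fun j => R * q j) j / L⌋ - (τ * k j) / (L:ℤ) - mL * ((Y j - τ * k j) / (m:ℤ)))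
            = ⌊p (fun j => R * q j) j / L⌋ + mL * (-((Y j - τ * k j) / (m:ℤ))) by ring, Int.add_mul_emod_self_left])
  refine ⟨fun x j => tri L (Wf L R o x j), fun x j => ⟨tri_nonneg _ _, tri_le _ _⟩,
    fun x y j => (tri_lip L _ _).trans (Wf_lip L R hR o x y j), fun k => ?_⟩
  set k' : Fin d → ℤ := fun j => k j % (mτ:ℤ) with hk'
  have hk'K : k' ∈ Kf := by
    rw [hKf, Fintype.mem_piFinset]
    intro j
    exact Finset.mem_Ico.2 ⟨Int.emod_nonneg _ (by omega), Int.emod_lt_of_pos _ (by omega)⟩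
  have hF : (wc S m (flp fun x j => p x j + tri L (Wf L R o x j)) (fun j => τ * k j) τ : ℝ) = Fc S val k' o := by
    unfold wc Fc
    rw [Finset.card_filter]
    push_cast
    refine Finset.sum_congr rfl fun x _ => ?_
    suffices key : (∀ j, (flp (fun x j => p x j + tri L (Wf L R o x j)) x j - (τ:ℤ) * k j) % (m:ℤ) < τ) ↔ val x o = k' by
      by_cases h : val x o = k'
      · rw [if_pos h, if_pos (key.2 h)]
      · rw [if_neg h, if_neg (fun hh => h (key.1 hh))]
    rw [hvk x o k' hk'K]
    refine forall_congr' fun j => ?_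
    have e := Int.emod_add_mul_ediv (k j) mτ
    have : ⌊p x j + tri L (Wf L R o x j)⌋ - τ * k j = ⌊p x j + tri L (Wf L R o x j)⌋ - τ * k' j + m * (-(k j / mτ)) := by
      rw [hk', hmτz]
      simp only
      linear_combination (-(τ:ℤ)) * e.symm
    show (⌊p x j + tri L (Wf L R o x j)⌋ - τ * k j) % (m:ℤ) < τ ↔ _
    rw [this, Int.add_mul_emod_self_left]
  rw [hF]
  have := ho k' hk'K
  push_cast at this ⊢
  constructor
  · linarith [this.1, hslo k']
  · linarith [this.2, hshi k']
end

section
/-- box index -/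
noncomputable def bx (M : ℝ) (t : ℤ) : ℤ := max (⌈(t:ℝ) / M⌉ - 1) 0

lemma bx_nonneg (M : ℝ) (t : ℤ) : 0 ≤ bx M t := le_max_right _ _

lemma bx_eq (M : ℝ) (hM : 0 < M) (t : ℤ) (ht : 0 < t) (p : ℤ) : bx M t = p ↔ M * p < t ∧ (t:ℝ) ≤ M * (p + 1) := by
  have h1 : 0 ≤ ⌈(t:ℝ) / M⌉ - 1 := by
    have : 0 < ⌈(t:ℝ) / M⌉ := Int.ceil_pos.2 (div_pos (by exact_mod_cast ht) hM)
    omega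
  unfold bx
  rw [max_eq_left h1, sub_eq_iff_eq_add, Int.ceil_eq_iff, lt_div_iff₀ hM, div_le_iff₀ hM]
  push_cast
  rw [add_sub_cancel_right, mul_comm, mul_comm (p+1:ℝ)]

lemma bx_lip (M : ℝ) (hM : 0 < M) (s t : ℤ) : |(bx M s : ℝ) - bx M t| ≤ |(s:ℝ) - t| / M + 1 := by
  unfold bx
  push_cast
  refine (abs_max_sub_max_le_abs _ _ _).trans ?_
  have e : |(s:ℝ) - t| / M = |(s:ℝ)/M - t/M| := by
    rw [← sub_div, abs_div, abs_of_pos hM]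
  rw [e]
  set u := (s:ℝ)/M
  set v := (t:ℝ)/M
  have := Int.ceil_lt_add_one u
  have := Int.ceil_lt_add_one v
  have := Int.le_ceil u
  have := Int.le_ceil v
  have := le_abs_self (u - v)
  have := neg_abs_le (u - v)
  rw [abs_le]
  constructor <;> linarith

open Classical in
lemma cnt_up {d : ℕ} (S : Finset (Fin d → ℤ)) (hS : ∀ x ∈ S, ∀ j, 0 ≤ x j) (M bH : ℝ) (hbH : 0 ≤ bH)
    (hbox : ∀ p : Fin d → ℤ, ((S.filter fun x => (∀ j, 0 < x j) ∧ ∀ j, bx M (x j) = p j).card : ℝ) ≤ bH)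
    (V : Fin d → Finset ℤ) (v w : ℝ) (hv : ∀ j, ((V j).card : ℝ) ≤ v) (hw : ∀ j, (((V j).image (bx M)).card : ℝ) ≤ w) :
    ((S.filter fun x => ∀ j, x j ∈ V j).card : ℝ) ≤ bH * w ^ d + d * v ^ (d-1) := by
  set A0 := S.filter fun x => (∀ j, 0 < x j) ∧ ∀ j, x j ∈ V j with hA0
  set B : Fin d → Finset (Fin d → ℤ) := fun j => Fintype.piFinset (fun i => if i = j then {0} else V i) with hB
  have hsub : (S.filter fun x => ∀ j, x j ∈ V j) ⊆ A0 ∪ Finset.univ.biUnion B := by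
    intro x hx
    simp only [Finset.mem_filter] at hx
    simp only [hA0, hB, Finset.mem_union, Finset.mem_filter, Finset.mem_biUnion, Finset.mem_univ, true_and, Fintype.mem_piFinset]
    by_cases h : ∀ j, 0 < x j
    · exact Or.inl ⟨hx.1, h, hx.2⟩
    · push Not at h
      obtain ⟨j, hj⟩ := h
      refine Or.inr ⟨j, fun i => ?_⟩
      split_ifs with hi
      · subst hi
        have := hS x hx.1 i
        simp; omega
      · exact hx.2 i
  have h0 : (A0.card : ℝ) ≤ bH * w ^ d := by
    have h1 := Finset.card_le_mul_card_image (f := fun x j => bx M (x j)) A0 ⌊bH⌋₊ (by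
      intro p hp
      refine Nat.le_floor ((Nat.cast_le.2 (Finset.card_le_card ?_)).trans (hbox p))
      intro x hx
      simp only [hA0, Finset.mem_filter] at hx ⊢
      exact ⟨hx.1.1, hx.1.2.1, fun j => congrFun hx.2 j⟩)
    have h2 : (A0.image fun x j => bx M (x j)) ⊆ Fintype.piFinset fun j => (V j).image (bx M) := by
      intro p hp
      simp only [hA0, Finset.mem_image, Finset.mem_filter] at hp
      obtain ⟨x, ⟨_, _, hx⟩, rfl⟩ := hp
      rw [Fintype.mem_piFinset]
      exact fun j => Finset.mem_image_of_mem _ (hx j)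
    have h3 := Finset.card_le_card h2
    rw [Fintype.card_piFinset] at h3
    have h4 : ((∏ j, ((V j).image (bx M)).card : ℕ) : ℝ) ≤ w ^ d := by
      push_cast
      calc _ ≤ ∏ j : Fin d, w := Finset.prod_le_prod (fun _ _ => by positivity) (fun j _ => hw j)
        _ = w ^ d := by simp
    calc (A0.card : ℝ) ≤ (⌊bH⌋₊ : ℝ) * (A0.image fun x j => bx M (x j)).card := by exact_mod_cast h1
      _ ≤ bH * w ^ d := by
        refine mul_le_mul (Nat.floor_le hbH) ?_ (by positivity) hbH
        refine le_trans ?_ h4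
        exact_mod_cast h3
  have hj : ∀ j, ((B j).card : ℝ) ≤ v ^ (d - 1) := by
    intro j
    simp only [hB]
    rw [Fintype.card_piFinset, ← Finset.mul_prod_erase _ _ (Finset.mem_univ j), if_pos rfl, Finset.card_singleton, one_mul]
    push_cast
    calc _ ≤ ∏ i ∈ Finset.univ.erase j, v := by
          refine Finset.prod_le_prod (fun _ _ => by positivity) fun i hi => ?_
          rw [if_neg (Finset.ne_of_mem_erase hi)]
          exact hv i
      _ = v ^ (d-1) := by simp
  calc ((S.filter fun x => ∀ j, x j ∈ V j).card : ℝ) ≤ (A0.card : ℝ) + ((Finset.univ.biUnion B).card : ℝ) := by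
        exact_mod_cast (Finset.card_le_card hsub).trans (Finset.card_union_le _ _)
    _ ≤ bH * w ^ d + ∑ j, ((B j).card : ℝ) := by
        refine add_le_add h0 ?_
        exact_mod_cast Finset.card_biUnion_le
    _ ≤ bH * w ^ d + ∑ j : Fin d, v ^ (d-1) := by
        gcongr with j
        exact hj j
    _ = _ := by simp

lemma card_Ioc_le (u v : ℝ) (A : Finset ℤ) (hA : ∀ t ∈ A, u < t ∧ (t:ℝ) ≤ v) (huv : u ≤ v) : (A.card : ℝ) ≤ v - u + 1 := by
  have h : A ⊆ Finset.Icc (⌊u⌋ + 1) ⌊v⌋ := by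
    intro t ht
    rw [Finset.mem_Icc]
    have := hA t ht
    exact ⟨Int.add_one_le_iff.2 (Int.floor_lt.2 this.1), Int.le_floor.2 this.2⟩
  have h1 := Finset.card_le_card h
  rw [Int.card_Icc] at h1
  have h2 : ⌊u⌋ ≤ ⌊v⌋ := Int.floor_mono huv
  have h3 : ((A.card : ℤ)) ≤ ⌊v⌋ - ⌊u⌋ := by omega
  have h4 : (A.card : ℝ) ≤ ⌊v⌋ - ⌊u⌋ := by exact_mod_cast h3
  have := Int.floor_le v
  have := Int.lt_floor_add_one u
  linarith

lemma card_Icc_le (u v : ℝ) (A : Finset ℤ) (hA : ∀ t ∈ A, u ≤ t ∧ (t:ℝ) ≤ v) (huv : u ≤ v) : (A.card : ℝ) ≤ v - u + 1 := by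
  have h : A ⊆ Finset.Icc ⌈u⌉ ⌊v⌋ := by
    intro t ht
    rw [Finset.mem_Icc]
    have := hA t ht
    exact ⟨Int.ceil_le.2 this.1, Int.le_floor.2 this.2⟩
  have h1 := Finset.card_le_card h
  rw [Int.card_Icc] at h1
  have h5 := Int.le_ceil u
  have := Int.floor_le v
  rcases le_or_gt (⌊v⌋ + 1 - ⌈u⌉) 0 with h2 | h2
  · have : A.card = 0 := by omega
    rw [this]; push_cast; linarith
  · have h3 : ((A.card : ℤ)) ≤ ⌊v⌋ + 1 - ⌈u⌉ := by omega
    have h4 : (A.card : ℝ) ≤ ⌊v⌋ + 1 - ⌈u⌉ := by exact_mod_cast h3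
    linarith

lemma bx_fiber (M : ℝ) (hM : 0 < M) (A : Finset ℤ) (p : ℤ) (hA : ∀ t ∈ A, 0 ≤ t ∧ bx M t = p) : (A.card : ℝ) ≤ M + 1 := by
  rcases eq_or_ne p 0 with rfl | hp
  · have := card_Icc_le 0 M A (fun t ht => ?_) hM.le
    · simpa using this
    · obtain ⟨h0, h1⟩ := hA t ht
      refine ⟨by exact_mod_cast h0, ?_⟩
      rcases h0.eq_or_lt with rfl | h0
      · simpa using hM.le
      · have := ((bx_eq M hM t h0 0).1 h1).2
        simpa using this
  · have := card_Ioc_le (M * p) (M * (p+1)) A (fun t ht => ?_) (by linarith)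
    · linarith
    · obtain ⟨h0, h1⟩ := hA t ht
      rcases h0.eq_or_lt with rfl | h0
      · exfalso; apply hp; rw [← h1]; simp [bx]
      · exact (bx_eq M hM t h0 p).1 h1

lemma wind_card_le (m s : ℕ) (z : ℤ) (A : Finset ℤ) (hA : ∀ t ∈ A, 0 ≤ t ∧ t < m ∧ (t - z) % (m:ℤ) < s) : A.card ≤ s := by
  have : A.card ≤ (Finset.Ico (0:ℤ) s).card := by
    refine Finset.card_le_card_of_injOn (fun t => (t - z) % (m:ℤ)) ?_ ?_
    · intro t ht
      obtain ⟨h0, h1, h2⟩ := hA t ht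
      have : (0:ℤ) < m := by omega
      simp only [Finset.coe_Ico, Set.mem_Ico]
      exact ⟨Int.emod_nonneg _ this.ne', h2⟩
    · intro t ht u hu htu
      obtain ⟨h0, h1, -⟩ := hA t ht
      obtain ⟨h0', h1', -⟩ := hA u hu
      have h : (t - z) % (m:ℤ) = (u - z) % (m:ℤ) := htu
      have h2 : t % (m:ℤ) = u % (m:ℤ) := by
        have := Int.ModEq.add_right z (show (t - z) ≡ (u - z) [ZMOD m] from h)
        simpa [Int.ModEq] using this
      rwa [Int.emod_eq_of_lt h0 h1, Int.emod_eq_of_lt h0' h1'] at h2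
  simpa using this

lemma wind_card_ge (m s : ℕ) (hm : 0 < m) (hs : s ≤ m) (z : ℤ) :
    s ≤ ((Finset.Ico (0:ℤ) m).filter fun t => (t - z) % (m:ℤ) < s).card := by
  have : (Finset.Ico (0:ℤ) s).card ≤ ((Finset.Ico (0:ℤ) m).filter fun t => (t - z) % (m:ℤ) < s).card := by
    have hm' : (0:ℤ) < m := by exact_mod_cast hm
    refine Finset.card_le_card_of_injOn (fun r => (z + r) % (m:ℤ)) ?_ ?_
    · intro r hr
      simp only [Finset.coe_Ico, Set.mem_Ico] at hr
      simp only [Finset.coe_filter, Finset.mem_Ico, Set.mem_setOf_eq]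
      refine ⟨⟨Int.emod_nonneg _ hm'.ne', Int.emod_lt_of_pos _ hm'⟩, ?_⟩
      have : ((z + r) % (m:ℤ) - z) % (m:ℤ) = r % (m:ℤ) := by
        rw [Int.emod_sub_emod]; congr 1; ring
      rw [this, Int.emod_eq_of_lt hr.1 (by omega)]
      exact hr.2
    · intro t ht u hu htu
      simp only [Finset.coe_Ico, Set.mem_Ico] at ht hu
      have h : (z + t) % (m:ℤ) = (z + u) % (m:ℤ) := htu
      have h2 : t % (m:ℤ) = u % (m:ℤ) := by
        have := Int.ModEq.add_left_cancel' z (show (z + t) ≡ (z + u) [ZMOD m] from h)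
        exact this
      rwa [Int.emod_eq_of_lt ht.1 (by omega), Int.emod_eq_of_lt hu.1 (by omega)] at h2
  simpa using this
end

section
structure Ini (d : ℕ) (θ a b : ℝ) (l : ℕ) (M H : ℝ) (S : Finset (Fin d → ℤ)) (p0 : (Fin d → ℤ) → Fin d → ℝ) : Prop where
  hM : 1 < M
  hH : 1 ≤ H
  lip : ∀ x y j, |p0 x j - p0 y j| ≤ dist x y / M + 1
  low : ∀ (z : Fin d → ℤ) (s : ℕ), s ≤ 2^l → a * H * s^d ≤ wc S (2^l) (flp p0) z s
  up : ∀ (z : Fin d → ℤ) (s : ℕ), (wc S (2^l) (flp p0) z s : ℝ) ≤ b * H * s^d + d * (s * (M + 1))^(d-1)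
  cube : ∀ (z : Fin d → ℤ) (r : ℕ), ((S.filter fun x => ∀ j, z j ≤ x j ∧ x j < z j + r).card : ℝ) ≤ b * H * (r / M + 2)^d + d * r^(d-1)
  tot : (S.card : ℝ) = H * (2^l)^d
  ha : θ < a
  hab : a < b
  hb : b < 1 / θ

open Classical in
lemma Ini_of_Hyp {d : ℕ} {θ : ℝ} (hθ : 0 < θ) {m n l : ℕ} {a b c : ℝ} {S : Finset (Fin d → ℤ)} (h : Hyp d θ m n l a b c S) :
    Ini d θ a b l (c * n / m) ((n / m)^d) S (fun x j => (bx (c * n / m) (x j) : ℝ)) := by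
  obtain ⟨hml, hmn, ha, hab, hb, hc, hS, hcard, hbox⟩ := h
  have hm0 : 0 < m := by rw [hml]; positivity
  have hmr : (0:ℝ) < m := by exact_mod_cast hm0
  have hmnr : (m:ℝ) ≤ n := by exact_mod_cast hmn
  have hh : (1:ℝ) ≤ n / m := by rwa [one_le_div hmr]
  set M : ℝ := c * n / m with hMdef
  set H : ℝ := ((n:ℝ) / m)^d with hHdef
  have hMh : M = c * (n / m) := by rw [hMdef]; ring
  have hM : 1 < M := by rw [hMh]; nlinarith
  have hM0 : 0 < M := by linarith
  have hH : 1 ≤ H := one_le_pow₀ hh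
  have hH' : H = n^d / m^d := div_pow _ _ _
  have hS0 : ∀ x ∈ S, ∀ j, 0 ≤ x j := fun x hx j => by exact_mod_cast (hS x hx j).1
  have hMm : M * m = c * n := by rw [hMdef]; field_simp
  have hflp : flp (fun (x : Fin d → ℤ) j => (bx M (x j) : ℝ)) = fun x j => bx M (x j) := by
    funext x j; simp [flp]
  -- box counts
  have hset : ∀ (q : Fin d → ℤ), (∀ j, 0 ≤ q j ∧ q j < m) →
      a * H ≤ ((S.filter fun x => (∀ j, 0 < x j) ∧ ∀ j, bx M (x j) = q j).card : ℝ) ∧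
      ((S.filter fun x => (∀ j, 0 < x j) ∧ ∀ j, bx M (x j) = q j).card : ℝ) ≤ b * H := by
    intro q hq
    have := hbox (fun j => ⟨(q j).toNat, by have := hq j; omega⟩)
    have hq' : ∀ j, (((q j).toNat : ℕ) : ℝ) = q j := fun j => by
      exact_mod_cast Int.toNat_of_nonneg (hq j).1
    simp only [hq'] at this
    have hs : {x | x ∈ S ∧ ∀ i, c * n * (q i:ℝ) / m < (x i : ℝ) ∧ (x i : ℝ) ≤ c * n * ((q i:ℝ) + 1) / m} =
        ((S.filter fun x => (∀ j, 0 < x j) ∧ ∀ j, bx M (x j) = q j : Finset (Fin d → ℤ)) : Set (Fin d → ℤ)) := by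
      ext x
      simp only [Finset.coe_filter, Set.mem_setOf_eq]
      have e1 : ∀ r : ℝ, c * n * r / m = M * r := fun r => by rw [hMdef]; ring
      simp only [e1]
      refine and_congr_right fun hx => ?_
      rw [← forall_and]
      refine forall_congr' fun j => ?_
      constructor
      · intro h1
        have : (0:ℝ) ≤ M * q j := mul_nonneg hM0.le (by exact_mod_cast (hq j).1)
        have h0 : 0 < x j := by exact_mod_cast this.trans_lt h1.1
        exact ⟨h0, (bx_eq M hM0 _ h0 _).2 h1⟩
      · intro h1
        exact (bx_eq M hM0 _ h1.1 _).1 h1.2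
    rw [hs, Set.ncard_coe_finset, mul_div_assoc, mul_div_assoc, ← hH'] at this
    exact this
  have hrange : ∀ x ∈ S, (∀ j, 0 ≤ x j) → ∀ j, bx M (x j) < m := by
    intro x hx h0 j
    rcases (h0 j).eq_or_lt with h1 | h1
    · rw [← h1]; simp [bx]; exact hm0
    · have h2 := ((bx_eq M hM0 _ h1 _).1 rfl).1
      have h3 := (hS x hx j).2
      rw [← hMm] at h3
      have : (bx M (x j) : ℝ) < m := lt_of_mul_lt_mul_left (h2.trans_le h3) hM0.le
      exact_mod_cast this
  have hbH : 0 ≤ b * H := by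
    have : 0 < b := hθ.trans (ha.trans hab)
    positivity
  have hboxle : ∀ q : Fin d → ℤ, ((S.filter fun x => (∀ j, 0 < x j) ∧ ∀ j, bx M (x j) = q j).card : ℝ) ≤ b * H := by
    intro q
    by_cases hq : ∀ j, 0 ≤ q j ∧ q j < m
    · exact (hset q hq).2
    · refine le_trans (le_of_eq ?_) hbH
      rw [Nat.cast_eq_zero, Finset.card_eq_zero, Finset.filter_eq_empty_iff]
      rintro x hx ⟨h1, h2⟩
      refine hq fun j => ?_
      rw [← h2 j]
      exact ⟨bx_nonneg _ _, hrange x hx (hS0 x hx) j⟩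
  have hmc : ((2^l : ℕ) : ℤ) = m := by rw [hml]
  refine ⟨hM, hH, ?_, ?_, ?_, ?_, ?_, ha, hab, hb⟩
  · intro x y j
    refine (bx_lip M hM0 _ _).trans ?_
    have := dist_le_pi_dist x y j
    rw [Int.dist_eq] at this
    gcongr
  · intro z s hs
    rw [hflp, ← hml]
    rw [← hml] at hs
    set W : Fin d → Finset ℤ := fun j => (Finset.Ico (0:ℤ) m).filter fun t => (t - z j) % (m:ℤ) < s with hW
    have hWc : ∀ j, s ≤ (W j).card := fun j => wind_card_ge m s hm0 hs (z j)
    set A := S.filter fun x => (∀ j, 0 < x j) ∧ ∀ j, bx M (x j) ∈ W j with hA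
    have h1 := Finset.card_eq_sum_card_fiberwise (f := fun (x : Fin d → ℤ) j => bx M (x j)) (s := A) (t := Fintype.piFinset W) (by
      intro x hx
      simp only [hA, Finset.coe_filter, Set.mem_setOf_eq] at hx
      exact Finset.mem_coe.2 (Fintype.mem_piFinset.2 hx.2.2))
    have h2 : A.card ≤ wc S m (fun x j => bx M (x j)) z s := by
      unfold wc
      refine Finset.card_le_card fun x hx => ?_
      simp only [hA, hW, Finset.mem_filter] at hx
      simp only [Finset.mem_filter]
      exact ⟨hx.1, fun j => (hx.2.2 j).2⟩
    have h3 : ∀ q ∈ Fintype.piFinset W, a * H ≤ ((A.filter fun x => (fun j => bx M (x j)) = q).card : ℝ) := by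
      intro q hq
      rw [Fintype.mem_piFinset] at hq
      have hq2 : ∀ j, 0 ≤ q j ∧ q j < m := fun j => by
        have := hq j
        simp only [hW, Finset.mem_filter, Finset.mem_Ico] at this
        exact this.1
      refine (hset q hq2).1.trans (Nat.cast_le.2 (Finset.card_le_card fun x hx => ?_))
      simp only [Finset.mem_filter] at hx
      simp only [hA, Finset.mem_filter]
      refine ⟨⟨hx.1, hx.2.1, fun j => ?_⟩, funext hx.2.2⟩
      rw [hx.2.2 j]; exact hq j
    have haH : 0 ≤ a * H := by
      have : 0 < a := hθ.trans ha
      positivity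
    have h4 : ((s:ℝ))^d ≤ ((Fintype.piFinset W).card : ℝ) := by
      rw [Fintype.card_piFinset]
      push_cast
      calc (s:ℝ)^d = ∏ j : Fin d, (s:ℝ) := by simp
        _ ≤ _ := Finset.prod_le_prod (fun _ _ => by positivity) fun j _ => by exact_mod_cast hWc j
    calc a * H * s^d ≤ a * H * ((Fintype.piFinset W).card : ℝ) := mul_le_mul_of_nonneg_left h4 haH
      _ = ∑ q ∈ Fintype.piFinset W, a * H := by rw [Finset.sum_const, nsmul_eq_mul, mul_comm]
      _ ≤ ∑ q ∈ Fintype.piFinset W, ((A.filter fun x => (fun j => bx M (x j)) = q).card : ℝ) := Finset.sum_le_sum h3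
      _ = (A.card : ℝ) := by rw [h1]; push_cast; rfl
      _ ≤ _ := by exact_mod_cast h2
  · intro z s
    rw [hflp, ← hml]
    set V : Fin d → Finset ℤ := fun j => (S.image fun x => x j).filter fun t => (bx M t - z j) % (m:ℤ) < s with hV
    have hVm : ∀ j, ∀ t ∈ V j, 0 ≤ t ∧ bx M t < m ∧ (bx M t - z j) % (m:ℤ) < s := by
      intro j t ht
      simp only [hV, Finset.mem_filter, Finset.mem_image] at ht
      obtain ⟨⟨x, hx, rfl⟩, h2⟩ := ht
      exact ⟨hS0 x hx j, hrange x hx (hS0 x hx) j, h2⟩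
    have hw : ∀ j, ((V j).image (bx M)).card ≤ s := by
      intro j
      refine wind_card_le m s (z j) _ fun t ht => ?_
      obtain ⟨u, hu, rfl⟩ := Finset.mem_image.1 ht
      exact ⟨bx_nonneg _ _, (hVm j u hu).2⟩
    have hv : ∀ j, ((V j).card : ℝ) ≤ s * (M + 1) := by
      intro j
      have h1 := Finset.card_le_mul_card_image (f := bx M) (V j) ⌊M + 1⌋₊ (by
        intro p hp
        refine Nat.le_floor (bx_fiber M hM0 _ p fun t ht => ?_)
        simp only [Finset.mem_filter] at ht
        exact ⟨(hVm j t ht.1).1, ht.2⟩)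
      calc ((V j).card : ℝ) ≤ (⌊M+1⌋₊ : ℝ) * ((V j).image (bx M)).card := by exact_mod_cast h1
        _ ≤ (M + 1) * s := by
          refine mul_le_mul (Nat.floor_le (by linarith)) (by exact_mod_cast hw j) (by positivity) (by linarith)
        _ = _ := mul_comm _ _
    refine le_trans ?_ (cnt_up S hS0 M (b * H) hbH hboxle V _ s hv (fun j => by exact_mod_cast hw j))
    unfold wc
    refine Nat.cast_le.2 (Finset.card_le_card fun x hx => ?_)
    simp only [Finset.mem_filter] at hx
    simp only [Finset.mem_filter, hV, Finset.mem_image]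
    exact ⟨hx.1, fun j => ⟨⟨x, hx.1, rfl⟩, hx.2 j⟩⟩
  · intro z r
    rcases Nat.eq_zero_or_pos d with rfl | hd
    · have := cnt_up S hS0 M (b * H) hbH hboxle (fun _ => ∅) 0 0 (by simp) (by simp)
      refine le_trans (Nat.cast_le.2 (Finset.card_le_card fun x hx => ?_)) (this.trans (le_of_eq ?_))
      · simp only [Finset.mem_filter] at hx
        simp only [Finset.mem_filter]
        exact ⟨hx.1, fun j => j.elim0⟩
      · simp
    rcases Nat.eq_zero_or_pos r with rfl | hr
    · refine le_trans (le_of_eq (b := 0) ?_) (by positivity)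
      rw [Nat.cast_eq_zero, Finset.card_eq_zero, Finset.filter_eq_empty_iff]
      intro x hx h1
      have := h1 ⟨0, hd⟩
      push_cast at this
      omega
    set V : Fin d → Finset ℤ := fun j => Finset.Ico (z j) (z j + r) with hV
    refine le_trans ?_ (cnt_up S hS0 M (b * H) hbH hboxle V r (r / M + 2) ?_ ?_)
    · refine Nat.cast_le.2 (Finset.card_le_card fun x hx => ?_)
      simp only [Finset.mem_filter] at hx
      simp only [Finset.mem_filter, hV, Finset.mem_Ico]
      exact hx
    · intro j; simp [hV]
    · intro j
      have hmono : Monotone (bx M) := by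
        intro s t hst
        unfold bx
        have : (s:ℝ) / M ≤ t / M := by gcongr
        have := Int.ceil_mono this
        exact max_le_max (by omega) le_rfl
      have h0 : (bx M (z j) : ℝ) ≤ bx M (z j + r - 1) := by exact_mod_cast hmono (by omega)
      have := card_Icc_le (bx M (z j)) (bx M (z j + r - 1)) ((V j).image (bx M)) (fun t ht => ?_) h0
      · have h2 := bx_lip M hM0 (z j + r - 1) (z j)
        have h3 := le_abs_self ((bx M (z j + r - 1) : ℝ) - bx M (z j))
        have h4 : |((z j + r - 1 : ℤ):ℝ) - (z j:ℤ)| ≤ r := by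
          have : (1:ℝ) ≤ r := by exact_mod_cast hr
          push_cast
          rw [abs_of_nonneg] <;> linarith
        have h5 : |((z j + r - 1 : ℤ):ℝ) - (z j:ℤ)| / M ≤ r / M := by gcongr
        linarith
      · obtain ⟨u, hu, rfl⟩ := Finset.mem_image.1 ht
        simp only [hV, Finset.mem_Ico] at hu
        exact ⟨by exact_mod_cast hmono hu.1, by exact_mod_cast hmono (by omega)⟩
  · rw [hcard, hH']
    have : ((2:ℝ)^l) = m := by rw [hml]; push_cast; rfl
    rw [this]
    field_simp
    push_cast
    rfl
end

section
def Dens {d : ℕ} (S : Finset (Fin d → ℤ)) (m : ℕ) (p : (Fin d → ℤ) → Fin d → ℝ) (τ : ℕ) (A B H : ℝ) : Prop :=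
  ∀ k : Fin d → ℤ, A * H * τ^d ≤ wc S m (flp p) (fun j => τ * k j) τ ∧ (wc S m (flp p) (fun j => τ * k j) τ : ℝ) ≤ B * H * τ^d

lemma emod_dec (P : ℤ) (m : ℕ) : P = m * (P / m) + P % m := (Int.mul_ediv_add_emod P m).symm

lemma emod_shift_le (w r : ℤ) (m : ℕ) (hm : 0 < m) (h : 0 ≤ r) : (m * w + r) % (m:ℤ) ≤ r := by
  rw [Int.mul_add_emod_self_left]
  exact emod_le_of_nonneg r m hm h

open Classical in
lemma dens_up {d : ℕ} {S : Finset (Fin d → ℤ)} {m : ℕ} {p : (Fin d → ℤ) → Fin d → ℝ} {τ : ℕ} {A B H : ℝ}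
    (h : Dens S m p τ A B H) (hm : 0 < m) (hτ : 0 < τ) (hBH : 0 ≤ B * H) (z : Fin d → ℤ) (s : ℕ) :
    (wc S m (flp p) z s : ℝ) ≤ B * H * (s + 2 * τ)^d := by
  set N := s / τ + 2 with hN
  have hτ' : (0:ℤ) < τ := by exact_mod_cast hτ
  have hsub : (S.filter fun x => ∀ j, (flp p x j - z j) % (m:ℤ) < s) ⊆
      (Fintype.piFinset fun _ : Fin d => Finset.Ico (0:ℤ) N).biUnion fun q =>
        S.filter fun x => ∀ j, (flp p x j - τ * (z j / τ + q j)) % (m:ℤ) < τ := by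
    intro x hx
    simp only [Finset.mem_filter] at hx
    simp only [Finset.mem_biUnion, Finset.mem_filter, Fintype.mem_piFinset, Finset.mem_Ico]
    have hm' : (0:ℤ) < m := by exact_mod_cast hm
    refine ⟨fun j => ((flp p x j - z j) % (m:ℤ) + z j % τ) / τ, fun j => ?_, hx.1, fun j => ?_⟩
    · have h1 := Int.emod_nonneg (flp p x j - z j) hm'.ne'
      have h2 := Int.emod_nonneg (z j) hτ'.ne'
      have h3 := Int.emod_lt_of_pos (z j) hτ'
      have h4 := hx.2 j
      refine ⟨Int.ediv_nonneg (by omega) hτ'.le, ?_⟩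
      rw [Int.ediv_lt_iff_lt_mul hτ', hN]
      have h5 : (s:ℤ) = τ * (s / τ) + s % τ := emod_dec s τ
      have h6 := Int.emod_lt_of_pos (s:ℤ) hτ'
      push_cast
      nlinarith
    · set r := (flp p x j - z j) % (m:ℤ) with hr
      have h1 := emod_dec (flp p x j - z j) m
      have h2 := emod_dec (z j) τ
      have h3 := emod_dec (r + z j % τ) τ
      have e : flp p x j - τ * (z j / τ + (r + z j % τ) / τ) = m * ((flp p x j - z j) / m) + (r + z j % τ) % τ := by
        rw [← hr] at h1
        linear_combination h1 + h2 + h3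
      rw [e]
      exact (emod_shift_le _ _ m hm (Int.emod_nonneg _ hτ'.ne')).trans_lt (Int.emod_lt_of_pos _ hτ')
  have h1 := Finset.card_le_card hsub
  have h2 := h1.trans Finset.card_biUnion_le
  have h3 : (wc S m (flp p) z s : ℝ) ≤ ∑ q ∈ (Fintype.piFinset fun _ : Fin d => Finset.Ico (0:ℤ) N), B * H * τ^d := by
    unfold wc
    refine (Nat.cast_le.2 h2).trans ?_
    push_cast
    exact Finset.sum_le_sum fun q _ => (h fun j => z j / τ + q j).2
  refine h3.trans ?_
  rw [Finset.sum_const, Fintype.card_piFinset, nsmul_eq_mul]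
  simp only [Int.card_Ico, sub_zero, Int.toNat_natCast, Finset.prod_const, Finset.card_univ, Fintype.card_fin]
  push_cast
  have h4 : (N:ℝ) * τ ≤ s + 2 * τ := by
    have : s / τ * τ ≤ s := Nat.div_mul_le_self s τ
    have : N * τ ≤ s + 2 * τ := by rw [hN, add_mul]; omega
    exact_mod_cast this
  calc (N:ℝ)^d * (B * H * τ^d) = B * H * (N * τ)^d := by rw [mul_pow]; ring
    _ ≤ _ := by gcongr

open Classical in
lemma dens_lo {d : ℕ} {S : Finset (Fin d → ℤ)} {m : ℕ} {p : (Fin d → ℤ) → Fin d → ℝ} {τ : ℕ} {A B H : ℝ}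
    (h : Dens S m p τ A B H) (hm : 0 < m) (hτ : 0 < τ) (hAH : 0 ≤ A * H) (z : Fin d → ℤ) (s : ℕ) (hs : s ≤ m) (hs2 : 2 * τ ≤ s) :
    A * H * (s - 2 * τ)^d ≤ wc S m (flp p) z s := by
  set N := s / τ - 1 with hN
  have hτ' : (0:ℤ) < τ := by exact_mod_cast hτ
  have hm' : (0:ℤ) < m := by exact_mod_cast hm
  have hst : 2 ≤ s / τ := (Nat.le_div_iff_mul_le hτ).2 hs2
  have hN1 : s / τ = N + 1 := by omega
  have hNs : N * τ + τ ≤ s := by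
    have := Nat.div_mul_le_self s τ
    rw [hN1] at this
    linarith
  have hNs' : (N:ℤ) * τ + τ ≤ s := by exact_mod_cast hNs
  have hsm : (s:ℤ) ≤ m := by exact_mod_cast hs
  have hsub : ((Fintype.piFinset fun _ : Fin d => Finset.Ico (0:ℤ) N).biUnion fun q =>
        S.filter fun x => ∀ j, (flp p x j - τ * (z j / τ + 1 + q j)) % (m:ℤ) < τ) ⊆ 
      (S.filter fun x => ∀ j, (flp p x j - z j) % (m:ℤ) < s) := by
    intro x hx
    simp only [Finset.mem_biUnion, Finset.mem_filter, Fintype.mem_piFinset, Finset.mem_Ico] at hx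
    simp only [Finset.mem_filter]
    obtain ⟨q, hq, hxS, hx⟩ := hx
    refine ⟨hxS, fun j => ?_⟩
    have h1 := emod_dec (flp p x j - τ * (z j / τ + 1 + q j)) m
    set r := (flp p x j - τ * (z j / τ + 1 + q j)) % (m:ℤ) with hr
    have h0 : 0 ≤ r := Int.emod_nonneg _ hm'.ne'
    have h0' := hx j
    have h2 := emod_dec (z j) τ
    have h3 := Int.emod_nonneg (z j) hτ'.ne'
    have h4 := Int.emod_lt_of_pos (z j) hτ'
    have hqj := hq j
    have e : flp p x j - z j = m * ((flp p x j - τ * (z j / τ + 1 + q j)) / m) + (r + τ - z j % τ + τ * q j) := by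
      linear_combination h1 - h2
    rw [e]
    have : 0 ≤ τ * q j := mul_nonneg hτ'.le hqj.1
    refine (emod_shift_le _ _ m hm (by linarith)).trans_lt ?_
    have : τ * q j ≤ τ * (N - 1) := mul_le_mul_of_nonneg_left (by omega) hτ'.le
    rw [← hr] at h0'
    nlinarith
  have hdisj : Set.PairwiseDisjoint ((Fintype.piFinset fun _ : Fin d => Finset.Ico (0:ℤ) N : Finset (Fin d → ℤ)) : Set (Fin d → ℤ))
      fun q => S.filter fun x => ∀ j, (flp p x j - τ * (z j / τ + 1 + q j)) % (m:ℤ) < τ := by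
    intro q hq q' hq' hne
    refine Finset.disjoint_left.2 fun x hx hx' => hne ?_
    simp only [Finset.mem_filter] at hx hx'
    simp only [Finset.mem_coe, Fintype.mem_piFinset, Finset.mem_Ico] at hq hq'
    funext j
    have h1 := emod_dec (flp p x j - τ * (z j / τ + 1 + q j)) m
    have h1' := emod_dec (flp p x j - τ * (z j / τ + 1 + q' j)) m
    have g := hx.2 j
    have g' := hx'.2 j
    set r := (flp p x j - τ * (z j / τ + 1 + q j)) % (m:ℤ)
    set r' := (flp p x j - τ * (z j / τ + 1 + q' j)) % (m:ℤ)
    have h0 : 0 ≤ r := Int.emod_nonneg _ hm'.ne'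
    have h0' : 0 ≤ r' := Int.emod_nonneg _ hm'.ne'
    set w := (flp p x j - τ * (z j / τ + 1 + q j)) / (m:ℤ)
    set w' := (flp p x j - τ * (z j / τ + 1 + q' j)) / (m:ℤ)
    have e : m * w + (r + τ * q j) = m * w' + (r' + τ * q' j) := by linear_combination h1' - h1
    have b1 : τ * q j ≤ τ * (N - 1) := mul_le_mul_of_nonneg_left (by have := hq j; omega) hτ'.le
    have b2 : τ * q' j ≤ τ * (N - 1) := mul_le_mul_of_nonneg_left (by have := hq' j; omega) hτ'.le
    have b3 : 0 ≤ τ * q j := mul_nonneg hτ'.le (hq j).1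
    have b4 : 0 ≤ τ * q' j := mul_nonneg hτ'.le (hq' j).1
    have c1 : r + τ * q j < m := by nlinarith
    have c2 : r' + τ * q' j < m := by nlinarith
    have e2 : r + τ * q j = r' + τ * q' j := by
      have := congrArg (· % (m:ℤ)) e
      simp only [Int.mul_add_emod_self_left] at this
      rwa [Int.emod_eq_of_lt (by omega) c1, Int.emod_eq_of_lt (by omega) c2] at this
    have := congrArg (· / (τ:ℤ)) e2
    simp only [Int.add_mul_ediv_left _ _ hτ'.ne'] at this
    rwa [Int.ediv_eq_zero_of_lt h0 g, Int.ediv_eq_zero_of_lt h0' g', zero_add, zero_add] at this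
  have h1 := Finset.card_le_card hsub
  rw [Finset.card_biUnion hdisj] at h1
  have h3 : ∑ q ∈ (Fintype.piFinset fun _ : Fin d => Finset.Ico (0:ℤ) N), A * H * τ^d ≤ (wc S m (flp p) z s : ℝ) := by
    unfold wc
    refine le_trans ?_ (Nat.cast_le.2 h1)
    push_cast
    exact Finset.sum_le_sum fun q _ => (h fun j => z j / τ + 1 + q j).1
  refine le_trans ?_ h3
  rw [Finset.sum_const, Fintype.card_piFinset, nsmul_eq_mul]
  simp only [Int.card_Ico, sub_zero, Int.toNat_natCast, Finset.prod_const, Finset.card_univ, Fintype.card_fin]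
  push_cast
  have h4 : (s:ℝ) - 2 * τ ≤ N * τ := by
    have : s < (s / τ + 1) * τ := by
      have := Nat.div_add_mod s τ
      have := Nat.mod_lt s hτ
      nlinarith
    rw [hN1] at this
    have : s ≤ N * τ + 2 * τ := by nlinarith
    have : (s:ℝ) ≤ N * τ + 2 * τ := by exact_mod_cast this
    linarith
  have h5 : (0:ℝ) ≤ s - 2 * τ := by
    have : (2:ℝ) * τ ≤ s := by exact_mod_cast hs2
    linarith
  calc A * H * (s - 2 * τ)^d ≤ A * H * (N * τ)^d := by gcongr
    _ = _ := by rw [mul_pow]; ring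

/-- displacement lemmas -/
lemma disp_up {d : ℕ} (S : Finset (Fin d → ℤ)) (m : ℕ) (hm : 0 < m) (p p' : (Fin d → ℤ) → Fin d → ℝ) (D : ℕ)
    (h1 : ∀ x j, p' x j ≤ p x j) (h2 : ∀ x j, p x j ≤ p' x j + D) (z : Fin d → ℤ) (s : ℕ) :
    wc S m (flp p) z s ≤ wc S m (flp p') (fun j => z j - D) (s + D) := by
  unfold wc
  refine Finset.card_le_card fun x hx => ?_
  simp only [Finset.mem_filter] at hx ⊢
  refine ⟨hx.1, fun j => ?_⟩
  have hm' : (0:ℤ) < m := by exact_mod_cast hm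
  have a1 : flp p' x j ≤ flp p x j := Int.floor_mono (h1 x j)
  have a2 : flp p x j ≤ flp p' x j + D := by
    have := Int.floor_mono (h2 x j)
    rwa [Int.floor_add_natCast] at this
  have h := emod_dec (flp p x j - z j) m
  have h0 := Int.emod_nonneg (flp p x j - z j) hm'.ne'
  have h3 := hx.2 j
  have e : flp p' x j - (z j - D) = m * ((flp p x j - z j) / m) + ((flp p x j - z j) % m + (D + flp p' x j - flp p x j)) := by
    linear_combination h
  rw [e]
  refine (emod_shift_le _ _ m hm (by omega)).trans_lt ?_
  push_cast
  omega

lemma disp_lo {d : ℕ} (S : Finset (Fin d → ℤ)) (m : ℕ) (hm : 0 < m) (p p' : (Fin d → ℤ) → Fin d → ℝ) (D : ℕ)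
    (h1 : ∀ x j, p' x j ≤ p x j) (h2 : ∀ x j, p x j ≤ p' x j + D) (z : Fin d → ℤ) (s : ℕ) (hs : D ≤ s) :
    wc S m (flp p') z (s - D) ≤ wc S m (flp p) z s := by
  unfold wc
  refine Finset.card_le_card fun x hx => ?_
  simp only [Finset.mem_filter] at hx ⊢
  refine ⟨hx.1, fun j => ?_⟩
  have hm' : (0:ℤ) < m := by exact_mod_cast hm
  have a1 : flp p' x j ≤ flp p x j := Int.floor_mono (h1 x j)
  have a2 : flp p x j ≤ flp p' x j + D := by
    have := Int.floor_mono (h2 x j)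
    rwa [Int.floor_add_natCast] at this
  have h := emod_dec (flp p' x j - z j) m
  have h0 := Int.emod_nonneg (flp p' x j - z j) hm'.ne'
  have h3 := hx.2 j
  have e : flp p x j - z j = m * ((flp p' x j - z j) / m) + ((flp p' x j - z j) % m + (flp p x j - flp p' x j)) := by
    linear_combination h
  rw [e]
  refine (emod_shift_le _ _ m hm (by omega)).trans_lt ?_
  push_cast [hs] at h3
  omega

lemma one_add_pow_le (q t : ℝ) (hq : 0 ≤ q) (h0 : 0 ≤ t) (h1 : t ≤ 1) (d : ℕ) : (1 + q * t)^d ≤ 1 + ((1 + q)^d - 1) * t := by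
  induction d with
  | zero => simp
  | succ d ih =>
    have h2 : 1 ≤ (1 + q)^d := one_le_pow₀ (by linarith)
    set X := (1+q)^d
    calc (1 + q*t)^(d+1) = (1+q*t)^d * (1 + q*t) := pow_succ _ _
      _ ≤ (1 + (X - 1) * t) * (1 + q * t) := by gcongr
      _ ≤ 1 + ((1+q)^(d+1) - 1) * t := by
        rw [pow_succ]
        have : q * (X-1) * t * t ≤ q * (X-1) * t * 1 := by
          apply mul_le_mul_of_nonneg_left h1
          have : 0 ≤ X - 1 := by linarith
          positivity
        nlinarith

lemma one_sub_pow_ge (q t : ℝ) (h1 : q * t ≤ 1) (d : ℕ) : 1 - d * q * t ≤ (1 - q * t)^d := by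
  have := one_add_mul_le_pow (a := -(q*t)) (by linarith) d
  calc _ = 1 + d * (-(q*t)) := by ring
    _ ≤ _ := this
    _ = _ := by ring
end

section
/-- per level error constant -/
noncomputable def cst (d : ℕ) (θ : ℝ) (K1 : ℕ) (B1 : ℝ) : ℝ :=
  (2 * (3 + 2 * K1) + 7 : ℕ)^d * Real.sqrt (2 * 3^d * (5^d / θ + d * 3^d) * B1)

lemma cst_nonneg (d : ℕ) (θ : ℝ) (K1 : ℕ) (B1 : ℝ) : 0 ≤ cst d θ K1 B1 := by unfold cst; positivity

lemma psupp_dist {d : ℕ} (R : ℕ) (hR : 0 < R) (x q : Fin d → ℤ) (hq : q ∈ psupp R x) : dist x (fun j => R * q j) ≤ 2 * R := by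
  refine (dist_pi_le_iff (by positivity)).2 fun j => ?_
  unfold psupp at hq
  rw [Fintype.mem_piFinset] at hq
  have h := Finset.mem_Icc.1 (hq j)
  have hR' : (0:ℤ) < R := by exact_mod_cast hR
  have e1 := Int.emod_add_mul_ediv (x j) R
  have a1 := Int.emod_nonneg (x j) hR'.ne'
  have a2 := Int.emod_lt_of_pos (x j) hR'
  rw [Int.dist_eq]
  have : |x j - R * q j| ≤ 2 * R := by
    rw [abs_le]
    constructor <;> nlinarith
  exact_mod_cast this

lemma twoe_le (d k e : ℕ) (hd : 1 ≤ d) (M : ℝ) (hM : 0 ≤ M) (he : 8 * d * e ≤ k) (h : (2:ℝ)^k ≤ M^d) : (2:ℝ)^e ≤ M := by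
  refine le_of_pow_le_pow_left₀ (n := d) (by omega) hM ?_
  refine le_trans ?_ h
  rw [← pow_mul]
  exact pow_le_pow_right₀ (by norm_num) (by nlinarith)

lemma step {d : ℕ} (hd : 1 ≤ d) {θ a b : ℝ} (hθ : 0 < θ) {l : ℕ} {M H : ℝ} {S : Finset (Fin d → ℤ)}
    {p0 : (Fin d → ℤ) → Fin d → ℝ} (I : Ini d θ a b l M H S p0) (k e : ℕ) (he : 8 * d * e ≤ k) (hk : k ≤ l) (hkM : (2:ℝ)^k ≤ M^d)
    (K1 : ℕ) (p : (Fin d → ℤ) → Fin d → ℝ)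
    (hp : ∀ x y j, |p x j - p y j| ≤ dist x y / M + 1 + K1 * (1/2)^e * dist x y)
    (B1 : ℝ) (hB1 : 0 ≤ B1)
    (hB : ∀ z, (wc S (2^l) (flp p) z ((2 * (3 + 2 * K1) + 1) * 2^k) : ℝ) ≤ B1 * H * (2^k)^d) (A B : ℝ)
    (hcase : (k = l ∧ A = 1 ∧ B = 1) ∨ (1 ≤ e ∧ ∀ z, A * H * (2^k)^d ≤ wc S (2^l) (flp p) z (2^k - 2 * 2^(k-e)) ∧
      (wc S (2^l) (flp p) z (2^k + 2^(k-e)) : ℝ) ≤ B * H * (2^k)^d)) :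
    ∃ u : (Fin d → ℤ) → Fin d → ℝ, (∀ x j, 0 ≤ u x j ∧ u x j ≤ 2^k) ∧
      (∀ x y j, |u x j - u y j| ≤ 4 * 3^d * (1/2)^e * dist x y) ∧
      Dens S (2^l) (fun x j => p x j + u x j) (2^(k-e)) (A - cst d θ K1 B1 * (1/2)^e) (B + cst d θ K1 B1 * (1/2)^e) H := by
  have hM0 : 0 < M := by linarith [I.hM]
  have hH0 : 0 < H := by linarith [I.hH]
  have hek : e ≤ k := by nlinarith
  have h2e := twoe_le d k e hd M hM0.le he hkM
  obtain ⟨f, hf⟩ : ∃ f, k = e + f := Nat.exists_eq_add_of_le hek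
  have hτ : k - e = f := by omega
  rw [hτ] at hcase ⊢
  have hhalf : (2:ℝ)^e * (1/2)^e = 1 := by rw [← mul_pow]; norm_num
  have hLτ : (2:ℝ)^f = 2^k * (1/2)^e := by
    rw [hf, pow_add]; linear_combination (-(2:ℝ)^f) * hhalf
  -- volumes
  set X : ℝ := (2^k)^d * (1/2)^(2 * e * (d+1)) with hX
  have hNle : 2 * e * (d + 1) ≤ k * d := by nlinarith
  obtain ⟨N, hN⟩ : ∃ N, k * d = 2 * e * (d+1) + N := Nat.exists_eq_add_of_le hNle
  have hXN : X = 2^N := by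
    rw [hX, ← pow_mul, hN, pow_add]
    have : (2:ℝ)^(2 * e * (d+1)) * (1/2)^(2 * e * (d+1)) = 1 := by rw [← mul_pow]; norm_num
    linear_combination (2:ℝ)^N * this
  have hX1 : 1 ≤ X := by rw [hXN]; exact one_le_pow₀ (by norm_num)
  have hX2 : ((2:ℝ)^(k+e) / M)^d ≤ X := by
    rw [div_pow, div_le_iff₀ (by positivity)]
    calc ((2:ℝ)^(k+e))^d ≤ 2^N * 2^k := by
          rw [← pow_mul, ← pow_add]
          refine pow_le_pow_right₀ (by norm_num) ?_
          nlinarith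
      _ ≤ X * M^d := by rw [hXN]; gcongr
  have hX3 : ((2:ℝ)^(k+e))^(d-1) ≤ X := by
    rw [hXN, ← pow_mul]
    refine pow_le_pow_right₀ (by norm_num) ?_
    obtain ⟨d', rfl⟩ : ∃ d', d = d' + 1 := ⟨d - 1, by omega⟩
    simp only [Nat.add_sub_cancel]
    nlinarith
  have hb0 : 0 < b := by linarith [I.ha, I.hab]
  have hμ : ∀ z : Fin d → ℤ, ((S.filter fun x => ∀ j, z j ≤ x j ∧ x j < z j + 3 * (2^(k+e) : ℕ)).card : ℝ) ≤ (5^d / θ + d * 3^d) * H * X := by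
    intro z
    have h1 := I.cube z (3 * 2^(k+e))
    push_cast at h1 ⊢
    refine h1.trans ?_
    have h2 : (3 * (2:ℝ)^(k+e) / M + 2)^d ≤ 5^d * X := by
      set Y := (2:ℝ)^(k+e) / M with hY
      have hY0 : 0 ≤ Y := by positivity
      calc (3 * (2:ℝ)^(k+e) / M + 2)^d = (3 * Y + 2)^d := by rw [hY]; ring
        _ ≤ (5 * max Y 1)^d := by
          gcongr
          have := le_max_left Y 1
          have := le_max_right Y 1
          linarith
        _ = 5^d * (max Y 1)^d := mul_pow _ _ _
        _ ≤ 5^d * X := by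
          gcongr
          rcases max_choice Y 1 with h | h <;> rw [h]
          · exact hX2
          · simpa using hX1
    have h3 : (3 * (2:ℝ)^(k+e))^(d-1) ≤ 3^d * (H * X) := by
      rw [mul_pow]
      have : X ≤ H * X := by nlinarith [I.hH]
      gcongr
      · norm_num
      · omega
      · exact hX3.trans this
    calc b * H * (3 * (2:ℝ)^(k+e) / M + 2)^d + d * (3 * (2:ℝ)^(k+e))^(d-1) ≤ (1 / θ) * H * (5^d * X) + d * (3^d * (H * X)) := by
          have := I.hb.le
          gcongr
      _ = _ := by ring
  have hvar : ∀ x q, q ∈ psupp (2^(k+e)) x → ∀ j, |p x j - p (fun j => (2^(k+e) : ℕ) * q j) j| ≤ (3 + 2 * K1 : ℕ) * (2^k : ℕ) := by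
    intro x q hq j
    have h1 := psupp_dist (2^(k+e)) (by positivity) x q hq
    refine (hp _ _ j).trans ?_
    set D := dist x (fun j => ((2^(k+e) : ℕ) : ℤ) * q j)
    push_cast at h1 ⊢
    have h2 : D / M ≤ 2 * 2^k := by
      rw [div_le_iff₀ hM0]
      calc D ≤ 2 * 2^(k+e) := h1
        _ = 2 * 2^k * 2^e := by rw [pow_add]; ring
        _ ≤ _ := by gcongr
    have h3 : (1/2:ℝ)^e * D ≤ 2 * 2^k := by
      calc (1/2:ℝ)^e * D ≤ (1/2)^e * (2 * 2^(k+e)) := by gcongr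
        _ = 2 * 2^k := by rw [pow_add]; linear_combination 2 * 2^k * hhalf
    have h4 : (1:ℝ) ≤ 2^k := one_le_pow₀ (by norm_num)
    have h5 : (K1:ℝ) * ((1/2:ℝ)^e * D) ≤ K1 * (2 * 2^k) := by gcongr
    linarith
  have hE : (2 * (3 + 2 * K1) + 7 : ℕ)^d * Real.sqrt (2 * ((5^d / θ + d * 3^d) * H * X) * (3^d * (B1 * H * (2^k)^d))) =
      cst d θ K1 B1 * (1/2)^e * H * ((2^f : ℕ):ℝ)^d := by
    have e1 : 2 * ((5^d / θ + d * 3^d) * H * X) * (3^d * (B1 * H * (2^k)^d)) =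
        (2 * 3^d * (5^d / θ + d * 3^d) * B1) * (H * (2^k)^d * (1/2)^(e * (d+1)))^2 := by
      rw [hX, mul_assoc 2 e, mul_comm 2 (e * (d+1)), pow_mul (1/2:ℝ) (e * (d+1)) 2]
      ring
    rw [e1, Real.sqrt_mul (by positivity), Real.sqrt_sq (by positivity)]
    unfold cst
    push_cast
    rw [hLτ, mul_pow, ← pow_mul (1/2:ℝ) e d, mul_add e, mul_one, pow_add (1/2:ℝ)]
    ring
  obtain ⟨u, hu1, hu2, hu3⟩ := level S p (2^l) (2^k) (2^f) (2^(k+e)) (2^(l-k)) (2^(l-f)) (3 + 2 * K1)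
    (by positivity) (by positivity) (by positivity) (by positivity)
    (by rw [← pow_add]; congr 1; omega) (by rw [← pow_add]; congr 1; omega)
    (Nat.pow_le_pow_right (by norm_num) (by omega)) hvar ((5^d / θ + d * 3^d) * H * X) (B1 * H * (2^k)^d) hμ hB
    (A * H * ((2^f : ℕ):ℝ)^d) (B * H * ((2^f : ℕ):ℝ)^d) (by
      rcases hcase with ⟨h1, rfl, rfl⟩ | ⟨h1, h2⟩
      · left
        subst h1
        have : (((2^f : ℕ):ℝ) / ((2^k : ℕ):ℝ))^d * (S.card : ℝ) = H * ((2^f : ℕ):ℝ)^d := by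
          rw [I.tot, div_pow]
          push_cast
          field_simp
        rw [this]
        exact ⟨rfl, by ring, by ring⟩
      · right
        refine ⟨?_, fun z => ?_⟩
        · rw [← pow_succ']
          exact Nat.pow_le_pow_right (by norm_num) (by omega)
        · have hq : ∀ Y : ℝ, Y * H * ((2^f : ℕ):ℝ)^d = (((2^f : ℕ):ℝ) / ((2^k : ℕ):ℝ))^d * (Y * H * (2^k)^d) := by
            intro Y
            rw [div_pow]
            push_cast
            field_simp
          rw [hq A, hq B]
          exact ⟨mul_le_mul_of_nonneg_left (h2 z).1 (by positivity), mul_le_mul_of_nonneg_left (h2 z).2 (by positivity)⟩)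
  refine ⟨u, fun x j => by simpa using hu1 x j, fun x y j => ?_, fun k' => ?_⟩
  · refine (hu2 x y j).trans (le_of_eq ?_)
    have : ((2^k : ℕ):ℝ) / ((2^(k+e) : ℕ):ℝ) = (1/2)^e := by
      push_cast
      rw [pow_add, one_div, inv_pow]
      field_simp
    rw [this]
  · have := hu3 k'
    rw [hE] at this
    constructor
    · refine le_trans (le_of_eq ?_) this.1
      ring
    · refine this.2.trans (le_of_eq ?_)
      ring
end

section
lemma Dens.mono {d : ℕ} {S : Finset (Fin d → ℤ)} {m : ℕ} {p : (Fin d → ℤ) → Fin d → ℝ} {τ : ℕ} {A B A' B' H : ℝ}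
    (h : Dens S m p τ A B H) (hH : 0 ≤ H) (hA : A' ≤ A) (hB : B ≤ B') : Dens S m p τ A' B' H := by
  intro k
  obtain ⟨h1, h2⟩ := h k
  refine ⟨le_trans ?_ h1, h2.trans ?_⟩
  all_goals gcongr

lemma sig_le (d k K : ℕ) (hd : 1 ≤ d) : ∑ i ∈ Finset.Ico k K, (1/2:ℝ)^(i / (8 * d)) ≤ 16 * d * (1/2)^(k / (8 * d)) := by
  rw [Finset.sum_Ico_eq_sum_range]
  have h := geo_sum (8 * d) (K - k)
  rw [if_neg (by omega), add_zero] at h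
  calc ∑ t ∈ Finset.range (K - k), (1/2:ℝ)^((k + t) / (8 * d)) ≤ ∑ t ∈ Finset.range (K - k), (1/2)^(k/(8*d)) * (1/2:ℝ)^(t / (8 * d)) := by
        refine Finset.sum_le_sum fun t _ => ?_
        rw [← pow_add]
        exact pow_le_pow_of_le_one (by norm_num) (by norm_num) Nat.div_add_div_le_add_div
    _ = (1/2)^(k/(8*d)) * ∑ t ∈ Finset.range (K - k), (1/2:ℝ)^(t / (8 * d)) := by rw [Finset.mul_sum]
    _ ≤ (1/2)^(k/(8*d)) * (2 * (8 * d : ℕ)) := by gcongr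
    _ = _ := by push_cast; ring

lemma pow_split (k e : ℕ) (h : e ≤ k) : (2:ℝ)^(k-e) = 2^k * (1/2)^e := by
  obtain ⟨f, rfl⟩ := Nat.exists_eq_add_of_le h
  rw [Nat.add_sub_cancel_left, pow_add]
  have hhalf : (2:ℝ)^e * (1/2)^e = 1 := by rw [← mul_pow]; norm_num
  linear_combination (-(2:ℝ)^f) * hhalf

lemma mid_case {d : ℕ} {S : Finset (Fin d → ℤ)} {p : (Fin d → ℤ) → Fin d → ℝ} {τ' : ℕ} {A B H G : ℝ} {l k e : ℕ} (C1 : ℕ)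
    (h : Dens S (2^l) p τ' A B H) (hτ0 : 0 < τ') (hτ : τ' ≤ 2 * 2^(k-e)) (hkl : k ≤ l) (he : 3 ≤ e) (hek : e ≤ k)
    (hA : 0 ≤ A) (hAG : A ≤ G) (hB : 0 ≤ B) (hBG : B ≤ G) (hH : 0 ≤ H) (z : Fin d → ℤ) :
    (wc S (2^l) (flp p) z ((2 * C1 + 1) * 2^k) : ℝ) ≤ G * (2 * C1 + 5)^d * H * (2^k)^d ∧
    (A - 6 * d * G * (1/2)^e) * H * (2^k)^d ≤ wc S (2^l) (flp p) z (2^k - 2 * 2^(k-e)) ∧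
    (wc S (2^l) (flp p) z (2^k + 2^(k-e)) : ℝ) ≤ (B + 6^d * G * (1/2)^e) * H * (2^k)^d := by
  have hs := pow_split k e hek
  set t : ℝ := (1/2)^e with ht
  have ht0 : 0 < t := by positivity
  have ht8 : t ≤ 1/8 := by
    calc t ≤ (1/2)^3 := pow_le_pow_of_le_one (by norm_num) (by norm_num) he
      _ = 1/8 := by norm_num
  have hτr : (τ':ℝ) ≤ 2 * (2^k * t) := by
    rw [← hs]; exact_mod_cast hτ
  have hL : (0:ℝ) < 2^k := by positivity
  set L : ℝ := 2^k with hLdef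
  have hG : 0 ≤ G := hA.trans hAG
  have h8 : 8 * 2^(k-e) ≤ 2^k := by
    calc 8 * 2^(k-e) = 2^(3 + (k-e)) := by rw [pow_add]; norm_num
      _ ≤ 2^k := Nat.pow_le_pow_right (by norm_num) (by omega)
  refine ⟨?_, ?_, ?_⟩
  · refine (dens_up h (by positivity) hτ0 (by positivity) z _).trans ?_
    push_cast
    rw [← hLdef]
    calc B * H * ((2 * C1 + 1) * L + 2 * τ')^d ≤ G * H * ((2 * C1 + 5) * L)^d := by
          gcongr
          nlinarith
      _ = _ := by rw [mul_pow]; ring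
  · have h2 : 2 * 2^(k-e) ≤ 2^k := by omega
    have hkl' : 2^k ≤ 2^l := Nat.pow_le_pow_right (by norm_num) hkl
    refine le_trans ?_ (dens_lo h (by positivity) hτ0 (by positivity) z _ (by omega) (by omega))
    rw [Nat.cast_sub h2]
    push_cast
    rw [← hLdef, hs]
    have h3 : A * (1 - d * 6 * t) ≤ A * (1 - 6 * t)^d := by
      refine mul_le_mul_of_nonneg_left (one_sub_pow_ge 6 t (by linarith) d) hA
    have h4 : A * (d * 6 * t) ≤ G * (d * 6 * t) := by gcongr
    calc (A - 6 * d * G * t) * H * L^d ≤ (A * (1 - 6 * t)^d) * H * L^d := by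
          gcongr
          linarith
      _ = A * H * (L - 6 * (L * t))^d := by rw [show L - 6 * (L*t) = L * (1 - 6 * t) by ring, mul_pow]; ring
      _ ≤ _ := by
          have : 0 ≤ L - 6 * (L * t) := by nlinarith
          refine mul_le_mul_of_nonneg_left (pow_le_pow_left₀ this ?_ d) (by positivity)
          linarith
  · refine (dens_up h (by positivity) hτ0 (by positivity) z _).trans ?_
    push_cast
    rw [← hLdef, hs]
    have h3 : B * (1 + 5 * t)^d ≤ B * (1 + ((1+5)^d - 1) * t) := 
      mul_le_mul_of_nonneg_left (one_add_pow_le 5 t (by norm_num) ht0.le (by linarith) d) hB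
    have h4 : B * (6^d * t) ≤ G * (6^d * t) := by gcongr
    have h5 : 0 ≤ B * t := by positivity
    norm_num at h3
    calc B * H * (L + L * t + 2 * τ')^d ≤ B * H * (L + 5 * (L * t))^d := by
          refine mul_le_mul_of_nonneg_left (pow_le_pow_left₀ (by positivity) ?_ d) (by positivity)
          linarith
      _ = B * (1 + 5 * t)^d * H * L^d := by rw [show L + 5 * (L*t) = L * (1 + 5 * t) by ring, mul_pow]; ring
      _ ≤ _ := by
          gcongr
          nlinarith

lemma Mp1 (d : ℕ) (hd : 1 ≤ d) (M : ℝ) (hM : 1 < M) : (M + 1)^(d-1) ≤ 2^d * M^d / M := by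
  obtain ⟨d', rfl⟩ : ∃ d', d = d' + 1 := ⟨d - 1, by omega⟩
  simp only [Nat.add_sub_cancel]
  calc (M+1)^d' ≤ (2 * M)^d' := by gcongr; linarith
    _ ≤ 2^(d'+1) * M^d' := by rw [mul_pow]; gcongr <;> norm_num
    _ = _ := by rw [pow_succ M]; field_simp

lemma top_case {d : ℕ} (hd : 1 ≤ d) {θ a b : ℝ} (hθ : 0 < θ) {l : ℕ} {M H : ℝ} {S : Finset (Fin d → ℤ)}
    {p0 : (Fin d → ℤ) → Fin d → ℝ} (I : Ini d θ a b l M H S p0) (k e : ℕ) (he : 3 ≤ e) (hek : e ≤ k) (hkl : k ≤ l)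
    (hM2 : M^d < 2^(k+1)) (heM : (2:ℝ)^e ≤ M) (C1 : ℕ) (z : Fin d → ℤ) :
    (wc S (2^l) (flp p0) z ((2 * C1 + 1) * 2^k) : ℝ) ≤ ((1/θ) * (2 * C1 + 1)^d + d * (2 * C1 + 1)^d * 2^(d+1)) * H * (2^k)^d ∧
    (a - 2 * d * (1/θ) * (1/2)^e) * H * (2^k)^d ≤ wc S (2^l) (flp p0) z (2^k - 2 * 2^(k-e)) ∧
    (wc S (2^l) (flp p0) z (2^k + 2^(k-e)) : ℝ) ≤ (b + (2^d * (1/θ) + 2 * d * 4^d) * (1/2)^e) * H * (2^k)^d := by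
  have hM0 : 0 < M := by linarith [I.hM]
  have hH := I.hH
  have ha0 : 0 < a := hθ.trans I.ha
  have hb0 : 0 < b := ha0.trans I.hab
  have hbθ := I.hb.le
  have haθ := I.hab.le.trans hbθ
  have hs := pow_split k e hek
  have hhalf : (2:ℝ)^e * (1/2)^e = 1 := by rw [← mul_pow]; norm_num
  set t : ℝ := (1/2)^e with ht
  have ht0 : 0 < t := by positivity
  have ht8 : t ≤ 1/8 := by
    calc t ≤ (1/2)^3 := pow_le_pow_of_le_one (by norm_num) (by norm_num) he
      _ = 1/8 := by norm_num
  have hM1 := Mp1 d hd M I.hM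
  have hL1 : (1:ℝ) ≤ 2^k := one_le_pow₀ (by norm_num)
  rw [pow_succ] at hM2
  set L : ℝ := 2^k with hLdef
  have hL : 0 < L := by linarith
  have hMinv : 1 / M ≤ t := by
    rw [div_le_iff₀ hM0]
    calc 1 = t * 2^e := by linarith
      _ ≤ t * M := by gcongr
  have hM3 : (M + 1)^(d-1) ≤ 2^(d+1) * L * t := by
    refine hM1.trans ?_
    calc 2^d * M^d / M = 2^d * M^d * (1 / M) := by ring
      _ ≤ 2^d * (L * 2) * t := by gcongr
      _ = _ := by rw [pow_succ]; ring
  have hLp : L^(d-1) * L = L^d := pow_sub_one_mul (by omega) L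
  have h8 : 8 * 2^(k-e) ≤ 2^k := by
    calc 8 * 2^(k-e) = 2^(3 + (k-e)) := by rw [pow_add]; norm_num
      _ ≤ 2^k := Nat.pow_le_pow_right (by norm_num) (by omega)
  have hLd : (0:ℝ) < L^d := by positivity
  have hHL : L^d ≤ H * L^d := by nlinarith
  refine ⟨?_, ?_, ?_⟩
  · refine (I.up z _).trans ?_
    push_cast
    rw [← hLdef]
    have h1 : ((2 * (C1:ℝ) + 1) * L * (M+1))^(d-1) ≤ (2 * C1 + 1)^d * 2^(d+1) * (H * L^d) := by
      rw [mul_pow, mul_pow]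
      calc (2 * (C1:ℝ) + 1)^(d-1) * L^(d-1) * (M+1)^(d-1) ≤ (2 * (C1:ℝ) + 1)^d * L^(d-1) * (2^(d+1) * L * 1) := by
            gcongr
            · linarith [show (0:ℝ) ≤ C1 from Nat.cast_nonneg _]
            · omega
            · exact hM3.trans (by gcongr; linarith)
        _ = (2 * (C1:ℝ) + 1)^d * 2^(d+1) * (L^(d-1) * L) := by ring
        _ ≤ _ := by rw [hLp]; gcongr
    have h2 : b * H * ((2 * (C1:ℝ) + 1) * L)^d ≤ (1/θ) * H * ((2 * (C1:ℝ) + 1) * L)^d := by gcongr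
    rw [mul_pow] at h2
    have h3 : (d:ℝ) * ((2 * (C1:ℝ) + 1) * L * (M+1))^(d-1) ≤ d * ((2 * C1 + 1)^d * 2^(d+1) * (H * L^d)) := by gcongr
    rw [mul_pow] 
    linarith
  · have h2 : 2 * 2^(k-e) ≤ 2^k := by omega
    have hkl' : 2^k ≤ 2^l := Nat.pow_le_pow_right (by norm_num) hkl
    refine le_trans ?_ (I.low z _ (by omega))
    rw [Nat.cast_sub h2]
    push_cast
    rw [← hLdef, hs]
    have h3 : a * (1 - d * 2 * t) ≤ a * (1 - 2 * t)^d := by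
      refine mul_le_mul_of_nonneg_left (one_sub_pow_ge 2 t (by linarith) d) ha0.le
    have h4 : a * (d * 2 * t) ≤ (1/θ) * (d * 2 * t) := by gcongr
    calc (a - 2 * d * (1/θ) * t) * H * L^d ≤ (a * (1 - 2 * t)^d) * H * L^d := by
          gcongr
          linarith
      _ = a * H * (L - 2 * (L * t))^d := by rw [show L - 2 * (L*t) = L * (1 - 2 * t) by ring, mul_pow]; ring
  · refine (I.up z _).trans ?_
    push_cast
    rw [← hLdef, hs]
    have h3 : b * (1 + 1 * t)^d ≤ b * (1 + ((1+1)^d - 1) * t) := 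
      mul_le_mul_of_nonneg_left (one_add_pow_le 1 t (by norm_num) ht0.le (by linarith) d) hb0.le
    have h4 : b * (2^d * t) ≤ (1/θ) * (2^d * t) := by gcongr
    have h5 : 0 ≤ b * t := by positivity
    norm_num at h3
    have h6 : b * (1 + t)^d ≤ b + 2^d * (1/θ) * t := by nlinarith
    have h7 : ((L + L * t) * (M+1))^(d-1) ≤ 2 * 4^d * t * (H * L^d) := by
      rw [mul_pow]
      calc (L + L * t)^(d-1) * (M+1)^(d-1) ≤ (2 * L)^(d-1) * (2^(d+1) * L * t) := by
            gcongr
            nlinarith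
        _ = 2^(d-1) * 2^(d+1) * t * (L^(d-1) * L) := by rw [mul_pow]; ring
        _ = 4^d * t * L^d := by
            rw [hLp, ← pow_add, show d - 1 + (d + 1) = 2 * d by omega, pow_mul]; norm_num
        _ ≤ 2 * 4^d * t * (H * L^d) := by
            have : 0 ≤ 4^d * t := by positivity
            nlinarith
    have h8 : (d:ℝ) * ((L + L * t) * (M+1))^(d-1) ≤ d * (2 * 4^d * t * (H * L^d)) := by gcongr
    have h9 : b * H * (L + L * t)^d ≤ (b + 2^d * (1/θ) * t) * (H * L^d) := by
      calc b * H * (L + L * t)^d = b * (1 + t)^d * (H * L^d) := by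
            rw [show L + L * t = L * (1 + t) by ring, mul_pow]; ring
        _ ≤ _ := by gcongr
    linarith
end

section
/-- constants -/
def kK (d : ℕ) : ℕ := 4 * 3^d * 16 * d
def kC1 (d : ℕ) : ℕ := 3 + 2 * kK d
noncomputable def kB1 (d : ℕ) (θ : ℝ) : ℝ :=
  1 + (1/θ + 2) * (2 * kC1 d + 5)^d + ((1/θ) * (2 * kC1 d + 1)^d + d * (2 * kC1 d + 1)^d * 2^(d+1))
noncomputable def kCase (d : ℕ) (θ : ℝ) : ℝ := (1/θ + 2) * (6^d + 6 * d) + 2 * d * 4^d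
noncomputable def kC (d : ℕ) (θ : ℝ) : ℝ := cst d θ (kK d) (kB1 d θ) + kCase d θ

lemma kC_nonneg (d : ℕ) {θ : ℝ} (hθ : 0 < θ) : 0 ≤ kC d θ := by
  have := cst_nonneg d θ (kK d) (kB1 d θ)
  unfold kC kCase; positivity

/-- partial sums -/
noncomputable def sg (d K k : ℕ) : ℝ := ∑ i ∈ Finset.Ico k (K+1), (1/2:ℝ)^(i / (8 * d))

lemma sg_nonneg (d K k : ℕ) : 0 ≤ sg d K k := Finset.sum_nonneg fun _ _ => by positivity
lemma sg_top (d K : ℕ) : sg d K (K+1) = 0 := by simp [sg]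
lemma sg_succ (d K k : ℕ) (h : k ≤ K) : sg d K k = (1/2)^(k / (8 * d)) + sg d K (k+1) := by
  unfold sg; rw [Finset.sum_eq_sum_Ico_succ_bot (by omega)]
lemma sg_le (d K k : ℕ) (hd : 1 ≤ d) : sg d K k ≤ 16 * d * (1/2)^(k / (8 * d)) := sig_le d k (K+1) hd

def St {d : ℕ} (l : ℕ) (M H : ℝ) (S : Finset (Fin d → ℤ)) (p0 : (Fin d → ℤ) → Fin d → ℝ) (C α0 β0 : ℝ) (K k : ℕ)
    (p : (Fin d → ℤ) → Fin d → ℝ) : Prop :=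
  (∀ x y j, |p x j - p y j| ≤ dist x y / M + 1 + 4 * 3^d * sg d K k * dist x y) ∧
  (∀ x j, p0 x j ≤ p x j ∧ p x j ≤ p0 x j + (2^(K+1) - 2^k)) ∧
  ∀ k', k ≤ k' → k' ≤ K → ∃ p', Dens S (2^l) p' (2^(k' - k' / (8 * d))) (α0 - C * sg d K k') (β0 + C * sg d K k') H ∧
    ∀ x j, p' x j ≤ p x j ∧ p x j ≤ p' x j + (2^k' - 2^k)

lemma iter {d : ℕ} (hd : 1 ≤ d) {θ a b : ℝ} (hθ : 0 < θ) (hθ1 : θ < 1) {l : ℕ} {M H : ℝ} {S : Finset (Fin d → ℤ)}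
    {p0 : (Fin d → ℤ) → Fin d → ℝ} (I : Ini d θ a b l M H S p0) (K : ℕ) (hKl : K ≤ l) (hKM : (2:ℝ)^K ≤ M^d)
    (α0 β0 : ℝ) (h0 : (K = l ∧ α0 = 1 ∧ β0 = 1) ∨ (M^d < 2^(K+1) ∧ α0 = a ∧ β0 = b))
    (k0 : ℕ) (hk0 : 24 * d ≤ k0) (hk1 : kC d θ * (16 * d) * (1/2)^(k0 / (8 * d)) ≤ θ / 2) :
    ∀ t k, k + t = K + 1 → k0 ≤ k → ∃ p, St l M H S p0 (kC d θ) α0 β0 K k p := by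
  have hM0 : 0 < M := by linarith [I.hM]
  have hH := I.hH
  have hθi : 1 < 1 / θ := by rw [lt_div_iff₀ hθ]; linarith
  have hα : θ ≤ α0 ∧ α0 ≤ 1 / θ ∧ 0 ≤ β0 ∧ β0 ≤ 1 / θ := by
    have := I.ha; have := I.hab; have := I.hb
    rcases h0 with ⟨-, rfl, rfl⟩ | ⟨-, rfl, rfl⟩ <;> refine ⟨?_, ?_, ?_, ?_⟩ <;> linarith
  have hC0 := kC_nonneg d hθ
  have hcst := cst_nonneg d θ (kK d) (kB1 d θ)
  intro t
  induction t with
  | zero =>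
    intro k hk _
    obtain rfl : k = K + 1 := by omega
    refine ⟨p0, ?_, ?_, ?_⟩
    · intro x y j
      rw [sg_top]
      simpa using I.lip x y j
    · intro x j; simp
    · intro k' h1 h2; omega
  | succ t ih =>
    intro k hk hkk
    have hkK : k ≤ K := by omega
    obtain ⟨p, hp1, hp2, hp3⟩ := ih (k+1) (by omega) (by omega)
    set e := k / (8 * d) with he
    have h8e : 8 * d * e ≤ k := Nat.mul_div_le k (8 * d)
    have he3 : 3 ≤ e := (Nat.le_div_iff_mul_le (by omega)).2 (by nlinarith)
    have hek : e ≤ k := by nlinarith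
    have hkM : (2:ℝ)^k ≤ M^d := (pow_le_pow_right₀ (by norm_num) hkK).trans hKM
    have hsg1 : sg d K (k+1) ≤ 16 * d * (1/2)^e := by
      have := sg_le d K k hd
      rw [sg_succ d K k hkK] at this
      have : (0:ℝ) < (1/2)^(k / (8 * d)) := by positivity
      linarith
    have hsgk := sg_succ d K k hkK
    have hsmall : kC d θ * sg d K (k+1) ≤ θ / 2 := by
      refine le_trans ?_ hk1
      rw [mul_assoc]
      refine mul_le_mul_of_nonneg_left (hsg1.trans ?_) hC0
      refine mul_le_mul_of_nonneg_left ?_ (by positivity)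
      exact pow_le_pow_of_le_one (by norm_num) (by norm_num) (Nat.div_le_div_right hkk)
    have hsg0 := sg_nonneg d K (k+1)
    have hp : ∀ x y j, |p x j - p y j| ≤ dist x y / M + 1 + (kK d : ℕ) * (1/2)^e * dist x y := by
      intro x y j
      refine (hp1 x y j).trans ?_
      have : 4 * 3^d * sg d K (k+1) ≤ (kK d : ℕ) * (1/2:ℝ)^e := by
        unfold kK
        push_cast
        calc 4 * 3^d * sg d K (k+1) ≤ 4 * 3^d * (16 * d * (1/2)^e) := by gcongr
          _ = _ := by ring
      gcongr
    have hkey : (∀ z, (wc S (2^l) (flp p) z ((2 * (3 + 2 * kK d) + 1) * 2^k) : ℝ) ≤ kB1 d θ * H * (2^k)^d) ∧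
        ∃ A B : ℝ, α0 - kC d θ * sg d K (k+1) - kCase d θ * (1/2)^e ≤ A ∧ B ≤ β0 + kC d θ * sg d K (k+1) + kCase d θ * (1/2)^e ∧
        ((k = l ∧ A = 1 ∧ B = 1) ∨ (1 ≤ e ∧ ∀ z, A * H * (2^k)^d ≤ wc S (2^l) (flp p) z (2^k - 2 * 2^(k-e)) ∧
      (wc S (2^l) (flp p) z (2^k + 2^(k-e)) : ℝ) ≤ B * H * (2^k)^d)) := by
      have hcase0 : 0 ≤ kCase d θ := by unfold kCase; positivity
      have htp : (0:ℝ) < (1/2)^e := by positivity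
      have g1 : (0:ℝ) ≤ (1/θ + 2) * (2 * kC1 d + 5)^d := by positivity
      have g2 : (0:ℝ) ≤ ((1/θ) * (2 * kC1 d + 1)^d + d * (2 * kC1 d + 1)^d * 2^(d+1)) := by positivity
      have hHL : (0:ℝ) ≤ H * (2^k)^d := by positivity
      have hmulB : ∀ c w : ℝ, c ≤ kB1 d θ → w ≤ c * H * (2^k)^d → w ≤ kB1 d θ * H * (2^k)^d := by
        intro c w h1 h2
        refine h2.trans ?_
        gcongr
      rcases hkK.eq_or_lt with rfl | hlt
      · have hpp : p = p0 := by
          funext x j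
          have := hp2 x j
          rw [sub_self, add_zero] at this
          exact le_antisymm this.2 this.1
        subst hpp
        rw [sg_top]
        rcases h0 with ⟨h1, rfl, rfl⟩ | ⟨h1, rfl, rfl⟩
        · refine ⟨fun z => ?_, 1, 1, ?_, ?_, Or.inl ⟨h1, rfl, rfl⟩⟩
          · refine hmulB 1 _ ?_ ?_
            · unfold kB1; linarith
            · rw [one_mul, h1, ← I.tot]
              unfold wc
              exact Nat.cast_le.2 (Finset.card_filter_le _ _)
          · nlinarith
          · nlinarith
        · have hh := top_case hd hθ I k e he3 hek hKl h1 (twoe_le d k e hd M hM0.le h8e hkM) (kC1 d)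
          refine ⟨fun z => ?_, _, _, ?_, ?_, Or.inr ⟨by omega, fun z => (hh z).2⟩⟩
          · refine hmulB _ _ ?_ (hh z).1
            unfold kB1; linarith
          · have : 2 * d * (1/θ) * (1/2)^e ≤ kCase d θ * (1/2)^e := by
              refine mul_le_mul_of_nonneg_right ?_ htp.le
              unfold kCase
              have : (0:ℝ) ≤ (1/θ) * 6^d + 2 * (6^d + 6 * d) + (1/θ) * (4 * d) + 2 * d * 4^d := by positivity
              linarith
            linarith
          · have : (2^d * (1/θ) + 2 * d * 4^d) * (1/2)^e ≤ kCase d θ * (1/2)^e := by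
              refine mul_le_mul_of_nonneg_right ?_ htp.le
              unfold kCase
              have h6 : (2:ℝ)^d ≤ 6^d := by gcongr; norm_num
              have : 2^d * (1/θ) ≤ 6^d * (1/θ) := by gcongr
              have : (0:ℝ) ≤ 2 * (6^d + 6 * d) + (1/θ) * (6 * d) := by positivity
              linarith
            linarith
      · obtain ⟨p', hD, hp'⟩ := hp3 (k+1) le_rfl (by omega)
        have hpp : p = p' := by
          funext x j
          have := hp' x j
          rw [sub_self, add_zero] at this
          exact le_antisymm this.2 this.1
        subst hpp
        have hτ : 2^(k + 1 - (k+1) / (8 * d)) ≤ 2 * 2^(k-e) := by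
          rw [← pow_succ']
          refine Nat.pow_le_pow_right (by norm_num) ?_
          have : e ≤ (k+1) / (8*d) := Nat.div_le_div_right (by omega)
          omega
        have hCs0 : 0 ≤ kC d θ * sg d K (k+1) := by positivity
        have hh := mid_case (G := 1/θ + 2) (kC1 d) hD (by positivity) hτ (by omega) he3 hek (by linarith) (by linarith) (by linarith) (by linarith) (by linarith)
        refine ⟨fun z => ?_, _, _, ?_, ?_, Or.inr ⟨by omega, fun z => (hh z).2⟩⟩
        · refine hmulB _ _ ?_ (hh z).1
          unfold kB1; linarith
        · have : 6 * d * (1/θ + 2) * (1/2)^e ≤ kCase d θ * (1/2)^e := by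
            refine mul_le_mul_of_nonneg_right ?_ htp.le
            unfold kCase
            have : (0:ℝ) ≤ (1/θ + 2) * 6^d + 2 * d * 4^d := by positivity
            linarith
          linarith
        · have : 6^d * (1/θ + 2) * (1/2)^e ≤ kCase d θ * (1/2)^e := by
            refine mul_le_mul_of_nonneg_right ?_ htp.le
            unfold kCase
            have : (0:ℝ) ≤ (1/θ + 2) * (6 * d) + 2 * d * 4^d := by positivity
            linarith
          linarith
    obtain ⟨hB, A, B, hA', hB', hcase⟩ := hkey
    have hB10 : 0 ≤ kB1 d θ := by unfold kB1; positivity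
    obtain ⟨u, hu1, hu2, hu3⟩ := step hd hθ I k e h8e (by omega) hkM (kK d) p hp (kB1 d θ) hB10 hB A B hcase
    have hpow : (2:ℝ)^(k+1) = 2 * 2^k := pow_succ' _ _
    refine ⟨fun x j => p x j + u x j, ?_, ?_, ?_⟩
    · intro x y j
      have h1 := hp1 x y j
      have h2 := hu2 x y j
      rw [hsgk]
      calc |p x j + u x j - (p y j + u y j)| = |(p x j - p y j) + (u x j - u y j)| := by congr 1; ring
        _ ≤ |p x j - p y j| + |u x j - u y j| := abs_add_le _ _
        _ ≤ _ := by linarith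
    · intro x j
      have h1 := hp2 x j
      have h2 := hu1 x j
      constructor <;> linarith
    · intro k' h1 h2
      rcases h1.eq_or_lt with rfl | h1
      · refine ⟨fun x j => p x j + u x j, hu3.mono (by linarith) ?_ ?_, fun x j => by simp⟩
        · rw [hsgk]
          have : kC d θ * (1/2)^e = cst d θ (kK d) (kB1 d θ) * (1/2)^e + kCase d θ * (1/2)^e := by unfold kC; ring
          rw [mul_add]
          linarith
        · rw [hsgk]
          have : kC d θ * (1/2)^e = cst d θ (kK d) (kB1 d θ) * (1/2)^e + kCase d θ * (1/2)^e := by unfold kC; ring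
          rw [mul_add]
          linarith
      · obtain ⟨p', h3, h4⟩ := hp3 k' h1 h2
        refine ⟨p', h3, fun x j => ?_⟩
        have h5 := h4 x j
        have h6 := hu1 x j
        constructor <;> linarith
end

section
noncomputable def kQ (d : ℕ) (θ : ℝ) : ℝ := kC d θ * (16 * d) + (1/θ + 2) * (4^d + 3 * d) + d * 4^d

lemma exists_K (d l : ℕ) (M : ℝ) (hM : 1 < M) : ∃ K, K ≤ l ∧ (2:ℝ)^K ≤ M^d ∧ (K = l ∨ (K < l ∧ M^d < 2^(K+1))) := by
  induction l with
  | zero => exact ⟨0, le_rfl, by simpa using one_le_pow₀ hM.le, Or.inl rfl⟩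
  | succ l ih =>
    obtain ⟨K, h1, h2, h3⟩ := ih
    rcases h3 with rfl | h3
    · rcases le_or_gt ((2:ℝ)^(K+1)) (M^d) with h | h
      · exact ⟨K+1, le_rfl, h, Or.inl rfl⟩
      · exact ⟨K, by omega, h2, Or.inr ⟨by omega, h⟩⟩
    · exact ⟨K, by omega, h2, Or.inr ⟨by omega, h3.2⟩⟩

lemma win1 {d : ℕ} {S : Finset (Fin d → ℤ)} {p p' : (Fin d → ℤ) → Fin d → ℝ} {A B H G : ℝ} {l k e i : ℕ}
    (h : Dens S (2^l) p' (2^(k-e)) A B H) (he : 1 ≤ e) (hek : e ≤ k) (hk2 : 2 ≤ k) (hki : 2 * k ≤ i) (hil : i ≤ l)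
    (h1 : ∀ x j, p' x j ≤ p x j) (h2 : ∀ x j, p x j ≤ p' x j + 2^k)
    (hA : 0 ≤ A) (hAG : A ≤ G) (hB : 0 ≤ B) (hBG : B ≤ G) (hH : 0 ≤ H) (z : Fin d → ℤ) :
    (A - 3 * d * G * (1/2)^e) * H * (2^i)^d ≤ wc S (2^l) (flp p) z (2^i) ∧
    (wc S (2^l) (flp p) z (2^i) : ℝ) ≤ (B + 4^d * G * (1/2)^e) * H * (2^i)^d := by
  have hhalf : (2:ℝ)^k * (1/2)^k = 1 := by rw [← mul_pow]; norm_num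
  have htk : (1/2:ℝ)^k ≤ (1/2)^e := pow_le_pow_of_le_one (by norm_num) (by norm_num) hek
  set t : ℝ := (1/2)^e with ht
  have ht0 : 0 < t := by positivity
  have ht1 : t ≤ 1 := pow_le_one₀ (by norm_num) (by norm_num)
  have hsr : (0:ℝ) < 2^i := by positivity
  have hks : (2:ℝ)^k ≤ 2^i * (1/2)^k := by
    have : (2:ℝ)^k * 2^k ≤ 2^i := by rw [← pow_add]; exact pow_le_pow_right₀ (by norm_num) (by omega)
    calc (2:ℝ)^k = 2^k * 2^k * (1/2)^k := by linear_combination -(2:ℝ)^k * hhalf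
      _ ≤ _ := by gcongr
  set w : ℝ := (1/2)^k with hw
  have hw0 : 0 < w := by positivity
  have hw4 : w ≤ 1/4 := by
    calc w ≤ (1/2)^2 := pow_le_pow_of_le_one (by norm_num) (by norm_num) hk2
      _ = 1/4 := by norm_num
  have hG : 0 ≤ G := hA.trans hAG
  have hτ : 2 * 2^(k-e) ≤ 2^k := by
    rw [← pow_succ']; exact Nat.pow_le_pow_right (by norm_num) (by omega)
  have hτr : (2:ℝ) * 2^(k-e) ≤ 2^k := by exact_mod_cast hτ
  have hik : 4 * 2^k ≤ 2^i := by
    calc 4 * 2^k = 2^(2 + k) := by rw [pow_add]; norm_num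
      _ ≤ 2^i := Nat.pow_le_pow_right (by norm_num) (by omega)
  have hil' : 2^i ≤ 2^l := Nat.pow_le_pow_right (by norm_num) hil
  have h2' : ∀ x j, p x j ≤ p' x j + ((2^k : ℕ):ℝ) := by intro x j; push_cast; exact h2 x j
  set s : ℝ := 2^i with hs
  constructor
  · have a1 := disp_lo S (2^l) (by positivity) p p' (2^k) h1 h2' z (2^i) (by omega)
    have a2 := dens_lo h (by positivity) (by positivity) (by positivity) z (2^i - 2^k) (by omega) (by omega)
    rw [Nat.cast_sub (by omega)] at a2
    push_cast at a2
    rw [← hs] at a2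
    refine le_trans ?_ (a2.trans (Nat.cast_le.2 a1))
    have h3 : A * (1 - d * 2 * w) ≤ A * (1 - 2 * w)^d := by
      refine mul_le_mul_of_nonneg_left (one_sub_pow_ge 2 w (by linarith) d) hA
    have h4 : A * (d * 2 * w) ≤ G * (d * 3 * t) := by gcongr; norm_num
    calc (A - 3 * d * G * t) * H * s^d ≤ (A * (1 - 2 * w)^d) * H * s^d := by
          gcongr
          linarith
      _ = A * H * (s - 2 * (s * w))^d := by rw [show s - 2 * (s*w) = s * (1 - 2 * w) by ring, mul_pow]; ring
      _ ≤ _ := by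
          have : 0 ≤ s - 2 * (s * w) := by nlinarith
          refine mul_le_mul_of_nonneg_left (pow_le_pow_left₀ this ?_ d) (by positivity)
          linarith
  · have a1 := disp_up S (2^l) (by positivity) p p' (2^k) h1 h2' z (2^i)
    have a2 := dens_up h (by positivity) (by positivity) (by positivity) (fun j => z j - (2^k : ℕ)) (2^i + 2^k)
    push_cast at a2
    rw [← hs] at a2
    refine (Nat.cast_le.2 a1).trans ?_
    push_cast
    refine a2.trans ?_
    have h3 : B * (1 + 3 * t)^d ≤ B * (1 + ((1+3)^d - 1) * t) := 
      mul_le_mul_of_nonneg_left (one_add_pow_le 3 t (by norm_num) ht0.le ht1 d) hB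
    have h4 : B * (4^d * t) ≤ G * (4^d * t) := by gcongr
    have h5 : 0 ≤ B * t := by positivity
    norm_num at h3
    have hst : s * w ≤ s * t := by gcongr
    have hst0 : 0 < s * t := by positivity
    calc B * H * (s + 2^k + 2 * 2^(k-e))^d ≤ B * H * (s + 3 * (s * t))^d := by
          refine mul_le_mul_of_nonneg_left (pow_le_pow_left₀ (by positivity) ?_ d) (by positivity)
          linarith
      _ = B * (1 + 3 * t)^d * H * s^d := by rw [show s + 3 * (s*t) = s * (1 + 3 * t) by ring, mul_pow]; ring
      _ ≤ _ := by
          gcongr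
          nlinarith

lemma win2 {d : ℕ} (hd : 1 ≤ d) {θ a b : ℝ} (hθ : 0 < θ) {l : ℕ} {M H : ℝ} {S : Finset (Fin d → ℤ)}
    {p0 p : (Fin d → ℤ) → Fin d → ℝ} (I : Ini d θ a b l M H S p0) {k e i : ℕ}
    (hek : e ≤ k) (hk2 : 2 ≤ k) (hki : 2 * k ≤ i) (hil : i ≤ l)
    (h1 : ∀ x j, p0 x j ≤ p x j) (h2 : ∀ x j, p x j ≤ p0 x j + 2^k) (hM2 : M^d ≤ 2^k) (z : Fin d → ℤ) :
    (a - d * (1/θ) * (1/2)^e) * H * (2^i)^d ≤ wc S (2^l) (flp p) z (2^i) ∧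
    (wc S (2^l) (flp p) z (2^i) : ℝ) ≤ (b + (2^d * (1/θ) + d * 4^d) * (1/2)^e) * H * (2^i)^d := by
  have hM0 : 0 < M := by linarith [I.hM]
  have hH := I.hH
  have ha0 : 0 < a := hθ.trans I.ha
  have hb0 : 0 < b := ha0.trans I.hab
  have hbθ := I.hb.le
  have haθ := I.hab.le.trans hbθ
  have hhalf : (2:ℝ)^k * (1/2)^k = 1 := by rw [← mul_pow]; norm_num
  have htk : (1/2:ℝ)^k ≤ (1/2)^e := pow_le_pow_of_le_one (by norm_num) (by norm_num) hek
  set t : ℝ := (1/2)^e with ht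
  have ht0 : 0 < t := by positivity
  have ht1 : t ≤ 1 := pow_le_one₀ (by norm_num) (by norm_num)
  have hsr : (0:ℝ) < 2^i := by positivity
  have hks : (2:ℝ)^k ≤ 2^i * (1/2)^k := by
    have : (2:ℝ)^k * 2^k ≤ 2^i := by rw [← pow_add]; exact pow_le_pow_right₀ (by norm_num) (by omega)
    calc (2:ℝ)^k = 2^k * 2^k * (1/2)^k := by linear_combination -(2:ℝ)^k * hhalf
      _ ≤ _ := by gcongr
  set w : ℝ := (1/2)^k with hw
  have hw0 : 0 < w := by positivity
  have hw4 : w ≤ 1/4 := by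
    calc w ≤ (1/2)^2 := pow_le_pow_of_le_one (by norm_num) (by norm_num) hk2
      _ = 1/4 := by norm_num
  have hik : 4 * 2^k ≤ 2^i := by
    calc 4 * 2^k = 2^(2 + k) := by rw [pow_add]; norm_num
      _ ≤ 2^i := Nat.pow_le_pow_right (by norm_num) (by omega)
  have hil' : 2^i ≤ 2^l := Nat.pow_le_pow_right (by norm_num) hil
  have h2' : ∀ x j, p x j ≤ p0 x j + ((2^k : ℕ):ℝ) := by intro x j; push_cast; exact h2 x j
  set s : ℝ := 2^i with hs
  have hst : s * w ≤ s * t := by gcongr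
  constructor
  · have a1 := disp_lo S (2^l) (by positivity) p p0 (2^k) h1 h2' z (2^i) (by omega)
    have a2 := I.low z (2^i - 2^k) (by omega)
    rw [Nat.cast_sub (by omega)] at a2
    push_cast at a2
    rw [← hs] at a2
    refine le_trans ?_ (a2.trans (Nat.cast_le.2 a1))
    have h3 : a * (1 - d * 1 * w) ≤ a * (1 - 1 * w)^d := by
      refine mul_le_mul_of_nonneg_left (one_sub_pow_ge 1 w (by linarith) d) ha0.le
    have h4 : a * (d * w) ≤ (1/θ) * (d * t) := by gcongr
    rw [one_mul] at h3
    calc (a - d * (1/θ) * t) * H * s^d ≤ (a * (1 - w)^d) * H * s^d := by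
          gcongr
          linarith
      _ = a * H * (s - s * w)^d := by rw [show s - s*w = s * (1 - w) by ring, mul_pow]; ring
      _ ≤ _ := by
          have : 0 ≤ s - s * w := by nlinarith
          refine mul_le_mul_of_nonneg_left (pow_le_pow_left₀ this ?_ d) (by positivity)
          linarith
  · have a1 := disp_up S (2^l) (by positivity) p p0 (2^k) h1 h2' z (2^i)
    have a2 := I.up (fun j => z j - (2^k : ℕ)) (2^i + 2^k)
    push_cast at a2
    rw [← hs] at a2
    refine (Nat.cast_le.2 a1).trans ?_
    push_cast
    refine a2.trans ?_
    have h3 : b * (1 + 1 * t)^d ≤ b * (1 + ((1+1)^d - 1) * t) := 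
      mul_le_mul_of_nonneg_left (one_add_pow_le 1 t (by norm_num) ht0.le ht1 d) hb0.le
    have h4 : b * (2^d * t) ≤ (1/θ) * (2^d * t) := by gcongr
    have h5 : 0 ≤ b * t := by positivity
    norm_num at h3
    have h6 : b * (1 + t)^d ≤ b + 2^d * (1/θ) * t := by nlinarith
    have hsk : (s:ℝ) + 2^k ≤ s * (1 + t) := by linarith
    have hLp : s^(d-1) * s = s^d := pow_sub_one_mul (by omega) s
    have hM3 : (M+1)^(d-1) ≤ 2^d * (s * t) := by
      refine (Mp1 d hd M I.hM).trans ?_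
      rw [div_le_iff₀ hM0]
      calc 2^d * M^d ≤ 2^d * (s * t) * 1 := by rw [mul_one]; gcongr; linarith
        _ ≤ _ := by gcongr; exact I.hM.le
    have hHs : s^d ≤ H * s^d := by
      have : 0 < s^d := by positivity
      nlinarith
    have h7 : ((s + 2^k) * (M+1))^(d-1) ≤ 4^d * t * (H * s^d) := by
      rw [mul_pow]
      calc (s + 2^k)^(d-1) * (M+1)^(d-1) ≤ (2 * s)^(d-1) * (2^d * (s * t)) := by
            gcongr
            nlinarith
        _ = 2^(d-1) * 2^d * t * (s^(d-1) * s) := by rw [mul_pow]; ring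
        _ ≤ 2^d * 2^d * t * s^d := by
            rw [hLp]; gcongr
            · norm_num
            · omega
        _ = 4^d * t * s^d := by rw [← mul_pow]; norm_num
        _ ≤ _ := by gcongr
    have h8 : (d:ℝ) * ((s + 2^k) * (M+1))^(d-1) ≤ d * (4^d * t * (H * s^d)) := by gcongr
    have h9 : b * H * (s + 2^k)^d ≤ (b + 2^d * (1/θ) * t) * (H * s^d) := by
      calc b * H * (s + 2^k)^d ≤ b * H * (s * (1 + t))^d := by gcongr
        _ = b * (1 + t)^d * (H * s^d) := by rw [mul_pow]; ring
        _ ≤ _ := by gcongr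
    linarith

theorem thmA (d : ℕ) (hd : 1 ≤ d) (θ : ℝ) (hθ : 0 < θ) (hθ1 : θ < 1) : ThmA d θ := by
  have hC0 := kC_nonneg d hθ
  have hQ0 : 0 < kQ d θ := by unfold kQ; positivity
  obtain ⟨E1, hE1⟩ := exists_pow_lt_of_lt_one (show 0 < θ / 2 / kQ d θ by positivity) (show (1/2:ℝ) < 1 by norm_num)
  set E := max E1 3 with hE
  have hEQ : kQ d θ * (1/2)^E ≤ θ / 2 := by
    have : (1/2:ℝ)^E ≤ (1/2)^E1 := pow_le_pow_of_le_one (by norm_num) (by norm_num) (le_max_left _ _)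
    have := this.trans hE1.le
    rwa [le_div_iff₀ hQ0, mul_comm] at this
  have hE3 : 3 ≤ E := le_max_right _ _
  set k0 := 8 * d * E with hk0
  have hk0E : k0 / (8 * d) = E := Nat.mul_div_cancel_left _ (by omega)
  have hCQ : kC d θ * (16 * d) ≤ kQ d θ := by
    unfold kQ
    have : 0 ≤ (1/θ + 2) * (4^d + 3 * d) + d * 4^d := by positivity
    linarith
  have hk1 : kC d θ * (16 * d) * (1/2)^(k0 / (8 * d)) ≤ θ / 2 := by
    rw [hk0E]
    refine le_trans ?_ hEQ
    gcongr
  have hk24 : 24 * d ≤ k0 := by rw [hk0]; nlinarith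
  refine ⟨2 * kQ d θ + 3 + 4 * 3^d * (16 * d), 2 * k0, by positivity, ?_⟩
  intro m n l a b c S hyp
  have I := Ini_of_Hyp hθ hyp
  have hml := hyp.1
  set M : ℝ := c * n / m with hMdef
  set H : ℝ := ((n:ℝ) / m)^d with hHdef
  set p0 : (Fin d → ℤ) → Fin d → ℝ := fun x j => (bx M (x j) : ℝ) with hp0
  obtain ⟨K, hKl, hKM, hK⟩ := exists_K d l M I.hM
  have hM0 : 0 < M := by linarith [I.hM]
  have hH := I.hH
  have hθi : 1 < 1 / θ := by rw [lt_div_iff₀ hθ]; linarith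
  obtain ⟨α0, β0, h0, hKα⟩ : ∃ α0 β0 : ℝ, ((K = l ∧ α0 = 1 ∧ β0 = 1) ∨ (M^d < 2^(K+1) ∧ α0 = a ∧ β0 = b)) ∧
      (K < l → M^d < 2^(K+1) ∧ α0 = a ∧ β0 = b) := by
    rcases hK with h | h
    · exact ⟨1, 1, Or.inl ⟨h, rfl, rfl⟩, fun h' => by omega⟩
    · exact ⟨a, b, Or.inr ⟨h.2, rfl, rfl⟩, fun h' => ⟨h.2, rfl, rfl⟩⟩
  have hα : θ ≤ α0 ∧ α0 ≤ 1 / θ ∧ 0 ≤ β0 ∧ β0 ≤ 1 / θ ∧ β0 ≤ α0 + (b - a) := by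
    have := I.ha; have := I.hab; have := I.hb
    rcases h0 with ⟨-, rfl, rfl⟩ | ⟨-, rfl, rfl⟩ <;> refine ⟨?_, ?_, ?_, ?_, ?_⟩ <;> linarith
  obtain ⟨kb, p, hkb0, hkbK, hp1, hp2, hp3⟩ : ∃ kb p, kb ≤ k0 ∧ kb ≤ K + 1 ∧ St l M H S p0 (kC d θ) α0 β0 K kb p := by
    rcases le_or_gt k0 (K+1) with h | h
    · obtain ⟨p, hp⟩ := iter hd hθ hθ1 I K hKl hKM α0 β0 h0 k0 hk24 hk1 (K + 1 - k0) k0 (by omega) le_rfl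
      exact ⟨k0, p, le_rfl, h, hp⟩
    · refine ⟨K+1, p0, h.le, le_rfl, ?_, ?_, ?_⟩
      · intro x y j
        rw [sg_top]
        simpa using I.lip x y j
      · intro x j; simp
      · intro k' h1 h2; omega
  refine ⟨flp p, ?_, ?_⟩
  · intro x y j
    rcases eq_or_ne x y with rfl | hne
    · simp
    have hD := one_le_dist hne
    have h1 := hp1 x y j
    have f1 := Int.floor_le (p x j)
    have f2 := Int.lt_floor_add_one (p x j)
    have f3 := Int.floor_le (p y j)
    have f4 := Int.lt_floor_add_one (p y j)
    have h2 : |((flp p x j : ℤ):ℝ) - flp p y j| ≤ |p x j - p y j| + 1 := by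
      unfold flp
      have := le_abs_self (p x j - p y j)
      have := neg_abs_le (p x j - p y j)
      rw [abs_le]
      constructor <;> linarith
    have h3 : dist x y / M ≤ dist x y := div_le_self dist_nonneg I.hM.le
    have h4 : sg d K kb ≤ 16 * d := by
      refine (sg_le d K kb hd).trans ?_
      have : (1/2:ℝ)^(kb / (8*d)) ≤ 1 := pow_le_one₀ (by norm_num) (by norm_num)
      have : (16 * d : ℝ) * (1/2:ℝ)^(kb / (8*d)) ≤ 16 * d * 1 := by gcongr
      linarith
    have h5 : 4 * 3^d * sg d K kb * dist x y ≤ 4 * 3^d * (16 * d) * dist x y := by gcongr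
    have h6 : 0 ≤ 2 * kQ d θ * dist x y := by positivity
    calc _ ≤ _ := h2
      _ ≤ dist x y + 2 * dist x y + 4 * 3^d * (16 * d) * dist x y := by linarith
      _ ≤ _ := by linarith
  · intro i hi hil
    set k := i / 2 with hk
    have hkk0 : k0 ≤ k := by omega
    have hki : 2 * k ≤ i := by omega
    have hek : k / (8 * d) = i / (16 * d) := by
      rw [hk, Nat.div_div_eq_div_mul]; congr 1; ring
    set e := k / (8 * d) with he
    rw [← hek]
    have heE : E ≤ e := by rw [← hk0E]; exact Nat.div_le_div_right hkk0
    have h8e : 8 * d * e ≤ k := Nat.mul_div_le k (8 * d)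
    have hek' : e ≤ k := by nlinarith
    have htp : (0:ℝ) < (1/2)^e := by positivity
    have hQt : kQ d θ * (1/2)^e ≤ θ / 2 := by
      refine le_trans ?_ hEQ
      gcongr ?_ * ?_
      exact pow_le_pow_of_le_one (by norm_num) (by norm_num) heE
    have hk2 : 2 ≤ k := by omega
    refine ⟨α0 - kQ d θ * (1/2)^e, β0 + kQ d θ * (1/2)^e, by linarith, ?_, ?_⟩
    · have : 0 ≤ (3 + 4 * 3^d * (16 * d)) * (1/2:ℝ)^e := by positivity
      linarith
    intro z
    have hfin : ∀ A B : ℝ, α0 - kQ d θ * (1/2)^e ≤ A → B ≤ β0 + kQ d θ * (1/2)^e →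
        (A * H * (2^i)^d ≤ wc S (2^l) (flp p) z (2^i) ∧ (wc S (2^l) (flp p) z (2^i) : ℝ) ≤ B * H * (2^i)^d) →
        ((α0 - kQ d θ * (1/2)^e) * H * (2^i)^d ≤ wc S m (flp p) z (2^i) ∧ (wc S m (flp p) z (2^i) : ℝ) ≤ (β0 + kQ d θ * (1/2)^e) * H * (2^i)^d) := by
      intro A B hA hB hh
      rw [hml]
      refine ⟨le_trans ?_ hh.1, hh.2.trans ?_⟩ <;> gcongr
    have hkbpos : (0:ℝ) < 2^kb := by positivity
    rcases le_or_gt k K with hkK | hkK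
    · obtain ⟨p', hD, hp'⟩ := hp3 k (by omega) hkK
      have hsg : kC d θ * sg d K k ≤ kC d θ * (16 * d) * (1/2)^e := by
        rw [mul_assoc]
        exact mul_le_mul_of_nonneg_left (sg_le d K k hd) hC0
      have hsg' : kC d θ * (16 * d) * (1/2)^e ≤ kQ d θ * (1/2)^e := by gcongr
      have hsg0 : 0 ≤ kC d θ * sg d K k := mul_nonneg hC0 (sg_nonneg d K k)
      have hh := win1 (G := 1/θ + 2) (i := i) hD (by omega) hek' hk2 hki hil.le (fun x j => (hp' x j).1) (fun x j => by have := (hp' x j).2; linarith)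
        (by linarith) (by linarith) (by linarith) (by linarith) (by linarith) z
      have hQe : kQ d θ * (1/2)^e = kC d θ * (16 * d) * (1/2)^e + 4^d * (1/θ + 2) * (1/2)^e + 3 * d * (1/θ + 2) * (1/2)^e + d * 4^d * (1/2)^e := by
        unfold kQ; ring
      have g1 : 0 ≤ 4^d * (1/θ + 2) * (1/2)^e := by positivity
      have g2 : 0 ≤ 3 * d * (1/θ + 2) * (1/2)^e := by positivity
      have g3 : 0 ≤ d * 4^d * (1/2:ℝ)^e := by positivity
      exact hfin _ _ (by linarith) (by linarith) hh
    · obtain ⟨hM2, rfl, rfl⟩ := hKα (by omega)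
      have hKk : (2:ℝ)^(K+1) ≤ 2^k := pow_le_pow_right₀ (by norm_num) (by omega)
      have hh := win2 hd hθ I (e := e) (k := k) (i := i) hek' hk2 hki hil.le (fun x j => (hp2 x j).1) (fun x j => by have := (hp2 x j).2; linarith)
        (by linarith) z
      have hQe : kQ d θ * (1/2)^e = kC d θ * (16 * d) * (1/2)^e + 4^d * (1/θ) * (1/2)^e + 2 * 4^d * (1/2)^e + 3 * d * (1/θ) * (1/2)^e + 6 * d * (1/2)^e + d * 4^d * (1/2)^e := by
        unfold kQ; ring
      have g0 : 0 ≤ kC d θ * (16 * d) * (1/2)^e := by positivity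
      have g1 : 2^d * (1/θ) * (1/2)^e ≤ 4^d * (1/θ) * (1/2)^e := by gcongr; norm_num
      have g2 : 0 ≤ d * (1/θ) * (1/2)^e := by positivity
      have g3 : 0 ≤ d * 4^d * (1/2:ℝ)^e := by positivity
      have g4 : 0 ≤ 2 * 4^d * (1/2:ℝ)^e := by positivity
      have g5 : 0 ≤ 6 * d * (1/2:ℝ)^e := by positivity
      have g6 : 0 ≤ 4^d * (1/θ) * (1/2)^e := by positivity
      exact hfin _ _ (by linarith) (by linarith) hh
end

/-- A set of `n^d` lattice points in `[0, cn]^d` whose number of points in each cube of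
the rescaled dyadic partition `c·n·𝒯_m` (`m = 2^l`) lies between `a·n^d/m^d` and
`b·n^d/m^d` admits a bijection onto `{1,…,n}^d` with Lipschitz constant at most
`Λ·2^(log₂ n − l·(1 − Δ·(b − a)))`. -/
theorem stmt_4 (d : ℕ) (hd : 1 ≤ d) (θ : ℝ) (hθ0 : 0 < θ) (hθ1 : θ < 1) :
    ∃ Λ : ℝ, 0 < Λ ∧ ∃ Δ : ℝ, 0 < Δ ∧
      ∀ (m n l : ℕ) (a b c : ℝ) (S : Finset (Fin d → ℤ)),
        m = 2 ^ l → m ≤ n → θ < a → a < b → b < 1 / θ → 1 < c →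
        (∀ x ∈ S, ∀ i, (0 : ℝ) ≤ (x i : ℝ) ∧ (x i : ℝ) ≤ c * n) →
        S.card = n ^ d →
        (∀ p : Fin d → Fin m,
          a * n ^ d / m ^ d ≤
            (Set.ncard {x | x ∈ S ∧ ∀ i,
              c * n * (p i : ℕ) / m < (x i : ℝ) ∧
              (x i : ℝ) ≤ c * n * ((p i : ℕ) + 1) / m} : ℝ) ∧
          (Set.ncard {x | x ∈ S ∧ ∀ i,
              c * n * (p i : ℕ) / m < (x i : ℝ) ∧
              (x i : ℝ) ≤ c * n * ((p i : ℕ) + 1) / m} : ℝ) ≤ b * n ^ d / m ^ d) →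
        ∃ g : (Fin d → ℤ) → (Fin d → ℤ),
          Set.BijOn g ↑S {y : Fin d → ℤ | ∀ i, 1 ≤ y i ∧ y i ≤ (n : ℤ)} ∧
          ∀ x ∈ S, ∀ y ∈ S,
            zdist (g x) (g y) ≤
              Λ * (2 : ℝ) ^ (Real.logb 2 n - l * (1 - Δ * (b - a))) * zdist x y := by
  obtain ⟨Λ, hΛ, Δ, hΔ, h⟩ := main_of_A d hd θ hθ0 (thmA d hd θ hθ0 hθ1)
  exact ⟨Λ, hΛ, Δ, hΔ, fun m n l a b c S h1 h2 h3 h4 h5 h6 h7 h8 h9 =>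
    h m n l a b c S ⟨h1, h2, h3, h4, h5, h6, h7, h8, h9⟩⟩
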